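/- Moser estimate at the boundary: let p > 0 and let B be a ball centered on Γ. Let u ∈ W_r(2B) be a nonnegative subsolution of Lu = 0 in 2B ∖ Γ such that Tu = 0 σ-almost everywhere on Γ ∩ 2B. Then ess sup_B u ≤ C_p ( m(2B)^{−1} ∫_{2B} u^p dm )^{1/p}, where C_p > 0 depends only on n, d, C₀, C₁, and p. -/

import Mathlib

open MeasureTheory Metric Set Filter
open scoped ENNReal NNReal Topology

noncomputable section

/-- Euclidean space `ℝⁿ`. -/
abbrev Euc (n : ℕ) := EuclideanSpace ℝ (Fin n)

/-- `Γ ⊆ ℝⁿ` is `d`-Ahlfors regular with constant `C₀`. -/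
def AhlforsRegular (n : ℕ) (d C₀ : ℝ) (Γ : Set (Euc n)) : Prop :=
  ∀ x ∈ Γ, ∀ r : ℝ, 0 < r →
    ENNReal.ofReal (C₀⁻¹ * r ^ d) ≤ μH[d] (Γ ∩ ball x r) ∧
      μH[d] (Γ ∩ ball x r) ≤ ENNReal.ofReal (C₀ * r ^ d)

/-- The weight `w(x) = dist(x, Γ) ^ (d + 1 - n)`. -/
def weightW (n : ℕ) (d : ℝ) (Γ : Set (Euc n)) (x : Euc n) : ℝ :=
  infDist x Γ ^ (d + 1 - (n : ℝ))

/-- The measure `m` with density `w` with respect to Lebesgue measure. -/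
def measW (n : ℕ) (d : ℝ) (Γ : Set (Euc n)) : Measure (Euc n) :=
  volume.withDensity fun x => ENNReal.ofReal (weightW n d Γ x)

/-- `v` is a distributional gradient of `u` on the open set `E`: for every smooth
compactly supported test function `φ` with support in `E`, `∫_E u ∇φ = -∫_E φ v`. -/
def IsDistribGradOn {n : ℕ} (u : Euc n → ℝ) (v : Euc n → Euc n) (E : Set (Euc n)) : Prop :=
  ∀ φ : Euc n → ℝ, ContDiff ℝ (⊤ : ℕ∞) φ → HasCompactSupport φ → tsupport φ ⊆ E →
    ∫ x in E, u x • gradient φ x = -∫ x in E, φ x • v x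

/-- The averages of `u` over small balls centered at `x` converge to `t`. -/
def HasTraceAt {n : ℕ} (u : Euc n → ℝ) (x : Euc n) (t : ℝ) : Prop :=
  Tendsto (fun ρ : ℝ => ⨍ y in ball x ρ, u y) (𝓝[>] (0 : ℝ)) (𝓝 t)

/-- `u` belongs to the weighted Sobolev space `W = Ẇ^{1,2}_w(Ω)`, `Ω = Γᶜ`, with
distributional gradient `v` on `Ω` lying in `L²(Ω, m)`. -/
structure MemW (n : ℕ) (d : ℝ) (Γ : Set (Euc n)) (u : Euc n → ℝ) (v : Euc n → Euc n) :
    Prop where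
  locInt : LocallyIntegrableOn u Γᶜ volume
  gradLocInt : LocallyIntegrableOn v Γᶜ volume
  isGrad : IsDistribGradOn u v Γᶜ
  l2 : ∫⁻ x in Γᶜ, ENNReal.ofReal (‖v x‖ ^ 2) ∂(measW n d Γ) < ⊤

/-- `u` belongs to the local space `W_r(E)`: `u ∈ L¹_loc(E)` and `φ u` (extended by `0`)
belongs to `W` for every smooth compactly supported `φ` with support in `E`. -/
def MemWrOn (n : ℕ) (d : ℝ) (Γ : Set (Euc n)) (E : Set (Euc n)) (u : Euc n → ℝ) : Prop :=
  LocallyIntegrableOn u E volume ∧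
    ∀ φ : Euc n → ℝ, ContDiff ℝ (⊤ : ℕ∞) φ → HasCompactSupport φ → tsupport φ ⊆ E →
      ∃ vφ : Euc n → Euc n, MemW n d Γ (fun x => φ x * u x) vφ

/-- Degenerate ellipticity and boundedness conditions for the matrix `A`. -/
def EllipticOn (n : ℕ) (d : ℝ) (Γ : Set (Euc n)) (A : Euc n → Euc n →L[ℝ] Euc n)
    (C₁ : ℝ) : Prop :=
  ∀ x, x ∉ Γ →
    (∀ ξ ζ : Euc n, |∑ i, A x ξ i * ζ i| ≤ C₁ * weightW n d Γ x * ‖ξ‖ * ‖ζ‖) ∧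
      ∀ ξ : Euc n, C₁⁻¹ * weightW n d Γ x * ‖ξ‖ ^ 2 ≤ ∑ i, A x ξ i * ξ i

/-- `u`, with gradient `v`, is a weak subsolution of `- div A ∇u = 0` on `U ⊆ Ω = Γᶜ`. -/
def SubsolOn {n : ℕ} (Γ : Set (Euc n)) (A : Euc n → Euc n →L[ℝ] Euc n)
    (v : Euc n → Euc n) (U : Set (Euc n)) : Prop :=
  ∀ φ : Euc n → ℝ, ContDiff ℝ (⊤ : ℕ∞) φ → HasCompactSupport φ → tsupport φ ⊆ U →
    (∀ x, 0 ≤ φ x) → ∫ x in Γᶜ, ∑ i, A x (v x) i * gradient φ x i ≤ 0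

/-- `u`, with gradient `v`, is a weak supersolution of `- div A ∇u = 0` on `U ⊆ Ω = Γᶜ`. -/
def SupersolOn {n : ℕ} (Γ : Set (Euc n)) (A : Euc n → Euc n →L[ℝ] Euc n)
    (v : Euc n → Euc n) (U : Set (Euc n)) : Prop :=
  ∀ φ : Euc n → ℝ, ContDiff ℝ (⊤ : ℕ∞) φ → HasCompactSupport φ → tsupport φ ⊆ U →
    (∀ x, 0 ≤ φ x) → 0 ≤ ∫ x in Γᶜ, ∑ i, A x (v x) i * gradient φ x i

/-- `u`, with gradient `v`, is a weak solution of `- div A ∇u = 0` on `U ⊆ Ω = Γᶜ`. -/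
def SolOn {n : ℕ} (Γ : Set (Euc n)) (A : Euc n → Euc n →L[ℝ] Euc n)
    (v : Euc n → Euc n) (U : Set (Euc n)) : Prop :=
  ∀ φ : Euc n → ℝ, ContDiff ℝ (⊤ : ℕ∞) φ → HasCompactSupport φ → tsupport φ ⊆ U →
    ∫ x in Γᶜ, ∑ i, A x (v x) i * gradient φ x i = 0

set_option linter.unusedVariables false
set_option linter.unusedSectionVars false

/-- kernel -/
def kerE {n : ℕ} (s : ℝ) (z : Euc n) : ℝ≥0∞ := ENNReal.ofReal (‖z‖ ^ (-s))

lemma measurable_kerE {n : ℕ} (s : ℝ) : Measurable (kerE (n := n) s) := by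
  unfold kerE; fun_prop

lemma kerE_neg {n : ℕ} (s : ℝ) (z : Euc n) : kerE s (-z) = kerE s z := by simp [kerE]

lemma kerE_sub_comm {n : ℕ} (s : ℝ) (y z : Euc n) : kerE s (y - z) = kerE s (z - y) := by
  rw [← kerE_neg, neg_sub]

lemma finrank_euc (n : ℕ) : Module.finrank ℝ (Euc n) = n := by simp

/-- scaling of lintegral -/
lemma lintegral_scale {n : ℕ} (f : Euc n → ℝ≥0∞) (hf : Measurable f) {R : ℝ} (hR : 0 < R) :
    ∫⁻ z, f (R • z) = ENNReal.ofReal (R ^ (-(n : ℝ))) * ∫⁻ z, f z := by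
  have h := Measure.map_addHaar_smul (volume : Measure (Euc n)) hR.ne'
  have h2 : ∫⁻ z, f (R • z) = ∫⁻ z, f z ∂(Measure.map (R • ·) (volume : Measure (Euc n))) := by
    rw [lintegral_map hf (by fun_prop)]
  rw [h2, h, lintegral_smul_measure, finrank_euc, smul_eq_mul]
  congr 2
  rw [abs_of_pos (by positivity), Real.rpow_neg hR.le, Real.rpow_natCast]

lemma kerE_smul {n : ℕ} (s : ℝ) {R : ℝ} (hR : 0 < R) (z : Euc n) :
    kerE s (R • z) = ENNReal.ofReal (R ^ (-s)) * kerE s z := by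
  unfold kerE
  rw [norm_smul, Real.norm_of_nonneg hR.le, Real.mul_rpow hR.le (norm_nonneg _),
    ENNReal.ofReal_mul (by positivity)]

lemma ker_ball (n : ℕ) (hn : 2 ≤ n) : ∃ C : ℝ≥0∞, C ≠ ⊤ ∧ ∀ R : ℝ, 0 < R →
    ∫⁻ z in ball (0 : Euc n) R, kerE ((n : ℝ) - 1) z ≤ C * ENNReal.ofReal R := by
  have hint : IntegrableOn (fun z : Euc n => ‖z‖ ^ (-((n : ℝ) - 1))) (ball 0 1) volume := by
    apply integrableOn_ball_of_norm_le_rpow (C := 1) (α := (n : ℝ) - 1)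
    · rw [finrank_euc]; linarith
    · filter_upwards with x
      rw [Real.norm_of_nonneg (by positivity), one_mul]
    · exact Measurable.aestronglyMeasurable (by fun_prop)
    · rw [finrank_euc]; omega
  have hfin : ∫⁻ z in ball (0 : Euc n) 1, kerE ((n : ℝ) - 1) z < ⊤ := by
    have := hint.2
    rw [hasFiniteIntegral_iff_ofReal (by filter_upwards with x; positivity)] at this
    exact this
  refine ⟨_, hfin.ne, fun R hR => ?_⟩
  have hm := measurable_kerE (n := n) ((n : ℝ) - 1)
  rw [← lintegral_indicator measurableSet_ball, ← lintegral_indicator measurableSet_ball]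
  have h := lintegral_scale ((ball (0 : Euc n) R).indicator (kerE ((n : ℝ) - 1)))
    (hm.indicator measurableSet_ball) hR
  have h2 : ∀ z : Euc n, (ball (0 : Euc n) R).indicator (kerE ((n : ℝ) - 1)) (R • z)
      = ENNReal.ofReal (R ^ (-((n : ℝ) - 1))) * (ball (0 : Euc n) 1).indicator (kerE ((n : ℝ) - 1)) z := by
    intro z
    have : R • z ∈ ball (0 : Euc n) R ↔ z ∈ ball (0 : Euc n) 1 := by
      simp [norm_smul, abs_of_pos hR, hR]
    by_cases hz : z ∈ ball (0 : Euc n) 1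
    · rw [indicator_of_mem (this.2 hz), indicator_of_mem hz, kerE_smul _ hR]
    · rw [indicator_of_notMem (fun h => hz (this.1 h)), indicator_of_notMem hz, mul_zero]
  simp_rw [h2] at h
  rw [lintegral_const_mul _ (hm.indicator measurableSet_ball)] at h
  have h3 : ENNReal.ofReal (R ^ (n : ℝ)) * (ENNReal.ofReal (R ^ (-(n : ℝ))) *
      ∫⁻ z, (ball (0 : Euc n) R).indicator (kerE ((n : ℝ) - 1)) z) =
      ∫⁻ z, (ball (0 : Euc n) R).indicator (kerE ((n : ℝ) - 1)) z := by
    rw [← mul_assoc, ← ENNReal.ofReal_mul (by positivity), ← Real.rpow_add hR]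
    simp
  rw [← h3, ← h, ← mul_assoc, ← ENNReal.ofReal_mul (by positivity), ← Real.rpow_add hR]
  rw [mul_comm]
  gcongr
  ring_nf; simp

section geom
variable {n : ℕ} {d C₀ : ℝ} {Γ : Set (Euc n)}

lemma infDist_pos' (hne : Γ.Nonempty) (hcl : IsClosed Γ) {x : Euc n} (hx : x ∉ Γ) :
    0 < infDist x Γ := (hcl.notMem_iff_infDist_pos hne).1 hx

lemma ker_lower (hA : AhlforsRegular n d C₀ Γ) (hC₀ : 1 ≤ C₀) {s : ℝ} (hs : 0 < s)
    {x y0 : Euc n} (hy0 : y0 ∈ Γ) (hx : 0 < infDist x Γ) (hd : dist x y0 = infDist x Γ) :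
    ENNReal.ofReal (C₀⁻¹ * 2 ^ (-s) * infDist x Γ ^ (d - s)) ≤
      ∫⁻ y in Γ ∩ ball y0 (infDist x Γ), kerE s (x - y) ∂μH[d] := by
  set δ := infDist x Γ
  have h1 : ∀ y ∈ Γ ∩ ball y0 δ, ENNReal.ofReal ((2 * δ) ^ (-s)) ≤ kerE s (x - y) := by
    intro y ⟨hy, hyb⟩
    unfold kerE
    apply ENNReal.ofReal_le_ofReal
    have hpos : 0 < ‖x - y‖ := by
      rw [← dist_eq_norm]; exact lt_of_lt_of_le hx (infDist_le_dist_of_mem hy)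
    apply Real.rpow_le_rpow_of_nonpos hpos _ (by linarith)
    rw [← dist_eq_norm]
    have := dist_triangle_right x y y0
    rw [mem_ball] at hyb
    linarith
  calc ENNReal.ofReal (C₀⁻¹ * 2 ^ (-s) * δ ^ (d - s))
      = ENNReal.ofReal ((2 * δ) ^ (-s)) * ENNReal.ofReal (C₀⁻¹ * δ ^ d) := by
        rw [← ENNReal.ofReal_mul (by positivity)]
        congr 1
        rw [Real.mul_rpow (by norm_num) hx.le, sub_eq_add_neg, Real.rpow_add hx]; ring
    _ ≤ ENNReal.ofReal ((2 * δ) ^ (-s)) * μH[d] (Γ ∩ ball y0 δ) := by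
        gcongr; exact (hA y0 hy0 δ hx).1
    _ ≤ _ := by
        rw [← setLIntegral_const]
        apply setLIntegral_mono ((measurable_kerE s).comp (by fun_prop)) h1

lemma ker_lower' (hne : Γ.Nonempty) (hcl : IsClosed Γ)
    (hA : AhlforsRegular n d C₀ Γ) (hC₀ : 1 ≤ C₀) {s : ℝ} (hs : 0 < s)
    {x : Euc n} (hx : x ∉ Γ) :
    ENNReal.ofReal (C₀⁻¹ * 2 ^ (-s) * infDist x Γ ^ (d - s)) ≤
      ∫⁻ y in Γ, kerE s (x - y) ∂μH[d] := by
  obtain ⟨y0, hy0, h⟩ := hcl.exists_infDist_eq_dist hne x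
  refine (ker_lower hA hC₀ hs hy0 (infDist_pos' hne hcl hx) h.symm).trans ?_
  exact lintegral_mono_set inter_subset_left

/-- constant of the upper bound -/
def cUp (d C₀ s : ℝ) : ℝ := C₀ * 4 ^ d * (1 - 2 ^ (d - s))⁻¹

lemma cUp_nonneg {d s : ℝ} (hC₀ : 1 ≤ C₀) (hs : d < s) : 0 ≤ cUp d C₀ s := by
  unfold cUp
  have : (2 : ℝ) ^ (d - s) < 1 := Real.rpow_lt_one_of_one_lt_of_neg (by norm_num) (by linarith)
  have : 0 < (1 - (2 : ℝ) ^ (d - s))⁻¹ := inv_pos.2 (by linarith)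
  positivity

lemma ker_upper (hne : Γ.Nonempty) (hcl : IsClosed Γ)
    (hA : AhlforsRegular n d C₀ Γ) (hC₀ : 1 ≤ C₀) (hd : 0 < d) {s : ℝ} (hs : d < s)
    {x : Euc n} (hx : x ∉ Γ) :
    ∫⁻ y in Γ, kerE s (x - y) ∂μH[d] ≤ ENNReal.ofReal (cUp d C₀ s * infDist x Γ ^ (d - s)) := by
  obtain ⟨y0, hy0, h0⟩ := hcl.exists_infDist_eq_dist hne x
  have hx := infDist_pos' hne hcl hx
  set δ := infDist x Γ
  have hcover : Γ ⊆ ⋃ j : ℕ, Γ ∩ {y | 2 ^ j * δ ≤ dist x y ∧ dist x y < 2 ^ (j + 1) * δ} := by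
    intro y hy
    have h1 : 1 ≤ dist x y / δ := by rw [le_div_iff₀ hx, one_mul]; exact infDist_le_dist_of_mem hy
    obtain ⟨j, hj1, hj2⟩ := exists_nat_pow_near h1 (by norm_num : (1 : ℝ) < 2)
    rw [mem_iUnion]
    exact ⟨j, hy, by rwa [le_div_iff₀ hx] at hj1, by rwa [div_lt_iff₀ hx] at hj2⟩
  have hq : (2 : ℝ) ^ (d - s) < 1 := Real.rpow_lt_one_of_one_lt_of_neg (by norm_num) (by linarith)
  have hq0 : 0 < (2 : ℝ) ^ (d - s) := by positivity
  have hshell : ∀ j : ℕ, ∫⁻ y in Γ ∩ {y | 2 ^ j * δ ≤ dist x y ∧ dist x y < 2 ^ (j + 1) * δ},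
      kerE s (x - y) ∂μH[d] ≤ ENNReal.ofReal (C₀ * 4 ^ d * δ ^ (d - s) * (2 ^ (d - s)) ^ j) := by
    intro j
    have hP : (0 : ℝ) < 2 ^ j * δ := by positivity
    calc _ ≤ ∫⁻ y in Γ ∩ {y | 2 ^ j * δ ≤ dist x y ∧ dist x y < 2 ^ (j + 1) * δ},
          ENNReal.ofReal ((2 ^ j * δ) ^ (-s)) ∂μH[d] := by
          apply setLIntegral_mono measurable_const
          intro y ⟨_, hy, _⟩
          unfold kerE
          apply ENNReal.ofReal_le_ofReal
          rw [← dist_eq_norm]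
          exact Real.rpow_le_rpow_of_nonpos hP hy (by linarith)
      _ = ENNReal.ofReal ((2 ^ j * δ) ^ (-s)) * μH[d] (Γ ∩ {y | 2 ^ j * δ ≤ dist x y ∧ dist x y < 2 ^ (j + 1) * δ}) := by
          rw [setLIntegral_const]
      _ ≤ ENNReal.ofReal ((2 ^ j * δ) ^ (-s)) * μH[d] (Γ ∩ ball y0 (4 * (2 ^ j * δ))) := by
          gcongr
          intro y ⟨_, hy⟩
          rw [mem_ball, dist_comm]
          have := dist_triangle_left y0 y x
          rw [pow_succ] at hy
          have h3 : δ ≤ 2 ^ j * δ := by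
            nlinarith [one_le_pow₀ (by norm_num : (1 : ℝ) ≤ 2) (n := j)]
          linarith
      _ ≤ ENNReal.ofReal ((2 ^ j * δ) ^ (-s)) * ENNReal.ofReal (C₀ * (4 * (2 ^ j * δ)) ^ d) := by
          gcongr; exact (hA y0 hy0 _ (by positivity)).2
      _ = _ := by
          rw [← ENNReal.ofReal_mul (by positivity)]
          congr 1
          rw [Real.mul_rpow (by norm_num) hP.le]
          have e1 : (2 ^ j * δ) ^ (-s) * (2 ^ j * δ) ^ d = (2 ^ j * δ) ^ (d - s) := by
            rw [← Real.rpow_add hP]; ring_nf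
          have e2 : (2 ^ j * δ) ^ (d - s) = (2 ^ (d - s)) ^ j * δ ^ (d - s) := by
            rw [Real.mul_rpow (by positivity) hx.le, ← Real.rpow_natCast, ← Real.rpow_natCast,
              ← Real.rpow_mul (by norm_num), ← Real.rpow_mul (by norm_num), mul_comm (j : ℝ)]
          rw [mul_assoc (C₀ * 4 ^ d), mul_comm (δ ^ (d - s)), ← e2, ← e1]; ring
  calc ∫⁻ y in Γ, kerE s (x - y) ∂μH[d]
      ≤ ∫⁻ y in ⋃ j : ℕ, Γ ∩ {y | 2 ^ j * δ ≤ dist x y ∧ dist x y < 2 ^ (j + 1) * δ},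
          kerE s (x - y) ∂μH[d] := lintegral_mono_set hcover
    _ ≤ ∑' j : ℕ, ∫⁻ y in Γ ∩ {y | 2 ^ j * δ ≤ dist x y ∧ dist x y < 2 ^ (j + 1) * δ},
          kerE s (x - y) ∂μH[d] := lintegral_iUnion_le _ _
    _ ≤ ∑' j : ℕ, ENNReal.ofReal (C₀ * 4 ^ d * δ ^ (d - s) * (2 ^ (d - s)) ^ j) :=
          ENNReal.tsum_le_tsum hshell
    _ = ENNReal.ofReal (∑' j : ℕ, C₀ * 4 ^ d * δ ^ (d - s) * (2 ^ (d - s)) ^ j) := by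
          rw [ENNReal.ofReal_tsum_of_nonneg (fun j => by positivity)]
          exact (summable_geometric_of_lt_one hq0.le hq).mul_left _
    _ = _ := by
          rw [tsum_mul_left, tsum_geometric_of_lt_one hq0.le hq]
          unfold cUp; congr 1; ring

lemma sfinite_sigma (hne : Γ.Nonempty) (hA : AhlforsRegular n d C₀ Γ) :
    SigmaFinite ((μH[d] : Measure (Euc n)).restrict Γ) := by
  obtain ⟨x0, hx0⟩ := hne
  refine ⟨⟨⟨fun j => ball x0 (j + 1), fun _ => trivial, fun j => ?_, ?_⟩⟩⟩
  · rw [Measure.restrict_apply measurableSet_ball, inter_comm]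
    exact lt_of_le_of_lt (hA x0 hx0 _ (by positivity)).2 ENNReal.ofReal_lt_top
  · rw [eq_univ_iff_forall]
    intro y
    obtain ⟨k, hk⟩ := exists_nat_gt (dist y x0)
    exact mem_iUnion.2 ⟨k, by rw [mem_ball]; linarith⟩

lemma nbhd_volume (hne : Γ.Nonempty) (hcl : IsClosed Γ)
    (hA : AhlforsRegular n d C₀ Γ) (hC₀ : 1 ≤ C₀)
    {x : Euc n} (hx : x ∈ Γ) {R : ℝ} (hR : 0 < R) : ∃ C : ℝ≥0∞, C ≠ ⊤ ∧ ∀ τ : ℝ, 0 < τ → τ ≤ R →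
      volume ({z | infDist z Γ < τ} ∩ ball x R) ≤ C * ENNReal.ofReal (τ ^ ((n : ℝ) - d)) := by
  have := sfinite_sigma hne hA
  have hfin : μH[d] (Γ ∩ ball x (3 * R)) ≠ ⊤ :=
    (lt_of_le_of_lt (hA x hx _ (by positivity)).2 ENNReal.ofReal_lt_top).ne
  refine ⟨ENNReal.ofReal C₀ * (ENNReal.ofReal (2 ^ (n : ℝ)) * volume (ball (0 : Euc n) 1)) *
    μH[d] (Γ ∩ ball x (3 * R)), ?_, ?_⟩
  · exact ENNReal.mul_ne_top (ENNReal.mul_ne_top ENNReal.ofReal_ne_top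
      (ENNReal.mul_ne_top ENNReal.ofReal_ne_top measure_ball_lt_top.ne)) hfin
  intro τ hτ hτR
  set S := {z | infDist z Γ < τ} ∩ ball x R
  have hS : MeasurableSet S :=
    ((isOpen_lt (continuous_infDist_pt Γ) continuous_const).inter isOpen_ball).measurableSet
  have hfub : ∫⁻ z in S, (μH[d].restrict Γ) (ball z (2 * τ) ∩ ball x (3 * R)) ≤
      volume (ball (0 : Euc n) (2 * τ)) * μH[d] (Γ ∩ ball x (3 * R)) := by
    set T : Set (Euc n × Euc n) := {q | dist q.2 q.1 < 2 * τ} ∩ {q | dist q.2 x < 3 * R} with hT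
    have hTm : MeasurableSet T := by
      apply IsOpen.measurableSet
      apply IsOpen.inter
      · exact isOpen_lt (f := fun q : Euc n × Euc n => dist q.2 q.1) (by fun_prop) continuous_const
      · exact isOpen_lt (f := fun q : Euc n × Euc n => dist q.2 x) (by fun_prop) continuous_const
    have hm : Measurable (T.indicator (1 : Euc n × Euc n → ℝ≥0∞)) := measurable_one.indicator hTm
    have e : ∀ z, (μH[d].restrict Γ) (ball z (2 * τ) ∩ ball x (3 * R)) =
        ∫⁻ y in Γ, T.indicator (1 : Euc n × Euc n → ℝ≥0∞) (z, y) ∂μH[d] := by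
      intro z
      rw [← lintegral_indicator_one (measurableSet_ball.inter measurableSet_ball)]
      rfl
    simp_rw [e]
    rw [lintegral_lintegral_swap (f := fun z y => T.indicator (1 : Euc n × Euc n → ℝ≥0∞) (z, y)) hm.aemeasurable]
    calc _ ≤ ∫⁻ y in Γ, (ball x (3 * R)).indicator (fun _ => volume (ball (0 : Euc n) (2 * τ))) y ∂μH[d] := by
          apply lintegral_mono
          intro y
          simp only
          by_cases hy : y ∈ ball x (3 * R)
          · rw [indicator_of_mem hy, ← Measure.addHaar_ball_center volume y, ← lintegral_indicator_one measurableSet_ball]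
            refine (setLIntegral_le_lintegral _ _).trans (lintegral_mono ?_)
            intro z
            by_cases hz : (z, y) ∈ T
            · have : z ∈ ball y (2 * τ) := by rw [mem_ball, dist_comm]; exact hz.1
              simp [hz, this]
            · simp [hz]
          · rw [indicator_of_notMem hy, nonpos_iff_eq_zero]
            convert lintegral_zero with z
            exact indicator_of_notMem (fun h => hy h.2) _
      _ = _ := by
          rw [lintegral_indicator measurableSet_ball, setLIntegral_const,
            Measure.restrict_apply measurableSet_ball, inter_comm]
  have hlow : volume S * ENNReal.ofReal (C₀⁻¹ * τ ^ d) ≤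
      ∫⁻ z in S, (μH[d].restrict Γ) (ball z (2 * τ) ∩ ball x (3 * R)) := by
    rw [mul_comm, ← setLIntegral_const]
    apply setLIntegral_mono' hS
    intro z ⟨hz, hzx⟩
    obtain ⟨y0, hy0, h0⟩ := hcl.exists_infDist_eq_dist hne z
    refine (hA y0 hy0 τ hτ).1.trans ?_
    rw [Measure.restrict_apply (measurableSet_ball.inter measurableSet_ball)]
    apply measure_mono
    intro y ⟨hy, hyb⟩
    simp only [mem_ofPred_eq, mem_ball] at hz hzx hyb
    have h1 := dist_triangle y y0 z
    have h2 := dist_triangle y z x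
    rw [dist_comm y0 z] at h1
    refine ⟨⟨?_, ?_⟩, hy⟩ <;> rw [mem_ball] <;> linarith
  have h3 := hlow.trans hfub
  have hp : 0 < C₀⁻¹ * τ ^ d := by positivity
  have h4 : volume S ≤ (volume (ball (0 : Euc n) (2 * τ)) * μH[d] (Γ ∩ ball x (3 * R))) *
      ENNReal.ofReal (C₀ * τ ^ (-d)) := by
    calc volume S = volume S * ENNReal.ofReal (C₀⁻¹ * τ ^ d) * ENNReal.ofReal (C₀ * τ ^ (-d)) := by
          rw [mul_assoc, ← ENNReal.ofReal_mul hp.le]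
          have : C₀⁻¹ * τ ^ d * (C₀ * τ ^ (-d)) = 1 := by
            rw [Real.rpow_neg hτ.le]; field_simp
          rw [this]; simp
      _ ≤ _ := by gcongr
  refine h4.trans (le_of_eq ?_)
  rw [Measure.addHaar_ball_of_pos volume (0 : Euc n) (by positivity : 0 < 2 * τ), finrank_euc,
    ENNReal.ofReal_mul (by positivity : 0 ≤ C₀),
    show τ ^ ((n : ℝ) - d) = τ ^ (n : ℝ) * τ ^ (-d) by rw [← Real.rpow_add hτ]; rfl,
    ENNReal.ofReal_mul (by positivity : 0 ≤ τ ^ (n : ℝ)),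
    ← Real.rpow_natCast, Real.mul_rpow (by norm_num) hτ.le,
    ENNReal.ofReal_mul (by positivity : (0 : ℝ) ≤ 2 ^ (n : ℝ))]
  ring

lemma vol_Gamma (hne : Γ.Nonempty) (hcl : IsClosed Γ)
    (hA : AhlforsRegular n d C₀ Γ) (hC₀ : 1 ≤ C₀) (hdn : d < n) : volume Γ = 0 := by
  obtain ⟨x, hx⟩ := hne
  have key : ∀ k : ℕ, volume (Γ ∩ ball x (k + 1)) = 0 := by
    intro k
    obtain ⟨C, hC, h⟩ := nbhd_volume ⟨x, hx⟩ hcl hA hC₀ hx (R := k + 1) (by positivity)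
    have hlim : Tendsto (fun τ : ℝ => C * ENNReal.ofReal (τ ^ ((n : ℝ) - d))) (𝓝[>] 0) (𝓝 0) := by
      have h1 : Tendsto (fun τ : ℝ => τ ^ ((n : ℝ) - d)) (𝓝[>] 0) (𝓝 0) := by
        have := (Real.continuousAt_rpow_const 0 ((n : ℝ) - d) (Or.inr (by linarith))).tendsto
        rw [Real.zero_rpow (by linarith)] at this
        exact this.mono_left nhdsWithin_le_nhds
      have h2 := ENNReal.Tendsto.const_mul (ENNReal.tendsto_ofReal h1) (Or.inr hC)
      simpa using h2
    have : volume (Γ ∩ ball x (k + 1)) ≤ 0 := by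
      apply ge_of_tendsto hlim
      have : Ioo (0 : ℝ) (k + 1) ∈ 𝓝[>] (0 : ℝ) := Ioo_mem_nhdsGT (by positivity)
      filter_upwards [this] with τ hτ
      refine (measure_mono ?_).trans (h τ hτ.1 hτ.2.le)
      intro z ⟨hz, hzb⟩
      refine ⟨?_, hzb⟩
      simp only [mem_ofPred_eq, infDist_zero_of_mem hz]
      exact hτ.1
    simpa using this
  have : Γ ⊆ ⋃ k : ℕ, Γ ∩ ball x (k + 1) := by
    intro y hy
    obtain ⟨k, hk⟩ := exists_nat_gt (dist y x)
    exact mem_iUnion.2 ⟨k, hy, by rw [mem_ball]; linarith⟩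
  exact measure_mono_null this (measure_iUnion_null key)

lemma measurable_weightE : Measurable fun x => ENNReal.ofReal (weightW n d Γ x) := by
  unfold weightW
  have : Measurable fun x : Euc n => infDist x Γ := (continuous_infDist_pt Γ).measurable
  fun_prop

lemma weightW_nonneg (x : Euc n) : 0 ≤ weightW n d Γ x := Real.rpow_nonneg infDist_nonneg _

end geom

lemma meas_ball_upper (n : ℕ) (hn : 2 ≤ n) (d C₀ : ℝ) (hC₀ : 1 ≤ C₀) (hdn : d < (n : ℝ) - 1) :
    ∃ C : ℝ, 0 < C ∧ ∀ Γ : Set (Euc n), Γ.Nonempty → IsClosed Γ → AhlforsRegular n d C₀ Γ →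
      ∀ x ∈ Γ, ∀ r : ℝ, 0 < r →
        measW n d Γ (ball x (2 * r)) ≤ ENNReal.ofReal (C * r ^ (d + 1)) := by
  obtain ⟨K, hK, hker⟩ := ker_ball n hn
  refine ⟨(K.toReal + 1) * 8 * C₀ * 6 ^ d * C₀ * 2 ^ ((n : ℝ) - 1), by positivity, ?_⟩
  intro Γ hne hcl hA x hx r hr
  have hσ := sfinite_sigma hne hA
  have hΓ0 := vol_Gamma hne hcl hA hC₀ (by linarith)
  have hn1 : (0 : ℝ) < (n : ℝ) - 1 := by
    have : (2 : ℝ) ≤ n := by exact_mod_cast hn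
    linarith
  have hm : Measurable (Function.uncurry fun z y : Euc n => kerE ((n : ℝ) - 1) (z - y)) :=
    (measurable_kerE _).comp (by fun_prop)
  have hw : ∀ᵐ z, z ∈ ball x (2 * r) → ENNReal.ofReal (weightW n d Γ z) ≤
      ENNReal.ofReal (C₀ * 2 ^ ((n : ℝ) - 1)) *
        ∫⁻ y in Γ ∩ ball x (6 * r), kerE ((n : ℝ) - 1) (z - y) ∂μH[d] := by
    have : ∀ᵐ z, z ∉ Γ := measure_eq_zero_iff_ae_notMem.1 hΓ0
    filter_upwards [this] with z hz hzb
    obtain ⟨y0, hy0, h0⟩ := hcl.exists_infDist_eq_dist hne z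
    have hpos := infDist_pos' hne hcl hz
    have h1 := ker_lower hA hC₀ hn1 hy0 hpos h0.symm
    have hle : infDist z Γ < 2 * r := lt_of_le_of_lt (infDist_le_dist_of_mem hx) hzb
    have hsub : Γ ∩ ball y0 (infDist z Γ) ⊆ Γ ∩ ball x (6 * r) := by
      apply inter_subset_inter_right
      apply ball_subset_ball'
      have := dist_triangle y0 z x
      rw [mem_ball] at hzb
      rw [dist_comm y0 z] at this
      linarith
    calc ENNReal.ofReal (weightW n d Γ z) = ENNReal.ofReal (C₀ * 2 ^ ((n : ℝ) - 1)) *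
          ENNReal.ofReal (C₀⁻¹ * 2 ^ (-((n : ℝ) - 1)) * infDist z Γ ^ (d - ((n : ℝ) - 1))) := by
          rw [← ENNReal.ofReal_mul (by positivity)]
          congr 1
          rw [Real.rpow_neg (by norm_num), weightW,
            show d + 1 - (n : ℝ) = d - ((n : ℝ) - 1) by ring]
          field_simp
      _ ≤ _ := by
          gcongr
          exact h1.trans (lintegral_mono_set hsub)
  have hres : (μH[d] : Measure (Euc n)).restrict (Γ ∩ ball x (6 * r)) =
      (μH[d].restrict Γ).restrict (ball x (6 * r)) := by
    rw [Measure.restrict_restrict measurableSet_ball, inter_comm]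
  have hres' : SigmaFinite ((μH[d] : Measure (Euc n)).restrict (Γ ∩ ball x (6 * r))) := by
    rw [hres]; infer_instance
  rw [measW, withDensity_apply _ measurableSet_ball]
  calc ∫⁻ z in ball x (2 * r), ENNReal.ofReal (weightW n d Γ z)
      ≤ ∫⁻ z in ball x (2 * r), ENNReal.ofReal (C₀ * 2 ^ ((n : ℝ) - 1)) *
        ∫⁻ y in Γ ∩ ball x (6 * r), kerE ((n : ℝ) - 1) (z - y) ∂μH[d] :=
        setLIntegral_mono_ae' measurableSet_ball hw
    _ = ENNReal.ofReal (C₀ * 2 ^ ((n : ℝ) - 1)) * ∫⁻ y in Γ ∩ ball x (6 * r),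
          (∫⁻ z in ball x (2 * r), kerE ((n : ℝ) - 1) (z - y)) ∂μH[d] := by
        rw [lintegral_const_mul' _ _ ENNReal.ofReal_ne_top, lintegral_lintegral_swap hm.aemeasurable]
    _ ≤ ENNReal.ofReal (C₀ * 2 ^ ((n : ℝ) - 1)) * ∫⁻ y in Γ ∩ ball x (6 * r),
          K * ENNReal.ofReal (8 * r) ∂μH[d] := by
        gcongr 1
        apply setLIntegral_mono measurable_const
        intro y ⟨_, hy⟩
        refine le_trans ?_ (hker (8 * r) (by positivity))
        rw [← lintegral_indicator measurableSet_ball, ← lintegral_indicator measurableSet_ball,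
          ← lintegral_sub_right_eq_self ((ball (0 : Euc n) (8 * r)).indicator _) y]
        apply lintegral_mono
        intro z
        simp only
        by_cases hz : z ∈ ball x (2 * r)
        · rw [indicator_of_mem hz, indicator_of_mem]
          rw [mem_ball_zero_iff, ← dist_eq_norm]
          rw [mem_ball] at hz hy
          have := dist_triangle_right z y x
          linarith
        · rw [indicator_of_notMem hz]; exact zero_le
    _ = ENNReal.ofReal (C₀ * 2 ^ ((n : ℝ) - 1)) * (K * ENNReal.ofReal (8 * r) *
          μH[d] (Γ ∩ ball x (6 * r))) := by rw [setLIntegral_const]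
    _ ≤ ENNReal.ofReal (C₀ * 2 ^ ((n : ℝ) - 1)) * (ENNReal.ofReal (K.toReal + 1) * ENNReal.ofReal (8 * r) *
          ENNReal.ofReal (C₀ * (6 * r) ^ d)) := by
        gcongr
        · rw [← ENNReal.ofReal_toReal hK]
          apply ENNReal.ofReal_le_ofReal
          rw [ENNReal.toReal_ofReal ENNReal.toReal_nonneg]; linarith
        · exact (hA x hx _ (by positivity)).2
    _ = _ := by
        have : 0 ≤ K.toReal := ENNReal.toReal_nonneg
        rw [← ENNReal.ofReal_mul (by positivity), ← ENNReal.ofReal_mul (by positivity),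
          ← ENNReal.ofReal_mul (by positivity)]
        congr 1
        rw [Real.mul_rpow (by norm_num) hr.le, Real.rpow_add hr, Real.rpow_one]; ring

lemma cs_lintegral {α : Type*} [MeasurableSpace α] {μ : Measure α} {f g : α → ℝ≥0∞}
    (hf : AEMeasurable f μ) (hg : AEMeasurable g μ) :
    (∫⁻ a, f a * g a ∂μ) ^ 2 ≤ (∫⁻ a, f a ^ 2 ∂μ) * ∫⁻ a, g a ^ 2 ∂μ := by
  have h := ENNReal.lintegral_mul_le_Lp_mul_Lq μ (Real.HolderConjugate.two_two) hf hg
  simp only [Pi.mul_apply, ENNReal.rpow_two] at h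
  have h2 : ∀ a : ℝ≥0∞, (a ^ (1 / (2 : ℝ))) ^ 2 = a := by
    intro a
    rw [← ENNReal.rpow_natCast, ← ENNReal.rpow_mul]; norm_num
  calc _ ≤ _ := pow_le_pow_left₀ zero_le h 2
    _ = _ := by rw [mul_pow, h2, h2]

lemma cs_weight {α : Type*} [MeasurableSpace α] {μ : Measure α} {w g : α → ℝ≥0∞}
    (hw : AEMeasurable w μ) (hg : AEMeasurable g μ) :
    (∫⁻ a, w a * g a ∂μ) ^ 2 ≤ (∫⁻ a, w a ∂μ) * ∫⁻ a, w a * g a ^ 2 ∂μ := by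
  have hac : μ.withDensity w ≪ μ := withDensity_absolutelyContinuous _ _
  have h := cs_lintegral (μ := μ.withDensity w) (f := 1) (g := g) aemeasurable_const
    (hg.mono_ac hac)
  rw [lintegral_withDensity_eq_lintegral_mul₀ hw (by fun_prop),
    lintegral_withDensity_eq_lintegral_mul₀ hw (by fun_prop),
    lintegral_withDensity_eq_lintegral_mul₀ hw (by fun_prop)] at h
  simpa using h

/-- Scheffe type lemma -/
lemma scheffe {α : Type*} [MeasurableSpace α] {μ : Measure α} {a b : ℕ → α → ℝ≥0∞} {c : α → ℝ≥0∞}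
    (ha : ∀ j, AEMeasurable (a j) μ) (hb : ∀ j, AEMeasurable (b j) μ) (hc : AEMeasurable c μ)
    (hab : ∀ j, ∀ᵐ x ∂μ, a j x ≤ b j x + c x)
    (ha0 : ∀ᵐ x ∂μ, Tendsto (fun j => a j x) atTop (𝓝 0))
    (hbc : ∀ᵐ x ∂μ, Tendsto (fun j => b j x) atTop (𝓝 (c x)))
    (hbI : ∀ j, ∫⁻ x, b j x ∂μ ≤ ∫⁻ x, c x ∂μ) (hcI : ∫⁻ x, c x ∂μ ≠ ⊤) :
    Tendsto (fun j => ∫⁻ x, a j x ∂μ) atTop (𝓝 0) := by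
  set C := ∫⁻ x, c x ∂μ
  have hF := lintegral_liminf_le' (μ := μ) (u := atTop) (f := fun j x => b j x + c x - a j x)
    (fun j => ((hb j).add hc).sub (ha j))
  have hlim : ∫⁻ x, liminf (fun j => b j x + c x - a j x) atTop ∂μ = C + C := by
    rw [← lintegral_add_left' hc]
    apply lintegral_congr_ae
    filter_upwards [ha0, hbc, ae_lt_top' hc hcI] with x h1 h2 h3
    have h4 : Tendsto (fun j => b j x + c x - a j x) atTop (𝓝 (c x + c x - 0)) :=
      ENNReal.Tendsto.sub (h2.add tendsto_const_nhds) h1 (Or.inr (by simp))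
    rw [h4.liminf_eq, tsub_zero]
  have hsum : ∀ j, ∫⁻ x, (b j x + c x - a j x) ∂μ + ∫⁻ x, a j x ∂μ ≤ C + C := by
    intro j
    rw [← lintegral_add_right' _ (ha j)]
    calc _ ≤ ∫⁻ x, (b j x + c x) ∂μ := by
          apply lintegral_mono_ae
          filter_upwards [hab j] with x hx
          rw [tsub_add_cancel_of_le hx]
      _ ≤ _ := by
          rw [lintegral_add_right' _ hc]
          gcongr
          exact hbI j
  rw [hlim] at hF
  rw [ENNReal.tendsto_nhds_zero]
  intro ε hε
  by_cases hC : C + C ≤ ε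
  · filter_upwards with j
    exact le_trans (le_trans le_add_self (hsum j)) hC
  push Not at hC
  have hlt : C + C - ε < liminf (fun j => ∫⁻ x, (b j x + c x - a j x) ∂μ) atTop := by
    refine lt_of_lt_of_le ?_ hF
    exact ENNReal.sub_lt_self (by simp [hcI]) (by intro h; simp [h] at hC) hε.ne'
  filter_upwards [eventually_lt_of_lt_liminf hlt] with j hj
  have h5 := hsum j
  set I := ∫⁻ x, (b j x + c x - a j x) ∂μ
  set J := ∫⁻ x, a j x ∂μ
  have hI : I ≠ ⊤ := ne_top_of_le_ne_top (by simp [hcI]) (le_trans le_self_add h5)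
  have h6 : C + C ≤ I + ε := by
    rw [← tsub_le_iff_right]; exact hj.le
  exact (ENNReal.add_le_add_iff_left hI).1 (h5.trans h6)

section moll
variable {n : ℕ} {E : Type*} [NormedAddCommGroup E] [NormedSpace ℝ E]

/-- scale -/
def eps (j : ℕ) : ℝ := 1 / ((j : ℝ) + 1)
lemma eps_pos (j : ℕ) : 0 < eps j := by unfold eps; positivity
lemma eps_tendsto : Tendsto eps atTop (𝓝 0) := tendsto_one_div_add_atTop_nhds_zero_nat

/-- bump -/
def bmp (n j : ℕ) : ContDiffBump (0 : Euc n) where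
  rIn := eps j / 2
  rOut := eps j
  rIn_pos := half_pos (eps_pos j)
  rIn_lt_rOut := half_lt_self (eps_pos j)

/-- mollifier -/
def rho (n j : ℕ) : Euc n → ℝ := (bmp n j).normed volume

/-- mollification -/
def moll (j : ℕ) (f : Euc n → E) (x : Euc n) : E := ∫ y, rho n j y • f (x - y)

/-- mollification, extended nonnegative -/
def mollE (j : ℕ) (g : Euc n → ℝ≥0∞) (x : Euc n) : ℝ≥0∞ :=
  ∫⁻ y, ENNReal.ofReal (rho n j y) * g (x - y)

lemma rho_nonneg (j : ℕ) (y : Euc n) : 0 ≤ rho n j y := (bmp n j).nonneg_normed y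
lemma rho_contDiff (j : ℕ) : ContDiff ℝ (⊤ : ℕ∞) (rho n j) := (bmp n j).contDiff_normed
lemma rho_cont (j : ℕ) : Continuous (rho n j) := (rho_contDiff j).continuous
lemma rho_meas (j : ℕ) : Measurable (rho n j) := (rho_cont j).measurable
lemma rho_cs (j : ℕ) : HasCompactSupport (rho n j) := (bmp n j).hasCompactSupport_normed
lemma rho_zero (j : ℕ) {y : Euc n} (h : eps j ≤ ‖y‖) : rho n j y = 0 := by
  by_contra hne
  have : y ∈ Function.support (rho n j) := hne
  rw [rho, (bmp n j).support_normed_eq, mem_ball_zero_iff] at this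
  exact absurd this (not_lt.2 h)
lemma rho_neg (j : ℕ) (y : Euc n) : rho n j (-y) = rho n j y := (bmp n j).normed_neg y
lemma rho_int (j : ℕ) : ∫ y, rho n j y = 1 := (bmp n j).integral_normed
lemma rho_integrable (j : ℕ) : Integrable (rho n j) := (bmp n j).integrable_normed
lemma rho_lint (j : ℕ) : ∫⁻ y, ENNReal.ofReal (rho n j y) = 1 := by
  rw [← ofReal_integral_eq_lintegral_ofReal (rho_integrable j)
    (Eventually.of_forall (rho_nonneg j)), rho_int]; simp
lemma rho_le (j : ℕ) (y : Euc n) : rho n j y ≤ 2 ^ n / volume.real (closedBall (0 : Euc n) (eps j)) := by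
  have := (bmp n j).normed_le_div_measure_closedBall_rOut volume 2 (by simp [bmp]; linarith) y
  rwa [finrank_euc] at this

lemma moll_eq_conv (j : ℕ) (f : Euc n → E) :
    moll j f = convolution (rho n j) f (ContinuousLinearMap.lsmul ℝ ℝ) volume := rfl

lemma moll_contDiff [CompleteSpace E] (j : ℕ) {f : Euc n → E} (hf : LocallyIntegrable f) :
    ContDiff ℝ (⊤ : ℕ∞) (moll j f) := by
  rw [moll_eq_conv]
  exact (rho_cs j).contDiff_convolution_left _ (rho_contDiff j) hf

lemma moll_ae [CompleteSpace E] {f : Euc n → E} (hf : LocallyIntegrable f) :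
    ∀ᵐ x, Tendsto (fun j => moll j f x) atTop (𝓝 (f x)) :=
  ContDiffBump.ae_convolution_tendsto_right_of_locallyIntegrable (φ := bmp n) (K := 2)
    eps_tendsto (by filter_upwards with j; simp [bmp]; linarith) hf

lemma moll_zero_of {j : ℕ} {f : Euc n → E} {x : Euc n} (h : ∀ y ∈ ball x (eps j), f y = 0) :
    moll j f x = 0 := by
  unfold moll
  apply integral_eq_zero_of_ae
  filter_upwards with y
  by_cases hy : eps j ≤ ‖y‖
  · simp [rho_zero j hy]
  · rw [h, smul_zero]; rfl
    rw [mem_ball, dist_eq_norm]; simpa using hy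

lemma moll_smul_int (j : ℕ) (f : Euc n → E) (x : Euc n) :
    moll j f x = ∫ y, rho n j (x - y) • f y := by
  unfold moll
  rw [← integral_sub_left_eq_self (fun y => rho n j (x - y) • f y) volume x]
  simp

lemma mollE_eq (j : ℕ) (g : Euc n → ℝ≥0∞) (x : Euc n) :
    mollE j g x = ∫⁻ y, ENNReal.ofReal (rho n j (x - y)) * g y := by
  unfold mollE
  rw [← lintegral_sub_left_eq_self (fun y => ENNReal.ofReal (rho n j (x - y)) * g y) x]
  simp

lemma moll_enorm_le (j : ℕ) (f : Euc n → E) (x : Euc n) :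
    ‖moll j f x‖ₑ ≤ mollE j (fun y => ‖f y‖ₑ) x := by
  refine (enorm_integral_le_lintegral_enorm _).trans (lintegral_mono fun y => ?_)
  rw [enorm_smul, Real.enorm_of_nonneg (rho_nonneg j y)]

lemma moll_enorm_sq_le (j : ℕ) {f : Euc n → E} (hf : AEStronglyMeasurable f volume) (x : Euc n) :
    ‖moll j f x‖ₑ ^ 2 ≤ mollE j (fun y => ‖f y‖ₑ ^ 2) x := by
  refine (pow_le_pow_left₀ zero_le (moll_enorm_le j f x) 2).trans ?_
  have hq : Measure.QuasiMeasurePreserving (fun y : Euc n => x - y) volume volume :=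
    (Measure.measurePreserving_sub_left volume x).quasiMeasurePreserving
  have h := cs_weight (μ := (volume : Measure (Euc n))) (w := fun y => ENNReal.ofReal (rho n j y))
    (g := fun y => ‖f (x - y)‖ₑ) (by have := rho_meas (n := n) j; fun_prop)
      (hf.comp_quasiMeasurePreserving hq).enorm
  rwa [rho_lint, one_mul] at h

lemma mollE_meas (j : ℕ) {g : Euc n → ℝ≥0∞} (hg : AEMeasurable g volume) :
    AEMeasurable (Function.uncurry fun x y : Euc n => ENNReal.ofReal (rho n j (x - y)) * g y)
      (volume.prod volume) := by
  apply AEMeasurable.mul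
  · have := rho_meas (n := n) j
    apply Measurable.aemeasurable
    show Measurable (fun q : Euc n × Euc n => ENNReal.ofReal (rho n j (q.1 - q.2)))
    fun_prop
  · exact hg.comp_quasiMeasurePreserving Measure.quasiMeasurePreserving_snd

lemma lintegral_mollE_mul (j : ℕ) {g k : Euc n → ℝ≥0∞} (hg : AEMeasurable g volume)
    (hk : AEMeasurable k volume) :
    ∫⁻ x, k x * mollE j g x = ∫⁻ x, mollE j k x * g x := by
  have hm := mollE_meas j hg
  have hm2 : AEMeasurable (Function.uncurry fun x y : Euc n => k x * (ENNReal.ofReal (rho n j (x - y)) * g y))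
      (volume.prod volume) :=
    (hk.comp_quasiMeasurePreserving Measure.quasiMeasurePreserving_fst).mul hm
  have e1 : ∀ x, k x * mollE j g x = ∫⁻ y, k x * (ENNReal.ofReal (rho n j (x - y)) * g y) := by
    intro x
    rw [mollE_eq, lintegral_const_mul'']
    have := rho_meas (n := n) j
    exact AEMeasurable.mul (by fun_prop) hg
  have e2 : ∀ y, mollE j k y * g y = ∫⁻ x, k x * (ENNReal.ofReal (rho n j (x - y)) * g y) := by
    intro y
    rw [mollE_eq, ← lintegral_mul_const'']
    · congr 1; ext x
      rw [← rho_neg, neg_sub]; ring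
    · have := rho_meas (n := n) j
      exact AEMeasurable.mul (by fun_prop) hk
  simp_rw [e1, e2]
  exact lintegral_lintegral_swap hm2

lemma lintegral_mollE (j : ℕ) {g : Euc n → ℝ≥0∞} (hg : AEMeasurable g volume) :
    ∫⁻ x, mollE j g x = ∫⁻ x, g x := by
  have := lintegral_mollE_mul j hg (k := fun _ => 1) aemeasurable_const
  simp only [one_mul] at this
  rw [this]
  have : ∀ x, mollE j (fun _ : Euc n => 1) x = 1 := by intro x; simp [mollE, rho_lint]
  simp [this]

lemma moll_L1 [CompleteSpace E] {f : Euc n → E} (hf : Integrable f) :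
    Tendsto (fun j => ∫⁻ x, ‖moll j f x - f x‖ₑ) atTop (𝓝 0) := by
  have hc := fun j => (moll_contDiff j hf.locallyIntegrable).continuous
  have hs := fun j => (hc j).aestronglyMeasurable (μ := volume)
  refine scheffe (b := fun j x => ‖moll j f x‖ₑ) (c := fun x => ‖f x‖ₑ)
    (fun j => ((hs j).sub hf.1).enorm) (fun j => (hs j).enorm) hf.1.enorm ?_ ?_ ?_ ?_ hf.2.ne
  · intro j
    filter_upwards with x
    exact enorm_sub_le
  · filter_upwards [moll_ae hf.locallyIntegrable] with x hx
    have := (hx.sub_const (f x)).enorm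
    simpa using this
  · filter_upwards [moll_ae hf.locallyIntegrable] with x hx using hx.enorm
  · intro j
    refine (lintegral_mono fun x => moll_enorm_le j f x).trans ?_
    rw [lintegral_mollE j hf.1.enorm]

lemma enorm_sub_sq_le (a b : E) : ‖a - b‖ₑ ^ 2 ≤ 2 * ‖a‖ₑ ^ 2 + 2 * ‖b‖ₑ ^ 2 := by
  have h1 : ‖a - b‖ ^ 2 ≤ 2 * ‖a‖ ^ 2 + 2 * ‖b‖ ^ 2 := by
    have := norm_sub_le a b
    nlinarith [sq_nonneg (‖a‖ - ‖b‖), norm_nonneg (a - b), norm_nonneg a, norm_nonneg b]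
  have h2 := ENNReal.ofReal_le_ofReal h1
  rw [ENNReal.ofReal_add (by positivity) (by positivity), ENNReal.ofReal_mul (by norm_num),
    ENNReal.ofReal_mul (by norm_num), ENNReal.ofReal_pow (by positivity),
    ENNReal.ofReal_pow (by positivity), ENNReal.ofReal_pow (by positivity)] at h2
  simpa using h2

lemma moll_L2 [CompleteSpace E] {f : Euc n → E} (hf : LocallyIntegrable f)
    (hf2 : ∫⁻ x, ‖f x‖ₑ ^ 2 ≠ ⊤) :
    Tendsto (fun j => ∫⁻ x, ‖moll j f x - f x‖ₑ ^ 2) atTop (𝓝 0) := by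
  have hc := fun j => (moll_contDiff j hf).continuous
  have hs := fun j => (hc j).aestronglyMeasurable (μ := volume)
  have hfm := hf.aestronglyMeasurable
  refine scheffe (b := fun j x => 2 * ‖moll j f x‖ₑ ^ 2) (c := fun x => 2 * ‖f x‖ₑ ^ 2)
    (fun j => ((hs j).sub hfm).enorm.pow_const _) (fun j => ((hs j).enorm.pow_const _).const_mul _)
    ((hfm.enorm.pow_const _).const_mul _) ?_ ?_ ?_ ?_ ?_
  · intro j
    filter_upwards with x
    exact enorm_sub_sq_le _ _
  · filter_upwards [moll_ae hf] with x hx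
    have := ENNReal.Tendsto.pow (n := 2) (hx.sub_const (f x)).enorm
    simpa using this
  · filter_upwards [moll_ae hf] with x hx
    exact ENNReal.Tendsto.const_mul (ENNReal.Tendsto.pow hx.enorm) (Or.inr (by simp))
  · intro j
    rw [lintegral_const_mul'' _ ((hs j).enorm.pow_const _), lintegral_const_mul'' _ (hfm.enorm.pow_const _)]
    gcongr 2 * ?_
    refine (lintegral_mono fun x => moll_enorm_sq_le j hfm x).trans ?_
    rw [lintegral_mollE j (hfm.enorm.pow_const _)]
  · rw [lintegral_const_mul'' _ (hfm.enorm.pow_const _)]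
    exact ENNReal.mul_ne_top (by simp) hf2

end moll

section wg
variable {n : ℕ}

/-- weak gradient -/
structure WG (U : Set (Euc n)) (f : Euc n → ℝ) (F : Euc n → Euc n) : Prop where
  hf : Integrable f
  hF : Integrable F
  ibp : ∀ ψ : Euc n → ℝ, ContDiff ℝ (⊤ : ℕ∞) ψ → HasCompactSupport ψ → tsupport ψ ⊆ U →
    ∫ x, f x • gradient ψ x = -∫ x, ψ x • F x

lemma WG.mono {U V : Set (Euc n)} {f : Euc n → ℝ} {F : Euc n → Euc n} (h : WG U f F) (hV : V ⊆ U) :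
    WG V f F := ⟨h.hf, h.hF, fun ψ h1 h2 h3 => h.ibp ψ h1 h2 (h3.trans hV)⟩

lemma inner_grad (ψ : Euc n → ℝ) (x v : Euc n) : inner ℝ (gradient ψ x) v = fderiv ℝ ψ x v := by
  rw [gradient]; simp

lemma norm_grad (ψ : Euc n → ℝ) (x : Euc n) : ‖gradient ψ x‖ = ‖fderiv ℝ ψ x‖ := by
  rw [gradient]; simp

lemma cd_diff {ψ : Euc n → ℝ} (h : ContDiff ℝ (⊤ : ℕ∞) ψ) : Differentiable ℝ ψ :=
  h.differentiable (by simp)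

lemma cont_grad {ψ : Euc n → ℝ} (h : ContDiff ℝ (⊤ : ℕ∞) ψ) : Continuous (gradient ψ) :=
  (InnerProductSpace.toDual ℝ (Euc n)).symm.continuous.comp (h.continuous_fderiv (by simp))

lemma supp_grad_sub (ψ : Euc n → ℝ) : tsupport (gradient ψ) ⊆ tsupport ψ := by
  apply closure_minimal _ (isClosed_tsupport ψ)
  intro x hx
  by_contra h
  apply hx
  have := fderiv_of_notMem_tsupport (𝕜 := ℝ) h
  rw [gradient, this]; simp

lemma cs_grad {ψ : Euc n → ℝ} (h : HasCompactSupport ψ) : HasCompactSupport (gradient ψ) :=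
  h.mono' ((subset_tsupport _).trans (supp_grad_sub ψ))

lemma grad_mul {a b : Euc n → ℝ} {x : Euc n} (ha : DifferentiableAt ℝ a x) (hb : DifferentiableAt ℝ b x) :
    gradient (fun y => a y * b y) x = a x • gradient b x + b x • gradient a x := by
  unfold gradient
  rw [fderiv_fun_mul ha hb]; simp

lemma grad_comp {H : ℝ → ℝ} {g : Euc n → ℝ} {x : Euc n} (hH : DifferentiableAt ℝ H (g x))
    (hg : DifferentiableAt ℝ g x) :
    gradient (fun y => H (g y)) x = deriv H (g x) • gradient g x := by
  unfold gradient
  have := (hH.hasDerivAt.comp_hasFDerivAt x hg.hasFDerivAt).fderiv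
  rw [show (fun y => H (g y)) = H ∘ g from rfl, this]; simp

lemma int_smul_bdd {E G : Type*} [NormedAddCommGroup E] [NormedSpace ℝ E] {f : Euc n → ℝ} {g : Euc n → E}
    (hf : Integrable f) (hg : AEStronglyMeasurable g volume) (C : ℝ) (hC : ∀ x, ‖g x‖ ≤ C) :
    Integrable (fun x => f x • g x) := by
  refine (hf.norm.const_mul C).mono' (hf.1.smul hg) ?_
  filter_upwards with x
  rw [norm_smul, mul_comm]
  gcongr
  exact hC x

lemma int_bdd_smul {E : Type*} [NormedAddCommGroup E] [NormedSpace ℝ E] {g : Euc n → ℝ} {f : Euc n → E}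
    (hf : Integrable f) (hg : AEStronglyMeasurable g volume) (C : ℝ) (hC : ∀ x, ‖g x‖ ≤ C) :
    Integrable (fun x => g x • f x) := by
  refine (hf.norm.const_mul C).mono' (hg.smul hf.1) ?_
  filter_upwards with x
  rw [norm_smul]
  gcongr
  exact hC x

lemma cs_bdd {E : Type*} [NormedAddCommGroup E] {g : Euc n → E} (hg : Continuous g) (hc : HasCompactSupport g) :
    ∃ C : ℝ, 0 ≤ C ∧ ∀ x, ‖g x‖ ≤ C := by
  obtain ⟨C, hC⟩ := hc.exists_bound_of_continuous hg
  exact ⟨C, (norm_nonneg _).trans (hC 0), hC⟩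

/-- moll of a function with weak gradient -/
lemma WG.moll_grad {f : Euc n → ℝ} {F : Euc n → Euc n} (h : WG univ f F) (j : ℕ) (x : Euc n) :
    HasGradientAt (moll j f) (moll j F x) x := by
  rw [hasGradientAt_iff_hasFDerivAt]
  have e : moll j f = convolution f (rho n j) (ContinuousLinearMap.lsmul ℝ ℝ) volume := by
    ext z
    rw [moll_smul_int, convolution_def]
    congr 1; ext y; simp [mul_comm]
  have h1 := (rho_cs (n := n) j).hasFDerivAt_convolution_right (ContinuousLinearMap.lsmul ℝ ℝ)
    h.hf.locallyIntegrable ((rho_contDiff j).of_le (by simp)) x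
  rw [e]
  suffices hsuff : (InnerProductSpace.toDual ℝ (Euc n)) (moll j F x) = convolution f (fderiv ℝ (rho n j))
    (ContinuousLinearMap.precompR (Euc n) (ContinuousLinearMap.lsmul ℝ ℝ)) volume x by
    rw [hsuff]; exact h1
  apply ContinuousLinearMap.ext
  intro v
  rw [convolution_precompR_apply _ h.hf.locallyIntegrable ((rho_cs j).fderiv ℝ)
    ((rho_contDiff j).continuous_fderiv (by simp)), convolution_def]
  set ψ : Euc n → ℝ := fun t => rho n j (x - t) with hψ
  have hψc : ContDiff ℝ (⊤ : ℕ∞) ψ := (rho_contDiff j).comp (by fun_prop)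
  have hψs : HasCompactSupport ψ := (rho_cs j).comp_homeomorph (Homeomorph.subLeft x)
  have hi := h.ibp ψ hψc hψs (subset_univ _)
  obtain ⟨C, hC0, hC⟩ := cs_bdd (cont_grad hψc) (cs_grad hψs)
  obtain ⟨C', hC0', hC'⟩ := cs_bdd hψc.continuous hψs
  have hi2 := congrArg (fun z => inner ℝ v z) hi
  simp only [inner_neg_right] at hi2
  rw [← integral_inner (int_smul_bdd (G := ℝ) h.hf (cont_grad hψc).aestronglyMeasurable C hC)] at hi2
  have e3 : ∀ t, fderiv ℝ ψ t v = - fderiv ℝ (rho n j) (x - t) v := by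
    intro t
    have h3 : HasFDerivAt (fun t : Euc n => x - t) (-(ContinuousLinearMap.id ℝ (Euc n))) t :=
      (hasFDerivAt_id t).const_sub x
    have h4 := ((cd_diff (rho_contDiff (n := n) j)) (x - t)).hasFDerivAt.comp t h3
    rw [hψ, show (fun t => rho n j (x - t)) = rho n j ∘ (fun t => x - t) from rfl, h4.fderiv]
    simp
  simp only [InnerProductSpace.toDual_apply_apply]
  rw [moll_smul_int, real_inner_comm]
  have e4 : ∀ t, inner ℝ v (f t • gradient ψ t) = - (ContinuousLinearMap.lsmul ℝ ℝ (f t) (fderiv ℝ (rho n j) (x - t) v)) := by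
    intro t
    rw [inner_smul_right, real_inner_comm, inner_grad, e3]; simp
  simp_rw [e4] at hi2
  rw [integral_neg, neg_inj] at hi2
  exact hi2.symm

lemma WG.moll_gradient {f : Euc n → ℝ} {F : Euc n → Euc n} (h : WG univ f F) (j : ℕ) (x : Euc n) :
    gradient (moll j f) x = moll j F x := (h.moll_grad j x).gradient

lemma WG.mul {U : Set (Euc n)} {f : Euc n → ℝ} {F : Euc n → Euc n} (h : WG U f F) {χ : Euc n → ℝ}
    (hχ : ContDiff ℝ (⊤ : ℕ∞) χ) (hc : HasCompactSupport χ) (hs : tsupport χ ⊆ U) :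
    WG univ (fun x => χ x * f x) (fun x => χ x • F x + f x • gradient χ x) := by
  obtain ⟨C, hC0, hC⟩ := cs_bdd (cont_grad hχ) (cs_grad hc)
  obtain ⟨C', hC0', hC'⟩ := cs_bdd hχ.continuous hc
  have i1 := int_bdd_smul h.hf hχ.continuous.aestronglyMeasurable C' hC'
  have i2 := int_bdd_smul h.hF hχ.continuous.aestronglyMeasurable C' hC'
  have i3 := int_smul_bdd (G := ℝ) h.hf (cont_grad hχ).aestronglyMeasurable C hC
  refine ⟨i1, i2.add i3, fun ψ hψ hψc _ => ?_⟩
  obtain ⟨D, hD0, hD⟩ := cs_bdd hψ.continuous hψc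
  have h1 := h.ibp (fun x => χ x * ψ x) (hχ.mul hψ) hc.mul_right
    ((closure_mono (Function.support_mul_subset_left χ ψ)).trans hs)
  have e : ∀ x, f x • gradient (fun x => χ x * ψ x) x =
      (χ x * f x) • gradient ψ x + ψ x • (f x • gradient χ x) := by
    intro x
    rw [grad_mul (cd_diff hχ x) (cd_diff hψ x), smul_add, smul_smul, smul_smul, smul_smul]
    congr 2 <;> ring
  obtain ⟨D', hD0', hD'⟩ := cs_bdd (cont_grad hψ) (cs_grad hψc)
  simp_rw [e] at h1
  have j1 := int_smul_bdd (G := ℝ) i1 (cont_grad hψ).aestronglyMeasurable D' hD'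
  have j2 := int_bdd_smul i3 hψ.continuous.aestronglyMeasurable D hD
  have j3 := int_bdd_smul i2 hψ.continuous.aestronglyMeasurable D hD
  simp only [smul_eq_mul] at j1
  rw [integral_add j1 j2] at h1
  have e2 : ∀ x, ψ x • (χ x • F x + f x • gradient χ x) = (χ x * ψ x) • F x + ψ x • (f x • gradient χ x) := by
    intro x; rw [smul_add, smul_smul, mul_comm (ψ x)]
  simp_rw [e2]
  have j3' : Integrable (fun x => (χ x * ψ x) • F x) := by
    simpa [smul_smul, mul_comm] using j3
  rw [integral_add j3' j2, neg_add, ← h1]; abel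

/-- classical integration by parts -/
lemma ibp_smooth {g ψ : Euc n → ℝ} (hg : ContDiff ℝ (⊤ : ℕ∞) g) (hψ : ContDiff ℝ (⊤ : ℕ∞) ψ)
    (hψc : HasCompactSupport ψ) :
    ∫ x, g x • gradient ψ x = -∫ x, ψ x • gradient g x := by
  have i1 : Integrable (fun x => g x • gradient ψ x) :=
    (hg.continuous.smul (cont_grad hψ)).integrable_of_hasCompactSupport (cs_grad hψc).smul_left
  have i2 : Integrable (fun x => ψ x • gradient g x) :=
    (hψ.continuous.smul (cont_grad hg)).integrable_of_hasCompactSupport hψc.smul_right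
  apply ext_inner_left ℝ
  intro v
  rw [← integral_inner i1, inner_neg_right, ← integral_inner i2]
  have e1 : ∀ x, inner ℝ v (g x • gradient ψ x) = g x * fderiv ℝ ψ x v := by
    intro x; rw [inner_smul_right, real_inner_comm, inner_grad]
  have e2 : ∀ x, inner ℝ v (ψ x • gradient g x) = fderiv ℝ g x v * ψ x := by
    intro x; rw [inner_smul_right, real_inner_comm, inner_grad, mul_comm]
  simp_rw [e1, e2]
  apply integral_mul_fderiv_eq_neg_fderiv_mul_of_integrable
  · simpa [e2] using i2.const_inner (𝕜 := ℝ) v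
  · simpa [e1] using i1.const_inner (𝕜 := ℝ) v
  · exact (hg.continuous.mul hψ.continuous).integrable_of_hasCompactSupport hψc.mul_left
  · exact fun x _ => cd_diff hg x
  · exact fun x _ => cd_diff hψ x

lemma tendsto_int_L1 {E : Type*} [NormedAddCommGroup E] [NormedSpace ℝ E]
    {g : ℕ → Euc n → E} {f : Euc n → E} (hf : Integrable f) (hg : ∀ j, Integrable (g j))
    (h : Tendsto (fun j => ∫⁻ x, ‖g j x - f x‖ₑ) atTop (𝓝 0)) :
    Tendsto (fun j => ∫ x, g j x) atTop (𝓝 (∫ x, f x)) :=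
  MeasureTheory.tendsto_integral_of_L1 f hf.1 (Eventually.of_forall hg) h

lemma WG.chain {f : Euc n → ℝ} {F : Euc n → Euc n} (h : WG univ f F) {H : ℝ → ℝ}
    (hH : ContDiff ℝ (⊤ : ℕ∞) H) (hH0 : H 0 = 0) (hH1 : ∀ t, |deriv H t| ≤ 1) :
    WG univ (fun x => H (f x)) (fun x => deriv H (f x) • F x) := by
  have hd : Differentiable ℝ H := hH.differentiable (by simp)
  have hH'c : Continuous (deriv H) := hH.continuous_deriv (by simp)
  have hlip : ∀ s t, |H s - H t| ≤ |s - t| := by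
    intro s t
    have := Convex.norm_image_sub_le_of_norm_deriv_le (s := univ) (f := H) (C := 1)
      (fun x _ => hd x) (fun x _ => hH1 x) convex_univ (mem_univ t) (mem_univ s)
    simpa using this
  have i1 : Integrable (fun x => H (f x)) := by
    refine h.hf.norm.mono' (hH.continuous.comp_aestronglyMeasurable h.hf.1) ?_
    filter_upwards with x
    have := hlip (f x) 0
    simpa [hH0] using this
  have i2 : Integrable (fun x => deriv H (f x) • F x) :=
    int_bdd_smul h.hF (hH'c.comp_aestronglyMeasurable h.hf.1) 1 (fun x => hH1 _)
  refine ⟨i1, i2, fun ψ hψ hψc _ => ?_⟩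
  obtain ⟨D, hD0, hD⟩ := cs_bdd hψ.continuous hψc
  obtain ⟨D', hD0', hD'⟩ := cs_bdd (cont_grad hψ) (cs_grad hψc)
  have hsm := fun j => moll_contDiff j h.hf.locallyIntegrable
  have hSM := fun j => moll_contDiff j h.hF.locallyIntegrable
  have key : ∀ j, ∫ x, H (moll j f x) • gradient ψ x = -∫ x, ψ x • (deriv H (moll j f x) • moll j F x) := by
    intro j
    have := ibp_smooth (hH.comp (hsm j)) hψ hψc
    refine this.trans ?_
    congr 2; ext1 x
    rw [show H ∘ moll j f = fun y => H (moll j f y) from rfl, grad_comp (hd _) (cd_diff (hsm j) x), h.moll_gradient]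
  have t1 : Tendsto (fun j => ∫ x, H (moll j f x) • gradient ψ x) atTop
      (𝓝 (∫ x, H (f x) • gradient ψ x)) := by
    apply tendsto_int_L1
    · exact int_smul_bdd (G := ℝ) i1 (cont_grad hψ).aestronglyMeasurable D' hD'
    · intro j
      exact ((hH.continuous.comp (hsm j).continuous).smul (cont_grad hψ)).integrable_of_hasCompactSupport
        (cs_grad hψc).smul_left
    · have hl : Tendsto (fun j => ENNReal.ofReal D' * ∫⁻ x, ‖moll j f x - f x‖ₑ) atTop (𝓝 0) := by
        have := ENNReal.Tendsto.const_mul (moll_L1 h.hf) (Or.inr (ENNReal.ofReal_ne_top (r := D')))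
        simpa using this
      refine tendsto_of_tendsto_of_tendsto_of_le_of_le tendsto_const_nhds hl (fun _ => zero_le) ?_
      intro j
      simp only
      rw [← lintegral_const_mul' _ _ ENNReal.ofReal_ne_top]
      apply lintegral_mono
      intro x
      simp only
      rw [← sub_smul, enorm_smul, mul_comm]
      gcongr
      · rw [← ofReal_norm]; exact ENNReal.ofReal_le_ofReal (hD' x)
      · rw [← ofReal_norm, ← ofReal_norm]; exact ENNReal.ofReal_le_ofReal (hlip _ _)
  have t2 : Tendsto (fun j => ∫ x, ψ x • (deriv H (moll j f x) • moll j F x)) atTop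
      (𝓝 (∫ x, ψ x • (deriv H (f x) • F x))) := by
    apply tendsto_int_L1
    · exact int_bdd_smul i2 hψ.continuous.aestronglyMeasurable D hD
    · intro j
      exact (hψ.continuous.smul ((hH'c.comp (hsm j).continuous).smul (hSM j).continuous)).integrable_of_hasCompactSupport
        hψc.smul_right
    · have hl1 : Tendsto (fun j => ENNReal.ofReal D * ∫⁻ x, ‖moll j F x - F x‖ₑ) atTop (𝓝 0) := by
        have := ENNReal.Tendsto.const_mul (moll_L1 h.hF) (Or.inr (ENNReal.ofReal_ne_top (r := D)))
        simpa using this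
      have hl2 : Tendsto (fun j => ∫⁻ x, ‖ψ x • ((deriv H (moll j f x) - deriv H (f x)) • F x)‖ₑ) atTop (𝓝 0) := by
        have : (0 : ℝ≥0∞) = ∫⁻ x : Euc n, 0 := by simp
        rw [this]
        apply tendsto_lintegral_of_dominated_convergence' (fun x => ENNReal.ofReal (2 * D) * ‖F x‖ₑ)
        · intro j
          have := (hH'c.comp (hsm j).continuous).aestronglyMeasurable (μ := volume)
          exact (hψ.continuous.aestronglyMeasurable.smul
            ((this.sub (hH'c.comp_aestronglyMeasurable h.hf.1)).smul h.hF.1)).enorm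
        · intro j
          filter_upwards with x
          rw [smul_smul, enorm_smul]
          gcongr
          rw [← ofReal_norm]
          apply ENNReal.ofReal_le_ofReal
          rw [norm_mul, mul_comm]
          gcongr
          · have a1 := hH1 (moll j f x)
            have a2 := hH1 (f x)
            rw [Real.norm_eq_abs]
            rw [abs_le] at *
            constructor <;> linarith
          · exact hD x
        · rw [lintegral_const_mul'' _ h.hF.1.enorm]
          exact ENNReal.mul_ne_top ENNReal.ofReal_ne_top h.hF.2.ne
        · filter_upwards [moll_ae h.hf.locallyIntegrable] with x hx
          have h1 : Tendsto (fun j => deriv H (moll j f x) - deriv H (f x)) atTop (𝓝 0) := by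
            have := ((hH'c.tendsto (f x)).comp hx).sub_const (deriv H (f x))
            simpa using this
          have h2 := ((h1.smul_const (F x)).const_smul (ψ x)).enorm
          simpa using h2
      have hl := hl1.add hl2
      rw [add_zero] at hl
      refine tendsto_of_tendsto_of_tendsto_of_le_of_le tendsto_const_nhds hl (fun _ => zero_le) ?_
      intro j
      simp only
      rw [← lintegral_const_mul' _ _ ENNReal.ofReal_ne_top, ← lintegral_add_left']
      swap
      · have := ((hSM j).continuous.aestronglyMeasurable (μ := volume)).sub h.hF.1
        exact this.enorm.const_mul _
      apply lintegral_mono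
      intro x
      simp only
      have : ψ x • (deriv H (moll j f x) • moll j F x) - ψ x • (deriv H (f x) • F x) =
        (ψ x * deriv H (moll j f x)) • (moll j F x - F x) + ψ x • ((deriv H (moll j f x) - deriv H (f x)) • F x) := by
        module
      rw [this]
      refine (enorm_add_le _ _).trans ?_
      gcongr
      rw [enorm_smul]
      gcongr
      rw [← ofReal_norm]
      apply ENNReal.ofReal_le_ofReal
      rw [norm_mul]
      calc _ ≤ D * 1 := mul_le_mul (hD x) (hH1 _) (abs_nonneg _) hD0
        _ = D := mul_one D
  have := t1.congr key
  exact tendsto_nhds_unique this t2.neg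
end wg

section pos
variable {n : ℕ}

/-- smooth approximation of the positive part -/
def Hs (k b t : ℝ) : ℝ := ((t - k - b) + √((t - k - b) ^ 2 + b ^ 4)) / 2

lemma Hs_contDiff (k : ℝ) {b : ℝ} (hb : 0 < b) : ContDiff ℝ (⊤ : ℕ∞) (Hs k b) := by
  unfold Hs
  apply ContDiff.div_const
  apply ContDiff.add (by fun_prop)
  apply ContDiff.sqrt (by fun_prop)
  intro x; positivity

lemma Hs_deriv (k : ℝ) {b : ℝ} (hb : 0 < b) (t : ℝ) :
    HasDerivAt (Hs k b) ((1 + (t - k - b) / √((t - k - b) ^ 2 + b ^ 4)) / 2) t := by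
  have h1 : HasDerivAt (fun t => t - k - b) 1 t := ((hasDerivAt_id t).sub_const k).sub_const b
  have h2 : HasDerivAt (fun t => (t - k - b) ^ 2 + b ^ 4) (2 * (t - k - b)) t := by
    have := (h1.pow 2).add_const (b ^ 4)
    simpa using this
  have h3 := h2.sqrt (by positivity)
  have h4 := (h1.add h3).div_const 2
  rw [mul_div_mul_left _ _ two_ne_zero] at h4
  exact h4

lemma Hs_deriv_bd (k : ℝ) {b : ℝ} (hb : 0 < b) (t : ℝ) : |deriv (Hs k b) t| ≤ 1 := by
  rw [(Hs_deriv k hb t).deriv]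
  set s := t - k - b
  have h0 : 0 < √(s ^ 2 + b ^ 4) := Real.sqrt_pos.2 (by positivity)
  have h1 : |s| ≤ √(s ^ 2 + b ^ 4) := by
    apply Real.abs_le_sqrt; linarith [pow_pos hb 4]
  have h2 : |s / √(s ^ 2 + b ^ 4)| ≤ 1 := by
    rw [abs_div, abs_of_pos h0]; exact (div_le_one h0).2 h1
  rw [abs_le] at *
  constructor <;> linarith

lemma Hs_tendsto (k t : ℝ) : Tendsto (fun j => Hs k (eps j) t) atTop (𝓝 (max (t - k) 0)) := by
  have hc : Continuous (fun b => Hs k b t) := by unfold Hs; fun_prop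
  have := (hc.tendsto 0).comp eps_tendsto
  suffices e' : max (t - k) 0 = Hs k 0 t by rw [e']; exact this
  unfold Hs
  have e : (t - k - 0) ^ 2 + (0 : ℝ) ^ 4 = (t - k) ^ 2 := by ring
  rw [e, Real.sqrt_sq_eq_abs, sub_zero]
  rcases le_total 0 (t - k) with h | h
  · rw [max_eq_left h, abs_of_nonneg h]; ring
  · rw [max_eq_right h, abs_of_nonpos h]; ring

lemma Hs_deriv_tendsto (k t : ℝ) :
    Tendsto (fun j => deriv (Hs k (eps j)) t) atTop (𝓝 (if k < t then 1 else 0)) := by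
  simp_rw [fun j => (Hs_deriv k (eps_pos j) t).deriv]
  by_cases ht : t = k
  · subst ht
    rw [if_neg (lt_irrefl _)]
    have hc : Continuous (fun b : ℝ => (1 + -1 / √(1 + b ^ 2)) / 2) := by
      apply Continuous.div_const
      apply continuous_const.add
      apply continuous_const.div (by fun_prop)
      intro x; exact (Real.sqrt_pos.2 (by positivity)).ne'
    have := (hc.tendsto 0).comp eps_tendsto
    have e0 : ((1 : ℝ) + -1 / √(1 + 0 ^ 2)) / 2 = 0 := by norm_num
    rw [e0] at this
    refine this.congr fun j => ?_
    have hb := eps_pos j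
    simp only [Function.comp]
    have e : (t - t - eps j) ^ 2 + eps j ^ 4 = eps j ^ 2 * (1 + eps j ^ 2) := by ring
    rw [e, Real.sqrt_mul (by positivity), Real.sqrt_sq hb.le]
    have h1 : 0 < √(1 + eps j ^ 2) := Real.sqrt_pos.2 (by positivity)
    congr 2
    field_simp
    ring
  · have hne : √((t - k - 0) ^ 2 + (0 : ℝ) ^ 4) ≠ 0 := by
      have e : (t - k - 0) ^ 2 + (0 : ℝ) ^ 4 = (t - k) ^ 2 := by ring
      rw [e, Real.sqrt_sq_eq_abs]
      simpa [sub_eq_zero] using ht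
    have hc : ContinuousAt (fun b : ℝ => (1 + (t - k - b) / √((t - k - b) ^ 2 + b ^ 4)) / 2) 0 := by
      apply ContinuousAt.div_const
      apply continuousAt_const.add
      exact ContinuousAt.div (by fun_prop) (by fun_prop) hne
    have := hc.tendsto.comp eps_tendsto
    suffices e' : (if k < t then (1 : ℝ) else 0) = (1 + (t - k - 0) / √((t - k - 0) ^ 2 + 0 ^ 4)) / 2 by
      rw [e']; exact this
    have e : (t - k - 0) ^ 2 + (0 : ℝ) ^ 4 = (t - k) ^ 2 := by ring
    rw [e, Real.sqrt_sq_eq_abs, sub_zero]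
    have htk : t - k ≠ 0 := sub_ne_zero.2 ht
    split_ifs with h
    · rw [abs_of_pos (by linarith), div_self htk]; norm_num
    · rw [abs_of_neg (lt_of_le_of_ne (by linarith) htk), div_neg, div_self htk]; norm_num

/-- gradient of the truncated function -/
def tg (k : ℝ) (f : Euc n → ℝ) (F : Euc n → Euc n) (x : Euc n) : Euc n :=
  (if k < f x then (1 : ℝ) else 0) • F x

lemma tg_meas {k : ℝ} {f : Euc n → ℝ} {F : Euc n → Euc n} (hf : AEStronglyMeasurable f volume)
    (hF : AEStronglyMeasurable F volume) : AEStronglyMeasurable (tg k f F) volume := by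
  have : Measurable (fun t : ℝ => if k < t then (1 : ℝ) else 0) :=
    Measurable.ite measurableSet_Ioi measurable_const measurable_const
  have h1 : AEStronglyMeasurable (fun x => if k < f x then (1 : ℝ) else 0) volume :=
    (this.comp_aemeasurable hf.aemeasurable).aestronglyMeasurable
  exact h1.smul hF

lemma tg_norm_le (k : ℝ) (f : Euc n → ℝ) (F : Euc n → Euc n) (x : Euc n) : ‖tg k f F x‖ ≤ ‖F x‖ := by
  unfold tg
  split_ifs <;> simp

lemma WG.pos {f : Euc n → ℝ} {F : Euc n → Euc n} (h : WG univ f F) {k : ℝ} (hk : 0 ≤ k) :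
    WG univ (fun x => max (f x - k) 0) (tg k f F) := by
  set H : ℕ → ℝ → ℝ := fun j t => Hs k (eps j) t - Hs k (eps j) 0 with hHdef
  have hder : ∀ j, deriv (H j) = deriv (Hs k (eps j)) := by
    intro j; ext t; simp only [hHdef]; rw [deriv_sub_const]
  have hch := fun j => h.chain (H := H j) ((Hs_contDiff k (eps_pos j)).sub contDiff_const)
    (by simp [hHdef]) (fun t => by rw [hder]; exact Hs_deriv_bd k (eps_pos j) t)
  have hlip : ∀ j t, |H j t| ≤ |t| := by
    intro j t
    have := Convex.norm_image_sub_le_of_norm_deriv_le (s := univ) (f := H j) (C := 1)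
      (fun x _ => (((Hs_contDiff k (eps_pos j)).sub contDiff_const).differentiable (by simp)) x)
      (fun x _ => by rw [hder]; exact Hs_deriv_bd k (eps_pos j) x) convex_univ (mem_univ 0) (mem_univ t)
    simpa [hHdef] using this
  have hlim : ∀ t, Tendsto (fun j => H j t) atTop (𝓝 (max (t - k) 0)) := by
    intro t
    have := (Hs_tendsto k t).sub (Hs_tendsto k 0)
    rw [max_eq_right (by linarith : 0 - k ≤ 0), sub_zero] at this
    exact this
  have i1 : Integrable (fun x => max (f x - k) 0) := by
    refine h.hf.norm.mono' ((h.hf.1.sub aestronglyMeasurable_const).sup aestronglyMeasurable_const) ?_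
    filter_upwards with x
    rw [Real.norm_eq_abs, abs_of_nonneg (le_max_right _ _), Real.norm_eq_abs]
    exact max_le (by linarith [le_abs_self (f x)]) (abs_nonneg _)
  have i2 : Integrable (tg k f F) := by
    refine h.hF.norm.mono' (tg_meas h.hf.1 h.hF.1) ?_
    filter_upwards with x using tg_norm_le k f F x
  refine ⟨i1, i2, fun ψ hψ hψc _ => ?_⟩
  obtain ⟨D, hD0, hD⟩ := cs_bdd hψ.continuous hψc
  obtain ⟨D', hD0', hD'⟩ := cs_bdd (cont_grad hψ) (cs_grad hψc)
  have t1 : Tendsto (fun j => ∫ x, H j (f x) • gradient ψ x) atTop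
      (𝓝 (∫ x, max (f x - k) 0 • gradient ψ x)) := by
    apply tendsto_integral_of_dominated_convergence (fun x => |f x| * D')
    · intro j
      exact ((hch j).hf.1).smul (cont_grad hψ).aestronglyMeasurable
    · exact h.hf.norm.mul_const D'
    · intro j
      filter_upwards with x
      rw [norm_smul]
      exact mul_le_mul (hlip j _) (hD' x) (norm_nonneg _) (abs_nonneg _)
    · filter_upwards with x using (hlim _).smul_const _
  have t2 : Tendsto (fun j => ∫ x, ψ x • (deriv (H j) (f x) • F x)) atTop
      (𝓝 (∫ x, ψ x • tg k f F x)) := by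
    apply tendsto_integral_of_dominated_convergence (fun x => D * ‖F x‖)
    · intro j
      exact hψ.continuous.aestronglyMeasurable.smul (hch j).hF.1
    · exact h.hF.norm.const_mul D
    · intro j
      filter_upwards with x
      rw [norm_smul, norm_smul]
      have h1 : ‖deriv (H j) (f x)‖ ≤ 1 := by rw [hder]; exact Hs_deriv_bd k (eps_pos j) _
      calc _ ≤ D * (1 * ‖F x‖) := by gcongr; exact hD x
        _ = _ := by ring
    · filter_upwards with x
      apply Tendsto.const_smul
      unfold tg
      apply Tendsto.smul_const
      simp_rw [hder]
      exact Hs_deriv_tendsto k (f x)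
  exact tendsto_nhds_unique (t1.congr fun j => (hch j).ibp ψ hψ hψc (subset_univ _)) t2.neg

/-- smooth cutoff by mollification -/
lemma moll_const_of {j : ℕ} {f : Euc n → ℝ} {x : Euc n} {c : ℝ} (h : ∀ y ∈ ball x (eps j), f y = c) :
    moll j f x = c := by
  unfold moll
  have : ∀ y, rho n j y • f (x - y) = rho n j y * c := by
    intro y
    by_cases hy : eps j ≤ ‖y‖
    · simp [rho_zero j hy]
    · rw [h, smul_eq_mul]
      rw [mem_ball, dist_eq_norm]; simpa using hy
  simp_rw [this]
  rw [integral_mul_const, rho_int, one_mul]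

lemma moll_mem_Icc (j : ℕ) {f : Euc n → ℝ} (hf : LocallyIntegrable f) (h : ∀ y, f y ∈ Icc (0 : ℝ) 1) (x : Euc n) :
    moll j f x ∈ Icc (0 : ℝ) 1 := by
  have hi : Integrable (fun y => rho n j y • f (x - y)) :=
    (rho_cs j).convolutionExists_left (ContinuousLinearMap.lsmul ℝ ℝ) (rho_cont j) hf x
  constructor
  · exact integral_nonneg fun y => mul_nonneg (rho_nonneg j y) (h _).1
  · rw [← rho_int (n := n) j]
    refine integral_mono hi (rho_integrable j) fun y => ?_
    exact mul_le_of_le_one_right (rho_nonneg j y) (h _).2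

lemma moll_lip (j : ℕ) {f : Euc n → ℝ} (hc : Continuous f) {L : ℝ} (hL : 0 ≤ L)
    (h : ∀ x y, |f x - f y| ≤ L * ‖x - y‖) (x : Euc n) : ‖gradient (moll j f) x‖ ≤ L := by
  have hi : ∀ x, Integrable (fun y => rho n j y • f (x - y)) := fun x =>
    (rho_cs j).convolutionExists_left (ContinuousLinearMap.lsmul ℝ ℝ) (rho_cont j) hc.locallyIntegrable x
  have hl : LipschitzWith L.toNNReal (moll j f) := by
    apply LipschitzWith.of_dist_le_mul
    intro x y
    rw [Real.coe_toNNReal _ hL, dist_eq_norm, dist_eq_norm]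
    unfold moll
    rw [← integral_sub (hi x) (hi y)]
    refine (norm_integral_le_integral_norm _).trans ?_
    have : ∫ t, rho n j t * (L * ‖x - y‖) = L * ‖x - y‖ := by
      rw [integral_mul_const, rho_int, one_mul]
    rw [← this]
    refine integral_mono ((hi x).sub (hi y)).norm ((rho_integrable j).mul_const _) fun t => ?_
    simp only
    rw [← smul_sub, norm_smul, Real.norm_of_nonneg (rho_nonneg j t)]
    gcongr
    · exact rho_nonneg j t
    · have := h (x - t) (y - t)
      simpa using this
  rw [norm_grad]
  have := norm_fderiv_le_of_lipschitz ℝ hl (x₀ := x)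
  rwa [Real.coe_toNNReal _ hL] at this

lemma exists_cutoff {K U : Set (Euc n)} (hK : IsCompact K) (hU : IsOpen U) (hKU : K ⊆ U) :
    ∃ χ : Euc n → ℝ, ContDiff ℝ (⊤ : ℕ∞) χ ∧ HasCompactSupport χ ∧ tsupport χ ⊆ U ∧
      (∀ x ∈ K, χ x = 1) ∧ (∀ x, χ x ∈ Icc (0 : ℝ) 1) := by
  obtain ⟨δ, hδ, hδU⟩ := hK.exists_cthickening_subset_open hU hKU
  obtain ⟨j, hj⟩ := (eps_tendsto.eventually_lt_const (show 0 < δ / 2 by positivity)).exists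
  set T := Metric.thickening (δ / 2) K
  have hT : MeasurableSet T := isOpen_thickening.measurableSet
  set g : Euc n → ℝ := T.indicator (fun _ => 1)
  have hg : LocallyIntegrable g := by
    apply LocallyIntegrable.indicator _ hT
    exact continuous_const.locallyIntegrable
  have hg01 : ∀ y, g y ∈ Icc (0 : ℝ) 1 := by
    intro y; simp only [g, indicator]; split_ifs <;> simp
  have hsub : Function.support (moll j g) ⊆ cthickening δ K := by
    intro x hx
    by_contra hn
    apply hx
    apply moll_zero_of
    intro y hy
    apply indicator_of_notMem
    intro hyT
    apply hn
    obtain ⟨z, hz, hzy⟩ := mem_thickening_iff.1 hyT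
    rw [mem_ball, dist_comm] at hy
    exact mem_cthickening_of_dist_le x z δ K hz (by linarith [dist_triangle x y z])
  have hts : tsupport (moll j g) ⊆ cthickening δ K := closure_minimal hsub isClosed_cthickening
  refine ⟨moll j g, moll_contDiff j hg, ?_, hts.trans hδU, ?_, moll_mem_Icc j hg hg01⟩
  · exact hK.cthickening.of_isClosed_subset (isClosed_tsupport _) hts
  · intro x hx
    apply moll_const_of
    intro y hy
    apply indicator_of_mem
    exact mem_thickening_iff.2 ⟨x, hx, by rw [mem_ball] at hy; linarith⟩

lemma WG.pos_local {U : Set (Euc n)} (hU : IsOpen U) {f : Euc n → ℝ} {F : Euc n → Euc n} (h : WG U f F)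
    {k : ℝ} (hk : 0 ≤ k) : WG U (fun x => max (f x - k) 0) (tg k f F) := by
  have i1 : Integrable (fun x => max (f x - k) 0) := by
    refine h.hf.norm.mono' ((h.hf.1.sub aestronglyMeasurable_const).sup aestronglyMeasurable_const) ?_
    filter_upwards with x
    rw [Real.norm_eq_abs, abs_of_nonneg (le_max_right _ _), Real.norm_eq_abs]
    exact max_le (by linarith [le_abs_self (f x)]) (abs_nonneg _)
  have i2 : Integrable (tg k f F) := by
    refine h.hF.norm.mono' (tg_meas h.hf.1 h.hF.1) ?_
    filter_upwards with x using tg_norm_le k f F x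
  refine ⟨i1, i2, fun ψ hψ hψc hψU => ?_⟩
  obtain ⟨δ, hδ, hδU⟩ := hψc.isCompact.exists_cthickening_subset_open hU hψU
  obtain ⟨χ, hχ, hχc, hχU, hχ1, _⟩ := exists_cutoff (hψc.isCompact.cthickening (r := δ)) hU hδU
  have h1 := ((h.mul hχ hχc hχU).pos hk).ibp ψ hψ hψc (subset_univ _)
  have h1x : ∀ x ∈ tsupport ψ, χ x = 1 := fun x hx => hχ1 x (self_subset_cthickening _ hx)
  have hgx : ∀ x ∈ tsupport ψ, gradient χ x = 0 := by
    intro x hx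
    have : χ =ᶠ[𝓝 x] fun _ => 1 := by
      filter_upwards [ball_mem_nhds x hδ] with y hy
      exact hχ1 y (mem_cthickening_of_dist_le y x δ _ hx hy.le)
    rw [this.gradient_eq]; simp
  have e1 : ∀ x, max (χ x * f x - k) 0 • gradient ψ x = max (f x - k) 0 • gradient ψ x := by
    intro x
    by_cases hx : x ∈ tsupport ψ
    · rw [h1x x hx, one_mul]
    · have : gradient ψ x = 0 := image_eq_zero_of_notMem_tsupport (fun h => hx (supp_grad_sub ψ h))
      rw [this]; simp
  have e2 : ∀ x, ψ x • tg k (fun x => χ x * f x) (fun x => χ x • F x + f x • gradient χ x) x = ψ x • tg k f F x := by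
    intro x
    by_cases hx : x ∈ tsupport ψ
    · simp only [tg, h1x x hx, hgx x hx, one_mul, one_smul, smul_zero, add_zero]
    · rw [image_eq_zero_of_notMem_tsupport hx]; simp
  simp_rw [e1, e2] at h1
  exact h1
end pos

section hardy
variable {n : ℕ}

lemma lint_half : ∫⁻ t in Ioc (0 : ℝ) 1, ENNReal.ofReal (t ^ (-(1 / 2) : ℝ)) ≤ 2 := by
  have hi : IntegrableOn (fun t : ℝ => t ^ (-(1 / 2) : ℝ)) (Ioc 0 1) := by
    have := intervalIntegral.intervalIntegrable_rpow' (a := 0) (b := 1) (r := -(1 / 2)) (by norm_num)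
    rwa [intervalIntegrable_iff_integrableOn_Ioc_of_le zero_le_one] at this
  rw [← ofReal_integral_eq_lintegral_ofReal hi]
  · rw [← intervalIntegral.integral_of_le zero_le_one, integral_rpow (by left; norm_num)]
    norm_num
  · filter_upwards [ae_restrict_mem measurableSet_Ioc] with t ht
    exact Real.rpow_nonneg ht.1.le _

lemma ftc_enorm {g : Euc n → ℝ} (hg : ContDiff ℝ (⊤ : ℕ∞) g) (y z : Euc n) :
    ‖g (y + z) - g y‖ₑ ≤ ‖z‖ₑ * ∫⁻ t in Ioc (0 : ℝ) 1, ‖gradient g (y + t • z)‖ₑ := by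
  have hd : ∀ t : ℝ, HasDerivAt (fun t : ℝ => g (y + t • z)) (fderiv ℝ g (y + t • z) z) t := by
    intro t
    have h1 : HasDerivAt (fun t : ℝ => y + t • z) z t := by
      simpa using ((hasDerivAt_id t).smul_const z).const_add y
    exact ((cd_diff hg) (y + t • z)).hasFDerivAt.comp_hasDerivAt t h1
  have hc : Continuous (fun t : ℝ => fderiv ℝ g (y + t • z) z) := by
    have := hg.continuous_fderiv (by simp)
    fun_prop
  have h := intervalIntegral.integral_eq_sub_of_hasDerivAt (a := 0) (b := 1) (fun t _ => hd t)
    (hc.intervalIntegrable _ _)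
  simp only [one_smul, zero_smul, add_zero] at h
  rw [← h, intervalIntegral.integral_of_le zero_le_one]
  refine (enorm_integral_le_lintegral_enorm _).trans ?_
  rw [← lintegral_const_mul' _ _ enorm_ne_top]
  refine lintegral_mono fun t => ?_
  rw [← inner_grad, mul_comm]
  have := norm_inner_le_norm (𝕜 := ℝ) (gradient g (y + t • z)) z
  rw [← ofReal_norm, ← ofReal_norm, ← ofReal_norm, ← ENNReal.ofReal_mul (norm_nonneg _)]
  exact ENNReal.ofReal_le_ofReal this

lemma hardy_y (hn : 2 ≤ n) {g : Euc n → ℝ} (hg : ContDiff ℝ (⊤ : ℕ∞) g) (y : Euc n) :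
    ∫⁻ x, ‖g x - g y‖ₑ ^ 2 * kerE ((n : ℝ) + 1) (x - y) ≤
      4 * ∫⁻ x, ‖gradient g x‖ₑ ^ 2 * kerE ((n : ℝ) - 1) (x - y) := by
  have hcg := cont_grad hg
  have hmk := measurable_kerE (n := n) ((n : ℝ) - 1)
  have tr : ∀ f : Euc n → ℝ≥0∞, ∫⁻ x, f x = ∫⁻ z, f (y + z) := fun f =>
    (lintegral_add_left_eq_self f y).symm
  rw [tr, tr (fun x => ‖gradient g x‖ₑ ^ 2 * kerE ((n : ℝ) - 1) (x - y))]
  simp only [add_sub_cancel_left]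
  set G : Euc n → ℝ≥0∞ := fun z => ‖gradient g (y + z)‖ₑ ^ 2 * kerE ((n : ℝ) - 1) z with hG
  have hGm : Measurable G := by
    apply Measurable.mul _ hmk
    have : Continuous fun z => gradient g (y + z) := by fun_prop
    exact this.measurable.enorm.pow_const 2
  have key : ∀ᵐ z : Euc n, ‖g (y + z) - g y‖ₑ ^ 2 * kerE ((n : ℝ) + 1) z ≤
      2 * ∫⁻ t in Ioc (0 : ℝ) 1, ENNReal.ofReal (t ^ (1 / 2 : ℝ) * t ^ ((n : ℝ) - 1)) * G (t • z) := by
    have hne : ∀ᵐ z : Euc n, z ≠ 0 := by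
      have : NeZero n := ⟨by omega⟩
      have : Nontrivial (Euc n) := inferInstance
      exact Measure.ae_ne volume 0
    filter_upwards [hne] with z hz
    have hz0 : 0 < ‖z‖ := norm_pos_iff.2 hz
    have hm1 : Measurable fun t : ℝ => ‖gradient g (y + t • z)‖ₑ := by
      have : Continuous fun t : ℝ => gradient g (y + t • z) := by fun_prop
      exact this.measurable.enorm
    have c1 : (∫⁻ t in Ioc (0 : ℝ) 1, ‖gradient g (y + t • z)‖ₑ) ^ 2 ≤
        2 * ∫⁻ t in Ioc (0 : ℝ) 1, ENNReal.ofReal (t ^ (1 / 2 : ℝ)) * ‖gradient g (y + t • z)‖ₑ ^ 2 := by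
      have := cs_weight (μ := volume.restrict (Ioc (0 : ℝ) 1))
        (w := fun t => ENNReal.ofReal (t ^ (-(1 / 2) : ℝ)))
        (g := fun t => ENNReal.ofReal (t ^ (1 / 2 : ℝ)) * ‖gradient g (y + t • z)‖ₑ)
        (by fun_prop) (by fun_prop)
      have e1 : ∫⁻ t in Ioc (0 : ℝ) 1, ‖gradient g (y + t • z)‖ₑ = ∫⁻ t in Ioc (0 : ℝ) 1,
          ENNReal.ofReal (t ^ (-(1 / 2) : ℝ)) * (ENNReal.ofReal (t ^ (1 / 2 : ℝ)) * ‖gradient g (y + t • z)‖ₑ) := by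
        refine setLIntegral_congr_fun measurableSet_Ioc fun t ht => ?_
        rw [← mul_assoc, ← ENNReal.ofReal_mul (Real.rpow_nonneg ht.1.le _), ← Real.rpow_add ht.1]
        norm_num
      have e2 : ∫⁻ t in Ioc (0 : ℝ) 1, ENNReal.ofReal (t ^ (1 / 2 : ℝ)) * ‖gradient g (y + t • z)‖ₑ ^ 2
          = ∫⁻ t in Ioc (0 : ℝ) 1, ENNReal.ofReal (t ^ (-(1 / 2) : ℝ)) *
            (ENNReal.ofReal (t ^ (1 / 2 : ℝ)) * ‖gradient g (y + t • z)‖ₑ) ^ 2 := by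
        refine setLIntegral_congr_fun measurableSet_Ioc fun t ht => ?_
        rw [mul_pow, ← mul_assoc, ← ENNReal.ofReal_pow (Real.rpow_nonneg ht.1.le _),
          ← ENNReal.ofReal_mul (Real.rpow_nonneg ht.1.le _)]
        congr 2
        rw [← Real.rpow_natCast, ← Real.rpow_mul ht.1.le, ← Real.rpow_add ht.1]
        norm_num
      rw [e1, e2]
      exact this.trans (mul_le_mul_left lint_half _)
    have c2 := pow_le_pow_left₀ zero_le (ftc_enorm hg y z) 2
    rw [mul_pow] at c2
    have c3 : ‖z‖ₑ ^ 2 * kerE ((n : ℝ) + 1) z = kerE ((n : ℝ) - 1) z := by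
      unfold kerE
      rw [← ofReal_norm, ← ENNReal.ofReal_pow hz0.le, ← ENNReal.ofReal_mul (by positivity),
        ← Real.rpow_natCast, ← Real.rpow_add hz0]
      congr 2; push_cast; ring
    calc _ ≤ ‖z‖ₑ ^ 2 * (∫⁻ t in Ioc (0 : ℝ) 1, ‖gradient g (y + t • z)‖ₑ) ^ 2 * kerE ((n : ℝ) + 1) z := by
          gcongr
      _ = kerE ((n : ℝ) - 1) z * (∫⁻ t in Ioc (0 : ℝ) 1, ‖gradient g (y + t • z)‖ₑ) ^ 2 := by
          rw [← c3]; ring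
      _ ≤ kerE ((n : ℝ) - 1) z * (2 * ∫⁻ t in Ioc (0 : ℝ) 1, ENNReal.ofReal (t ^ (1 / 2 : ℝ)) *
            ‖gradient g (y + t • z)‖ₑ ^ 2) := by gcongr
      _ = 2 * (kerE ((n : ℝ) - 1) z * ∫⁻ t in Ioc (0 : ℝ) 1, ENNReal.ofReal (t ^ (1 / 2 : ℝ)) *
            ‖gradient g (y + t • z)‖ₑ ^ 2) := by ring
      _ = _ := by
          congr 1
          rw [← lintegral_const_mul' _ _ (by unfold kerE; exact ENNReal.ofReal_ne_top)]
          refine setLIntegral_congr_fun measurableSet_Ioc fun t ht => ?_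
          simp only [hG]
          rw [kerE_smul _ ht.1, ENNReal.ofReal_mul (Real.rpow_nonneg ht.1.le _)]
          have : ENNReal.ofReal (t ^ ((n : ℝ) - 1)) * ENNReal.ofReal (t ^ (-((n : ℝ) - 1))) = 1 := by
            rw [← ENNReal.ofReal_mul (Real.rpow_nonneg ht.1.le _), ← Real.rpow_add ht.1]; simp
          calc _ = ENNReal.ofReal (t ^ (1 / 2 : ℝ)) * 1 * ‖gradient g (y + t • z)‖ₑ ^ 2 *
                kerE ((n : ℝ) - 1) z := by ring
            _ = _ := by rw [← this]; ring
  refine (lintegral_mono_ae key).trans ?_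
  rw [lintegral_const_mul' _ _ (by norm_num)]
  rw [lintegral_lintegral_swap (f := fun (z : Euc n) (t : ℝ) => ENNReal.ofReal (t ^ (1 / 2 : ℝ) * t ^ ((n : ℝ) - 1)) * G (t • z))]
  · have e : ∀ t ∈ Ioc (0 : ℝ) 1, ∫⁻ z, ENNReal.ofReal (t ^ (1 / 2 : ℝ) * t ^ ((n : ℝ) - 1)) * G (t • z) =
        (∫⁻ z, G z) * ENNReal.ofReal (t ^ (-(1 / 2) : ℝ)) := by
      intro t ht
      rw [lintegral_const_mul' _ _ ENNReal.ofReal_ne_top, lintegral_scale G hGm ht.1, ← mul_assoc,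
        ← ENNReal.ofReal_mul (mul_nonneg (Real.rpow_nonneg ht.1.le _) (Real.rpow_nonneg ht.1.le _)), mul_comm]
      congr 2
      rw [← Real.rpow_add ht.1, ← Real.rpow_add ht.1]
      congr 1; ring
    rw [setLIntegral_congr_fun measurableSet_Ioc e, lintegral_const_mul _ (by fun_prop)]
    calc _ ≤ 2 * ((∫⁻ z, G z) * 2) := by gcongr; exact lint_half
      _ = _ := by ring
  · apply Measurable.aemeasurable
    have : Measurable fun p : Euc n × ℝ => G (p.2 • p.1) := hGm.comp (by fun_prop)
    exact Measurable.mul (by fun_prop) this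
end hardy

lemma gns (n : ℕ) (hn : 2 ≤ n) : ∃ C : ℝ≥0∞, C ≠ ⊤ ∧ ∀ g : Euc n → ℝ, ContDiff ℝ 1 g → HasCompactSupport g →
    ∀ S : Set (Euc n), MeasurableSet S →
      ∫⁻ x in S, ‖g x‖ₑ ≤ C * volume S ^ (1 / (n : ℝ)) * ∫⁻ x, ‖fderiv ℝ g x‖ₑ := by
  have hn1 : (1 : ℝ) < n := by exact_mod_cast hn
  have hp := Real.HolderConjugate.conjExponent hn1
  set p := Real.conjExponent (n : ℝ)
  have hp0 : 0 < p := hp.symm.pos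
  refine ⟨(lintegralPowLePowLIntegralFDerivConst (volume : Measure (Euc n)) p : ℝ≥0∞) ^ (1 / p), ?_, ?_⟩
  · exact ENNReal.rpow_ne_top_of_nonneg (by positivity) ENNReal.coe_ne_top
  intro g hg hgc S hS
  have h1 := lintegral_pow_le_pow_lintegral_fderiv (μ := (volume : Measure (Euc n))) hg hgc
    (p := p) (by rw [finrank_euc]; exact hp)
  have h2 := ENNReal.lintegral_mul_le_Lp_mul_Lq (volume.restrict S) hp (f := fun _ => 1)
    (g := fun x => ‖g x‖ₑ) aemeasurable_const hg.continuous.measurable.enorm.aemeasurable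
  simp only [Pi.mul_apply, one_mul, ENNReal.one_rpow, lintegral_const, Measure.restrict_apply_univ] at h2
  refine h2.trans ?_
  have h3 : (∫⁻ x in S, ‖g x‖ₑ ^ p) ^ (1 / p) ≤
      (lintegralPowLePowLIntegralFDerivConst (volume : Measure (Euc n)) p : ℝ≥0∞) ^ (1 / p) * ∫⁻ x, ‖fderiv ℝ g x‖ₑ := by
    calc _ ≤ (lintegralPowLePowLIntegralFDerivConst (volume : Measure (Euc n)) p *
          (∫⁻ x, ‖fderiv ℝ g x‖ₑ) ^ p) ^ (1 / p) := by
          apply ENNReal.rpow_le_rpow _ (by positivity)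
          exact (setLIntegral_le_lintegral _ _).trans h1
      _ = _ := by
          rw [ENNReal.mul_rpow_of_nonneg _ _ (by positivity), ← ENNReal.rpow_mul, mul_one_div_cancel hp0.ne',
            ENNReal.rpow_one]
  calc _ ≤ volume S ^ (1 / (n : ℝ)) * _ := mul_le_mul_right h3 _
    _ = _ := by ring

section fk
variable {n : ℕ} {d C₀ : ℝ} {Γ : Set (Euc n)}

/-- power weight -/
def dE (d : ℝ) (Γ : Set (Euc n)) (s : ℝ) (x : Euc n) : ℝ≥0∞ := ENNReal.ofReal (infDist x Γ ^ (d - s))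

lemma dE_meas (s : ℝ) : Measurable (dE d Γ s) := by
  unfold dE
  have : Measurable fun x : Euc n => infDist x Γ := (continuous_infDist_pt Γ).measurable
  fun_prop

lemma kint_swap (hne : Γ.Nonempty) (hA : AhlforsRegular n d C₀ Γ) (s : ℝ) {H : Euc n → ℝ≥0∞}
    (hH : AEMeasurable H volume) :
    ∫⁻ y in Γ, (∫⁻ x, H x * kerE s (x - y)) ∂μH[d] = ∫⁻ x, H x * (∫⁻ y in Γ, kerE s (x - y) ∂μH[d]) := by
  have := sfinite_sigma hne hA
  have hk := measurable_kerE (n := n) s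
  rw [← lintegral_lintegral_swap (f := fun x y => H x * kerE s (x - y))]
  · refine lintegral_congr fun x => ?_
    have hk2 : Measurable fun y => kerE s (x - y) := hk.comp (measurable_const.sub measurable_id)
    rw [lintegral_const_mul _ hk2]
  · apply AEMeasurable.mul
    · exact hH.comp_quasiMeasurePreserving (Measure.quasiMeasurePreserving_fst)
    · apply Measurable.aemeasurable
      exact hk.comp (measurable_fst.sub measurable_snd)

lemma ae_notMem (hne : Γ.Nonempty) (hcl : IsClosed Γ)
    (hA : AhlforsRegular n d C₀ Γ) (hC₀ : 1 ≤ C₀) (hdn : d < (n : ℝ) - 1) : ∀ᵐ x : Euc n, x ∉ Γ :=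
  measure_eq_zero_iff_ae_notMem.1 (vol_Gamma hne hcl hA hC₀ (by linarith))

lemma kint_lower (hne : Γ.Nonempty) (hcl : IsClosed Γ)
    (hA : AhlforsRegular n d C₀ Γ) (hC₀ : 1 ≤ C₀) (hdn : d < (n : ℝ) - 1) {s : ℝ} (hs : 0 < s) {H : Euc n → ℝ≥0∞}
    (hH : AEMeasurable H volume) :
    ENNReal.ofReal (C₀⁻¹ * 2 ^ (-s)) * ∫⁻ x, H x * dE d Γ s x ≤ ∫⁻ y in Γ, (∫⁻ x, H x * kerE s (x - y)) ∂μH[d] := by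
  rw [kint_swap hne hA s hH, ← lintegral_const_mul' _ _ ENNReal.ofReal_ne_top]
  apply lintegral_mono_ae
  filter_upwards [ae_notMem hne hcl hA hC₀ hdn] with x hx
  have h := ker_lower' hne hcl hA hC₀ hs hx
  rw [ENNReal.ofReal_mul (by positivity)] at h
  calc _ = H x * (ENNReal.ofReal (C₀⁻¹ * 2 ^ (-s)) * dE d Γ s x) := by ring
    _ ≤ _ := mul_le_mul_right h _

lemma kint_upper (hne : Γ.Nonempty) (hcl : IsClosed Γ)
    (hA : AhlforsRegular n d C₀ Γ) (hC₀ : 1 ≤ C₀) (hd : 0 < d) (hdn : d < (n : ℝ) - 1) {s : ℝ} (hs : d < s) {H : Euc n → ℝ≥0∞}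
    (hH : AEMeasurable H volume) :
    ∫⁻ y in Γ, (∫⁻ x, H x * kerE s (x - y)) ∂μH[d] ≤ ENNReal.ofReal (cUp d C₀ s) * ∫⁻ x, H x * dE d Γ s x := by
  rw [kint_swap hne hA s hH, ← lintegral_const_mul' _ _ ENNReal.ofReal_ne_top]
  apply lintegral_mono_ae
  filter_upwards [ae_notMem hne hcl hA hC₀ hdn] with x hx
  have h := ker_upper hne hcl hA hC₀ hd hs hx
  rw [ENNReal.ofReal_mul (cUp_nonneg hC₀ hs)] at h
  calc _ ≤ H x * (ENNReal.ofReal (cUp d C₀ s) * dE d Γ s x) := mul_le_mul_right h _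
    _ = _ := by ring

lemma gy_diff (hn : 2 ≤ n) {g : Euc n → ℝ} (hg : ContDiff ℝ (⊤ : ℕ∞) g) {y : Euc n} (hy : y ∉ tsupport g) :
    ContDiff ℝ 1 (fun x => g x ^ 2 * ‖x - y‖ ^ (-((n : ℝ) - 1))) ∧
    ∀ x, ‖fderiv ℝ (fun x => g x ^ 2 * ‖x - y‖ ^ (-((n : ℝ) - 1))) x‖ₑ ≤
      2 * (‖g x‖ₑ * ‖gradient g x‖ₑ) * kerE ((n : ℝ) - 1) (x - y) + ENNReal.ofReal ((n : ℝ) - 1) * ‖g x‖ₑ ^ 2 * kerE (n : ℝ) (x - y) := by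
  have hn1 : (1 : ℝ) < n := by exact_mod_cast hn
  have hev : ∀ x ∉ tsupport g, (fun x => g x ^ 2 * ‖x - y‖ ^ (-((n : ℝ) - 1))) =ᶠ[𝓝 x] fun _ => 0 := by
    intro x hx
    filter_upwards [(isClosed_tsupport g).isOpen_compl.mem_nhds hx] with z hz
    rw [image_eq_zero_of_notMem_tsupport hz]; simp
  constructor
  · rw [contDiff_iff_contDiffAt]
    intro x
    by_cases hx : x ∈ tsupport g
    · have hxy : x - y ≠ 0 := by rintro h; rw [sub_eq_zero] at h; exact hy (h ▸ hx)
      apply ContDiffAt.mul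
      · exact ((hg.of_le (by exact_mod_cast le_top)).pow 2).contDiffAt
      · apply ContDiffAt.rpow_const_of_ne
        · exact (contDiffAt_id.sub contDiffAt_const).norm ℝ hxy
        · exact norm_ne_zero_iff.2 hxy
    · exact contDiffAt_const.congr_of_eventuallyEq (hev x hx)
  · intro x
    by_cases hx : x ∈ tsupport g
    · have hxy : x - y ≠ 0 := by rintro h; rw [sub_eq_zero] at h; exact hy (h ▸ hx)
      have hp : 0 < ‖x - y‖ := norm_pos_iff.2 hxy
      have d1 : HasFDerivAt g (fderiv ℝ g x) x := (cd_diff hg x).hasFDerivAt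
      have d2 : DifferentiableAt ℝ (fun x => ‖x - y‖) x := by
        exact DifferentiableAt.norm (f := fun x => x - y) ℝ (by fun_prop) hxy
      have d3 : ‖fderiv ℝ (fun x => ‖x - y‖) x‖ ≤ 1 := by
        have : LipschitzWith 1 (fun x : Euc n => ‖x - y‖) := by
          apply LipschitzWith.of_dist_le_mul
          intro a b
          rw [Real.dist_eq, dist_eq_norm]
          have := abs_norm_sub_norm_le (a - y) (b - y)
          simpa using this
        simpa using norm_fderiv_le_of_lipschitz ℝ this (x₀ := x)
      have d4 := (d1.pow 2).mul (d2.hasFDerivAt.rpow_const (p := -((n : ℝ) - 1)) (Or.inl hp.ne'))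
      have d5 : fderiv ℝ (fun x => g x ^ 2 * ‖x - y‖ ^ (-((n : ℝ) - 1))) x = _ := d4.fderiv
      have nb : ‖fderiv ℝ (fun x => g x ^ 2 * ‖x - y‖ ^ (-((n : ℝ) - 1))) x‖ ≤
          2 * (‖g x‖ * ‖gradient g x‖) * ‖x - y‖ ^ (-((n : ℝ) - 1)) + ((n : ℝ) - 1) * ‖g x‖ ^ 2 * ‖x - y‖ ^ (-(n : ℝ)) := by
        rw [d5]
        refine (norm_add_le _ _).trans ?_
        rw [norm_smul, norm_smul, norm_smul, norm_smul, norm_grad]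
        have e1 : ‖-((n : ℝ) - 1) * ‖x - y‖ ^ (-((n : ℝ) - 1) - 1)‖ = ((n : ℝ) - 1) * ‖x - y‖ ^ (-(n : ℝ)) := by
          rw [norm_mul, norm_neg, Real.norm_of_nonneg (by linarith), Real.norm_of_nonneg (by positivity)]
          congr 2; ring
        rw [e1]
        have e2 : 0 ≤ ((n : ℝ) - 1) * ‖x - y‖ ^ (-(n : ℝ)) := mul_nonneg (by linarith) (by positivity)
        have e3 : ‖g x ^ 2‖ = ‖g x‖ ^ 2 := norm_pow _ _
        rw [e3, Real.norm_of_nonneg (by positivity : 0 ≤ ‖x - y‖ ^ (-((n : ℝ) - 1)))]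
        have e4 : ‖g x‖ ^ 2 * (((n : ℝ) - 1) * ‖x - y‖ ^ (-(n : ℝ)) * ‖fderiv ℝ (fun x => ‖x - y‖) x‖) ≤
          ‖g x‖ ^ 2 * (((n : ℝ) - 1) * ‖x - y‖ ^ (-(n : ℝ)) * 1) := by gcongr
        have e5 : ‖(2 : ℕ) • g x ^ (2 - 1)‖ = 2 * ‖g x‖ := by simp
        rw [e5]
        nlinarith [e4]
      rw [← ofReal_norm, ← ofReal_norm, ← ofReal_norm]
      refine (ENNReal.ofReal_le_ofReal nb).trans ?_
      unfold kerE
      have : (0:ℝ) ≤ (n : ℝ) - 1 := by linarith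
      rw [ENNReal.ofReal_add (by positivity) (by positivity), ENNReal.ofReal_mul (by positivity),
        ENNReal.ofReal_mul (by positivity), ENNReal.ofReal_mul (by positivity),
        ENNReal.ofReal_mul (p := ((n : ℝ) - 1) * ‖g x‖ ^ 2) (by positivity), ENNReal.ofReal_mul this,
        ENNReal.ofReal_pow (by positivity)]
      simp
    · have : fderiv ℝ (fun x => g x ^ 2 * ‖x - y‖ ^ (-((n : ℝ) - 1))) x = 0 := by
        rw [(hev x hx).fderiv_eq]; simp
      rw [← ofReal_norm, this, norm_zero, ENNReal.ofReal_zero]; exact zero_le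

lemma cs_w {α : Type*} [MeasurableSpace α] {μ : Measure α} {w f g : α → ℝ≥0∞}
    (hw : AEMeasurable w μ) (hf : AEMeasurable f μ) (hg : AEMeasurable g μ) :
    ∫⁻ a, f a * g a * w a ∂μ ≤ ((∫⁻ a, f a ^ 2 * w a ∂μ) * ∫⁻ a, g a ^ 2 * w a ∂μ) ^ (1 / 2 : ℝ) := by
  have hac : μ.withDensity w ≪ μ := withDensity_absolutelyContinuous _ _
  have h := cs_lintegral (μ := μ.withDensity w) (f := f) (g := g) (hf.mono_ac hac) (hg.mono_ac hac)
  have e0 : ∫⁻ a, f a * g a ∂μ.withDensity w = ∫⁻ a, f a * g a * w a ∂μ := by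
    rw [lintegral_withDensity_eq_lintegral_mul₀ hw (g := fun a => f a * g a) (hf.mul hg)]
    simp [mul_comm]
  rw [e0,
    lintegral_withDensity_eq_lintegral_mul₀ hw (hf.pow_const 2),
    lintegral_withDensity_eq_lintegral_mul₀ hw (hg.pow_const 2)] at h
  rw [one_div, ENNReal.le_rpow_inv_iff (by norm_num), ENNReal.rpow_two]
  refine h.trans (le_of_eq ?_)
  simp [mul_comm]

lemma hardy_smooth (hn : 2 ≤ n) (hne : Γ.Nonempty) (hcl : IsClosed Γ)
    (hA : AhlforsRegular n d C₀ Γ) (hC₀ : 1 ≤ C₀) (hd : 0 < d) (hdn : d < (n : ℝ) - 1)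
    {g : Euc n → ℝ} (hg : ContDiff ℝ (⊤ : ℕ∞) g) (hgs : tsupport g ⊆ Γᶜ) :
    ENNReal.ofReal (C₀⁻¹ * 2 ^ (-((n : ℝ) + 1))) * ∫⁻ x, ‖g x‖ₑ ^ 2 * dE d Γ ((n : ℝ) + 1) x ≤
      4 * ENNReal.ofReal (cUp d C₀ ((n : ℝ) - 1)) * ∫⁻ x, ‖gradient g x‖ₑ ^ 2 * dE d Γ ((n : ℝ) - 1) x := by
  have m1 : AEMeasurable (fun x => ‖g x‖ₑ ^ 2) volume := (hg.continuous.measurable.enorm.pow_const 2).aemeasurable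
  have m2 : AEMeasurable (fun x => ‖gradient g x‖ₑ ^ 2) volume := ((cont_grad hg).measurable.enorm.pow_const 2).aemeasurable
  refine (kint_lower hne hcl hA hC₀ hdn (by positivity) m1).trans ?_
  rw [mul_assoc]
  refine le_trans ?_ (mul_le_mul_right (kint_upper hne hcl hA hC₀ hd hdn hdn m2) 4)
  rw [← lintegral_const_mul' _ _ (by norm_num)]
  refine setLIntegral_mono' hcl.measurableSet fun y hy => ?_
  have := hardy_y hn hg y
  rw [image_eq_zero_of_notMem_tsupport (f := g) (x := y) (fun h => hgs h hy)] at this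
  simpa using this

lemma fk_smooth (n : ℕ) (hn : 2 ≤ n) (d C₀ : ℝ) (hC₀ : 1 ≤ C₀) (hd : 0 < d) (hdn : d < (n : ℝ) - 1) :
    ∃ C : ℝ≥0∞, C ≠ ⊤ ∧ ∀ Γ : Set (Euc n), Γ.Nonempty → IsClosed Γ → AhlforsRegular n d C₀ Γ →
      ∀ g : Euc n → ℝ, ContDiff ℝ (⊤ : ℕ∞) g → HasCompactSupport g → tsupport g ⊆ Γᶜ →
      ∀ S : Set (Euc n), MeasurableSet S → volume S ≠ ⊤ →
      ∫⁻ x in S, ‖g x‖ₑ ^ 2 * dE d Γ ((n : ℝ) - 1) x ≤ C * volume S ^ (1 / (n : ℝ)) *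
        ((∫⁻ x, ‖g x‖ₑ ^ 2 * dE d Γ ((n : ℝ) - 1) x) * ∫⁻ x, ‖gradient g x‖ₑ ^ 2 * dE d Γ ((n : ℝ) - 1) x) ^ (1 / 2 : ℝ) := by
  obtain ⟨K, hK, hgns⟩ := gns n hn
  have hn1 : (1 : ℝ) < n := by exact_mod_cast hn
  set c1 := ENNReal.ofReal (C₀⁻¹ * 2 ^ (-((n : ℝ) - 1))) with hc1
  set c2 := ENNReal.ofReal (C₀⁻¹ * 2 ^ (-((n : ℝ) + 1))) with hc2
  set u1 := ENNReal.ofReal (cUp d C₀ ((n : ℝ) - 1))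
  set u2 := ENNReal.ofReal (cUp d C₀ (n : ℝ))
  have hc10 : c1 ≠ 0 := by rw [hc1, ne_eq, ENNReal.ofReal_eq_zero, not_le]; positivity
  have hc20 : c2 ≠ 0 := by rw [hc2, ne_eq, ENNReal.ofReal_eq_zero, not_le]; positivity
  have hc1t : c1 ≠ ⊤ := ENNReal.ofReal_ne_top
  have hc2t : c2 ≠ ⊤ := ENNReal.ofReal_ne_top
  set M := K * (2 * u1 + ENNReal.ofReal ((n : ℝ) - 1) * u2 * (c2⁻¹ * (4 * u1)) ^ (1 / 2 : ℝ)) with hM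
  refine ⟨c1⁻¹ * M, ?_, ?_⟩
  · apply ENNReal.mul_ne_top (ENNReal.inv_ne_top.2 hc10)
    apply ENNReal.mul_ne_top hK
    apply ENNReal.add_ne_top.2 ⟨by finiteness, ?_⟩
    apply ENNReal.mul_ne_top (by finiteness)
    apply ENNReal.rpow_ne_top_of_nonneg (by norm_num)
    exact ENNReal.mul_ne_top (ENNReal.inv_ne_top.2 hc20) (by finiteness)
  intro Γ hne hcl hA g hg hgc hgs S hS hSt
  have m0 : AEMeasurable (fun x => ‖g x‖ₑ) volume := hg.continuous.measurable.enorm.aemeasurable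
  have m0' : AEMeasurable (fun x => ‖gradient g x‖ₑ) volume := (cont_grad hg).measurable.enorm.aemeasurable
  have m1 : AEMeasurable (fun x => ‖g x‖ₑ ^ 2) volume := m0.pow_const 2
  set I := ∫⁻ x, ‖g x‖ₑ ^ 2 * dE d Γ ((n : ℝ) - 1) x with hI
  set D := ∫⁻ x, ‖gradient g x‖ₑ ^ 2 * dE d Γ ((n : ℝ) - 1) x with hD
  have hP : ∫⁻ x, ‖g x‖ₑ * ‖gradient g x‖ₑ * dE d Γ ((n : ℝ) - 1) x ≤ (I * D) ^ (1 / 2 : ℝ) :=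
    cs_w (dE_meas _).aemeasurable m0 m0'
  have hH : ∫⁻ x, ‖g x‖ₑ ^ 2 * dE d Γ ((n : ℝ) + 1) x ≤ c2⁻¹ * (4 * u1) * D := by
    have := hardy_smooth hn hne hcl hA hC₀ hd hdn hg hgs
    calc _ = c2⁻¹ * (c2 * ∫⁻ x, ‖g x‖ₑ ^ 2 * dE d Γ ((n : ℝ) + 1) x) := by
          rw [← mul_assoc, ENNReal.inv_mul_cancel hc20 hc2t, one_mul]
      _ ≤ c2⁻¹ * (4 * u1 * D) := mul_le_mul_right this _
      _ = _ := by ring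
  have hQ : ∫⁻ x, ‖g x‖ₑ ^ 2 * dE d Γ (n : ℝ) x ≤ (c2⁻¹ * (4 * u1)) ^ (1 / 2 : ℝ) * (I * D) ^ (1 / 2 : ℝ) := by
    have h1 := cs_w (μ := volume) (w := dE d Γ ((n : ℝ) - 1)) (f := fun x => ‖g x‖ₑ)
      (g := fun x => ‖g x‖ₑ * ENNReal.ofReal ((infDist x Γ)⁻¹)) (dE_meas _).aemeasurable m0 (by
        have : Measurable fun x : Euc n => infDist x Γ := (continuous_infDist_pt Γ).measurable
        exact m0.mul (by fun_prop))
    have e1 : ∀ᵐ x : Euc n, ‖g x‖ₑ * (‖g x‖ₑ * ENNReal.ofReal ((infDist x Γ)⁻¹)) * dE d Γ ((n : ℝ) - 1) x =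
        ‖g x‖ₑ ^ 2 * dE d Γ (n : ℝ) x := by
      filter_upwards [ae_notMem hne hcl hA hC₀ hdn] with x hx
      have hx := infDist_pos' hne hcl hx
      have : ENNReal.ofReal ((infDist x Γ)⁻¹) * dE d Γ ((n : ℝ) - 1) x = dE d Γ (n : ℝ) x := by
        unfold dE
        rw [← ENNReal.ofReal_mul (by positivity), ← Real.rpow_neg_one, ← Real.rpow_add hx]
        congr 2; ring
      rw [← this]; ring
    have e2 : ∀ᵐ x : Euc n, (‖g x‖ₑ * ENNReal.ofReal ((infDist x Γ)⁻¹)) ^ 2 * dE d Γ ((n : ℝ) - 1) x =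
        ‖g x‖ₑ ^ 2 * dE d Γ ((n : ℝ) + 1) x := by
      filter_upwards [ae_notMem hne hcl hA hC₀ hdn] with x hx
      have hx := infDist_pos' hne hcl hx
      have : ENNReal.ofReal ((infDist x Γ)⁻¹) ^ 2 * dE d Γ ((n : ℝ) - 1) x = dE d Γ ((n : ℝ) + 1) x := by
        unfold dE
        rw [← ENNReal.ofReal_pow (by positivity), ← ENNReal.ofReal_mul (by positivity), ← Real.rpow_neg_one,
          ← Real.rpow_natCast, ← Real.rpow_mul hx.le, ← Real.rpow_add hx]
        congr 2; push_cast; ring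
      rw [← this]; ring
    rw [lintegral_congr_ae e1, lintegral_congr_ae e2] at h1
    refine h1.trans ?_
    rw [← ENNReal.mul_rpow_of_nonneg _ _ (by norm_num)]
    apply ENNReal.rpow_le_rpow _ (by norm_num)
    calc _ ≤ I * (c2⁻¹ * (4 * u1) * D) := mul_le_mul_right hH _
      _ = _ := by ring
  have key : c1 * ∫⁻ x in S, ‖g x‖ₑ ^ 2 * dE d Γ ((n : ℝ) - 1) x ≤ M * volume S ^ (1 / (n : ℝ)) * (I * D) ^ (1 / 2 : ℝ) := by
    have mS : AEMeasurable (S.indicator fun x => ‖g x‖ₑ ^ 2) volume := m1.indicator hS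
    have l1 := kint_lower hne hcl hA hC₀ hdn (s := (n : ℝ) - 1) (by linarith) mS
    have ind : ∀ k : Euc n → ℝ≥0∞, ∫⁻ x, S.indicator (fun x => ‖g x‖ₑ ^ 2) x * k x = ∫⁻ x in S, ‖g x‖ₑ ^ 2 * k x := by
      intro k
      rw [← lintegral_indicator hS]
      refine lintegral_congr fun x => ?_
      by_cases hx : x ∈ S <;> simp [hx]
    rw [ind] at l1
    simp_rw [fun y => ind (fun x => kerE ((n : ℝ) - 1) (x - y))] at l1
    refine l1.trans ?_
    have l2 : ∀ y ∈ Γ, ∫⁻ x in S, ‖g x‖ₑ ^ 2 * kerE ((n : ℝ) - 1) (x - y) ≤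
        K * volume S ^ (1 / (n : ℝ)) * ((∫⁻ x, (2 * (‖g x‖ₑ * ‖gradient g x‖ₑ)) * kerE ((n : ℝ) - 1) (x - y)) +
          ∫⁻ x, (ENNReal.ofReal ((n : ℝ) - 1) * ‖g x‖ₑ ^ 2) * kerE (n : ℝ) (x - y)) := by
      intro y hy
      have hyt : y ∉ tsupport g := fun h => hgs h hy
      obtain ⟨g1, g2⟩ := gy_diff hn hg hyt
      have g3 := hgns _ g1 (by
        apply HasCompactSupport.mul_right
        exact hgc.comp_left (g := fun t => t ^ 2) (by simp)) S hS
      have e : ∀ x, ‖g x ^ 2 * ‖x - y‖ ^ (-((n : ℝ) - 1))‖ₑ = ‖g x‖ₑ ^ 2 * kerE ((n : ℝ) - 1) (x - y) := by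
        intro x
        rw [enorm_mul, enorm_pow, kerE, Real.enorm_of_nonneg (r := ‖x - y‖ ^ (-((n : ℝ) - 1))) (by positivity)]
      simp_rw [e] at g3
      refine g3.trans (mul_le_mul_right ?_ _)
      have hk := measurable_kerE (n := n) ((n : ℝ) - 1)
      rw [← lintegral_add_left']
      · exact lintegral_mono g2
      · apply AEMeasurable.mul ((m0.mul m0').const_mul 2)
        exact (hk.comp (measurable_id.sub measurable_const)).aemeasurable
    refine (setLIntegral_mono' hcl.measurableSet l2).trans ?_
    have m2 : AEMeasurable (fun x => 2 * (‖g x‖ₑ * ‖gradient g x‖ₑ)) volume := (m0.mul m0').const_mul 2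
    have m3 : AEMeasurable (fun x => ENNReal.ofReal ((n : ℝ) - 1) * ‖g x‖ₑ ^ 2) volume := m1.const_mul _
    have a1 := kint_upper hne hcl hA hC₀ hd hdn hdn m2
    have a2 := kint_upper hne hcl hA hC₀ hd hdn (s := (n : ℝ)) (by linarith) m3
    have := sfinite_sigma hne hA
    have hk := measurable_kerE (n := n) ((n : ℝ) - 1)
    have mm : Measurable fun y => ∫⁻ x, (2 * (‖g x‖ₑ * ‖gradient g x‖ₑ)) * kerE ((n : ℝ) - 1) (x - y) := by
      apply Measurable.lintegral_prod_left'
        (f := fun p : Euc n × Euc n => (2 * (‖g p.1‖ₑ * ‖gradient g p.1‖ₑ)) * kerE ((n : ℝ) - 1) (p.1 - p.2))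
      have q1 := (hg.continuous.measurable.comp (measurable_fst (α := Euc n) (β := Euc n))).enorm
      have q2 := ((cont_grad hg).measurable.comp (measurable_fst (α := Euc n) (β := Euc n))).enorm
      have q3 := hk.comp ((measurable_fst (α := Euc n) (β := Euc n)).sub measurable_snd)
      exact ((q1.mul q2).const_mul 2).mul q3
    rw [lintegral_const_mul' _ _ (ENNReal.mul_ne_top hK (ENNReal.rpow_ne_top_of_nonneg (by positivity) hSt)),
      lintegral_add_left mm]
    have b1 : ∫⁻ x, (2 * (‖g x‖ₑ * ‖gradient g x‖ₑ)) * dE d Γ ((n : ℝ) - 1) x ≤ 2 * (I * D) ^ (1 / 2 : ℝ) := by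
      simp_rw [mul_assoc (2 : ℝ≥0∞)]
      rw [lintegral_const_mul' _ _ (by norm_num)]
      exact mul_le_mul_right hP _
    have b2 : ∫⁻ x, (ENNReal.ofReal ((n : ℝ) - 1) * ‖g x‖ₑ ^ 2) * dE d Γ (n : ℝ) x ≤
        ENNReal.ofReal ((n : ℝ) - 1) * ((c2⁻¹ * (4 * u1)) ^ (1 / 2 : ℝ) * (I * D) ^ (1 / 2 : ℝ)) := by
      simp_rw [mul_assoc (ENNReal.ofReal ((n : ℝ) - 1))]
      rw [lintegral_const_mul' _ _ (by finiteness)]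
      exact mul_le_mul_right hQ _
    calc _ ≤ K * volume S ^ (1 / (n : ℝ)) * (u1 * (2 * (I * D) ^ (1 / 2 : ℝ)) + u2 * (ENNReal.ofReal ((n : ℝ) - 1) *
          ((c2⁻¹ * (4 * u1)) ^ (1 / 2 : ℝ) * (I * D) ^ (1 / 2 : ℝ)))) := by
          gcongr
          · exact a1.trans (mul_le_mul_right b1 _)
          · exact a2.trans (mul_le_mul_right b2 _)
      _ = _ := by rw [hM]; ring
  calc _ = c1⁻¹ * (c1 * ∫⁻ x in S, ‖g x‖ₑ ^ 2 * dE d Γ ((n : ℝ) - 1) x) := by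
        rw [← mul_assoc, ENNReal.inv_mul_cancel hc10 hc1t, one_mul]
    _ ≤ c1⁻¹ * (M * volume S ^ (1 / (n : ℝ)) * (I * D) ^ (1 / 2 : ℝ)) := mul_le_mul_right key _
    _ = _ := by ring
end fk

section fk2
variable {n : ℕ} {d C₀ : ℝ} {Γ : Set (Euc n)}

lemma weight_dE (x : Euc n) : ENNReal.ofReal (weightW n d Γ x) = dE d Γ ((n : ℝ) - 1) x := by
  unfold weightW dE
  congr 2; ring

lemma lint_m (f : Euc n → ℝ≥0∞) : ∫⁻ x, f x ∂(measW n d Γ) = ∫⁻ x, f x * dE d Γ ((n : ℝ) - 1) x := by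
  unfold measW
  rw [lintegral_withDensity_eq_lintegral_mul_non_measurable _ measurable_weightE (by simp)]
  refine lintegral_congr fun x => ?_
  rw [Pi.mul_apply, weight_dE, mul_comm]

lemma lint_m_set (f : Euc n → ℝ≥0∞) {S : Set (Euc n)} (hS : MeasurableSet S) :
    ∫⁻ x in S, f x ∂(measW n d Γ) = ∫⁻ x in S, f x * dE d Γ ((n : ℝ) - 1) x := by
  rw [← lintegral_indicator hS, lint_m, ← lintegral_indicator hS]
  refine lintegral_congr fun x => ?_
  by_cases hx : x ∈ S <;> simp [hx]

lemma m_ac : measW n d Γ ≪ volume := withDensity_absolutelyContinuous _ _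

lemma L2_tri {α : Type*} [MeasurableSpace α] {μ : Measure α} {a b c : α → ℝ≥0∞} (hb : AEMeasurable b μ)
    (hc : AEMeasurable c μ) (h : ∀ᵐ x ∂μ, a x ≤ b x + c x) :
    (∫⁻ x, a x ^ 2 ∂μ) ^ (1 / 2 : ℝ) ≤ (∫⁻ x, b x ^ 2 ∂μ) ^ (1 / 2 : ℝ) + (∫⁻ x, c x ^ 2 ∂μ) ^ (1 / 2 : ℝ) := by
  have h2 := ENNReal.lintegral_Lp_add_le (p := 2) hb hc (by norm_num)
  simp only [Pi.add_apply, ENNReal.rpow_two] at h2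
  refine le_trans ?_ h2
  apply ENNReal.rpow_le_rpow _ (by norm_num)
  apply lintegral_mono_ae
  filter_upwards [h] with x hx
  gcongr

lemma dE_bdd (hne : Γ.Nonempty) (hcl : IsClosed Γ) {K : Set (Euc n)} (hK : IsCompact K) (hKΓ : K ⊆ Γᶜ) (s : ℝ) :
    ∃ M : ℝ≥0∞, M ≠ ⊤ ∧ ∀ x ∈ K, dE d Γ s x ≤ M := by
  have hc : ContinuousOn (fun x => infDist x Γ ^ (d - s)) K := by
    apply ContinuousOn.rpow_const (continuous_infDist_pt Γ).continuousOn
    intro x hx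
    exact Or.inl (infDist_pos' hne hcl (hKΓ hx)).ne'
  obtain ⟨C, hC⟩ := hK.exists_bound_of_continuousOn hc
  exact ⟨ENNReal.ofReal C, ENNReal.ofReal_ne_top, fun x hx =>
    ENNReal.ofReal_le_ofReal ((le_abs_self _).trans (hC x hx))⟩

lemma lint_le_of_supp {K : Set (Euc n)} {M : ℝ≥0∞} (hM : ∀ x ∈ K, dE d Γ ((n : ℝ) - 1) x ≤ M) {f : Euc n → ℝ≥0∞}
    (hMt : M ≠ ⊤) (hf : ∀ x ∉ K, f x = 0) : ∫⁻ x, f x ∂(measW n d Γ) ≤ M * ∫⁻ x, f x := by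
  rw [lint_m, ← lintegral_const_mul' _ _ hMt]
  refine lintegral_mono fun x => ?_
  by_cases hx : x ∈ K
  · simp only; rw [mul_comm]; exact mul_le_mul_left (hM x hx) _
  · simp [hf x hx]

/-- moll supported near K -/
lemma moll_supp {E : Type*} [NormedAddCommGroup E] [NormedSpace ℝ E] {K : Set (Euc n)} {f : Euc n → E}
    (hf : ∀ x ∉ K, f x = 0) {η : ℝ} {j : ℕ} (hj : eps j ≤ η) : ∀ x ∉ cthickening η K, moll j f x = 0 := by
  intro x hx
  apply moll_zero_of
  intro y hy
  apply hf
  intro hyK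
  apply hx
  rw [mem_ball, dist_comm] at hy
  exact mem_cthickening_of_dist_le x y η K hyK (by linarith)

/-- convergence in L²(m) of mollifications -/
lemma moll_L2m {E : Type*} [NormedAddCommGroup E] [NormedSpace ℝ E] [CompleteSpace E] (hne : Γ.Nonempty) (hcl : IsClosed Γ)
    {K : Set (Euc n)} (hK : IsCompact K) (hKΓ : K ⊆ Γᶜ)
    {f : Euc n → E} (hf : ∀ x ∉ K, f x = 0) (hfi : LocallyIntegrable f) (h2 : ∫⁻ x, ‖f x‖ₑ ^ 2 ≠ ⊤) :
    Tendsto (fun j => ∫⁻ x, ‖moll j f x - f x‖ₑ ^ 2 ∂(measW n d Γ)) atTop (𝓝 0) := by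
  obtain ⟨η, hη, hηΓ⟩ := hK.exists_cthickening_subset_open hcl.isOpen_compl hKΓ
  obtain ⟨M, hM, hMb⟩ := dE_bdd (d := d) hne hcl (hK.cthickening (r := η)) hηΓ ((n : ℝ) - 1)
  have := ENNReal.Tendsto.const_mul (moll_L2 hfi h2) (Or.inr hM)
  rw [mul_zero] at this
  refine tendsto_of_tendsto_of_tendsto_of_le_of_le' tendsto_const_nhds this (Eventually.of_forall fun _ => zero_le) ?_
  filter_upwards [eps_tendsto.eventually_lt_const hη] with j hj
  apply lint_le_of_supp hMb hM
  intro x hx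
  rw [moll_supp hf hj.le x hx, hf x (fun h => hx (self_subset_cthickening _ h))]
  simp

lemma fk (n : ℕ) (hn : 2 ≤ n) (d C₀ : ℝ) (hC₀ : 1 ≤ C₀) (hd : 0 < d) (hdn : d < (n : ℝ) - 1) :
    ∃ C : ℝ≥0∞, C ≠ ⊤ ∧ ∀ Γ : Set (Euc n), Γ.Nonempty → IsClosed Γ → AhlforsRegular n d C₀ Γ →
      ∀ (h : Euc n → ℝ) (H : Euc n → Euc n), WG univ h H → ∀ K : Set (Euc n), IsCompact K → K ⊆ Γᶜ →
      (∀ x ∉ K, h x = 0) → (∀ x ∉ K, H x = 0) → ∫⁻ x, ‖h x‖ₑ ^ 2 ≠ ⊤ → ∫⁻ x, ‖H x‖ₑ ^ 2 ≠ ⊤ →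
      ∀ S : Set (Euc n), MeasurableSet S → volume S ≠ ⊤ → (∀ᵐ x, x ∉ S → h x = 0) →
      ∫⁻ x, ‖h x‖ₑ ^ 2 ∂(measW n d Γ) ≤ C * (volume S ^ (1 / (n : ℝ))) ^ 2 * ∫⁻ x, ‖H x‖ₑ ^ 2 ∂(measW n d Γ) := by
  obtain ⟨C, hC, hfk⟩ := fk_smooth n hn d C₀ hC₀ hd hdn
  refine ⟨C ^ 2, by finiteness, ?_⟩
  intro Γ hne hcl hA h H hw K hK hKΓ hh hH h2 H2 S hS hSt hhS
  set m := measW n d Γ with hm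
  set I := ∫⁻ x, ‖h x‖ₑ ^ 2 ∂m with hI
  set D := ∫⁻ x, ‖H x‖ₑ ^ 2 ∂m with hD
  set s := volume S ^ (1 / (n : ℝ)) with hs
  have hst : s ≠ ⊤ := ENNReal.rpow_ne_top_of_nonneg (by positivity) hSt
  obtain ⟨η, hη, hηΓ⟩ := hK.exists_cthickening_subset_open hcl.isOpen_compl hKΓ
  obtain ⟨M, hM, hMb⟩ := dE_bdd (d := d) hne hcl hK hKΓ ((n : ℝ) - 1)
  have hIt : I ≠ ⊤ := ne_top_of_le_ne_top (ENNReal.mul_ne_top hM h2)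
    (lint_le_of_supp hMb hM (fun x hx => by rw [hh x hx]; simp))
  have hDt : D ≠ ⊤ := ne_top_of_le_ne_top (ENNReal.mul_ne_top hM H2)
    (lint_le_of_supp hMb hM (fun x hx => by rw [hH x hx]; simp))
  have hli := hw.hf.locallyIntegrable
  have hLi := hw.hF.locallyIntegrable
  have t1 := moll_L2m (d := d) hne hcl hK hKΓ hh hli h2
  have t2 := moll_L2m (d := d) hne hcl hK hKΓ hH hLi H2
  have cm := fun j => (moll_contDiff j hli).continuous
  have cM := fun j => (moll_contDiff j hLi).continuous
  have root : ∀ {a : ℕ → ℝ≥0∞}, Tendsto a atTop (𝓝 0) → Tendsto (fun j => a j ^ (1 / 2 : ℝ)) atTop (𝓝 0) := by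
    intro a ha
    have := ha.ennrpow_const (1 / 2)
    rwa [ENNReal.zero_rpow_of_pos (by norm_num)] at this
  set X : ℕ → ℝ≥0∞ := fun j => I ^ (1 / 2 : ℝ) + (∫⁻ x, ‖moll j h x - h x‖ₑ ^ 2 ∂m) ^ (1 / 2 : ℝ) with hX
  set Y : ℕ → ℝ≥0∞ := fun j => D ^ (1 / 2 : ℝ) + (∫⁻ x, ‖moll j H x - H x‖ₑ ^ 2 ∂m) ^ (1 / 2 : ℝ) with hY
  have tX : Tendsto X atTop (𝓝 (I ^ (1 / 2 : ℝ))) := by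
    have := (tendsto_const_nhds (x := I ^ (1 / 2 : ℝ))).add (root t1)
    rw [add_zero] at this; exact this
  have tY : Tendsto Y atTop (𝓝 (D ^ (1 / 2 : ℝ))) := by
    have := (tendsto_const_nhds (x := D ^ (1 / 2 : ℝ))).add (root t2)
    rw [add_zero] at this; exact this
  have hI2 : I ^ (1 / 2 : ℝ) ≠ ⊤ := ENNReal.rpow_ne_top_of_nonneg (by norm_num) hIt
  have hD2 : D ^ (1 / 2 : ℝ) ≠ ⊤ := ENNReal.rpow_ne_top_of_nonneg (by norm_num) hDt
  have step : ∀ᶠ j in atTop, ∫⁻ x in S, ‖moll j h x‖ₑ ^ 2 ∂m ≤ C * s * (X j * Y j) := by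
    filter_upwards [eps_tendsto.eventually_lt_const hη] with j hj
    have hsub : tsupport (moll j h) ⊆ cthickening η K := by
      apply closure_minimal _ isClosed_cthickening
      intro x hx
      by_contra hc
      exact hx (moll_supp hh hj.le x hc)
    have := hfk Γ hne hcl hA (moll j h) (moll_contDiff j hli)
      (hK.cthickening.of_isClosed_subset (isClosed_tsupport _) hsub) (hsub.trans hηΓ) S hS hSt
    rw [← lint_m, ← lint_m, ← lint_m_set _ hS, ENNReal.mul_rpow_of_nonneg _ _ (by norm_num)] at this
    refine this.trans ?_
    apply mul_le_mul_right
    apply mul_le_mul'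
    · apply L2_tri (hw.hf.1.enorm.mono_ac m_ac) (((cm j).aestronglyMeasurable.sub hw.hf.1).enorm.mono_ac m_ac)
      filter_upwards with x
      calc ‖moll j h x‖ₑ = ‖h x + (moll j h x - h x)‖ₑ := by congr 1; ring
        _ ≤ _ := enorm_add_le _ _
    · apply L2_tri (hw.hF.1.enorm.mono_ac m_ac) (((cM j).aestronglyMeasurable.sub hw.hF.1).enorm.mono_ac m_ac)
      filter_upwards with x
      rw [hw.moll_gradient]
      calc ‖moll j H x‖ₑ = ‖H x + (moll j H x - H x)‖ₑ := by congr 1; simp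
        _ ≤ _ := enorm_add_le _ _
  have tXY : Tendsto (fun j => C * s * (X j * Y j)) atTop (𝓝 (C * s * (I ^ (1 / 2 : ℝ) * D ^ (1 / 2 : ℝ)))) := by
    apply ENNReal.Tendsto.const_mul _ (Or.inr (ENNReal.mul_ne_top hC hst))
    exact ENNReal.Tendsto.mul tX (Or.inr hD2) tY (Or.inr hI2)
  have fat : I ≤ C * s * (I ^ (1 / 2 : ℝ) * D ^ (1 / 2 : ℝ)) := by
    have e1 : I = ∫⁻ x in S, ‖h x‖ₑ ^ 2 ∂m := by
      rw [hI, ← lintegral_indicator hS]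
      apply lintegral_congr_ae
      filter_upwards [m_ac.ae_le hhS] with x hx
      by_cases hxS : x ∈ S
      · simp [hxS]
      · simp [hxS, hx hxS]
    rw [e1]
    have e2 : ∫⁻ x in S, ‖h x‖ₑ ^ 2 ∂m ≤ ∫⁻ x in S, liminf (fun j => ‖moll j h x‖ₑ ^ 2) atTop ∂m := by
      apply lintegral_mono_ae
      apply ae_restrict_of_ae
      filter_upwards [m_ac.ae_le (moll_ae hli)] with x hx
      have : Tendsto (fun j => ‖moll j h x‖ₑ ^ 2) atTop (𝓝 (‖h x‖ₑ ^ 2)) :=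
        ((ENNReal.continuous_pow 2).tendsto _).comp (hx.enorm)
      rw [this.liminf_eq]
    rw [← e1]
    rw [← e1] at e2
    refine e2.trans ((lintegral_liminf_le (fun j => ((cm j).measurable.enorm.pow_const 2))).trans ?_)
    rw [← tXY.liminf_eq]
    exact liminf_le_liminf step
  have hsq : ∀ a : ℝ≥0∞, (a ^ (1 / 2 : ℝ)) ^ 2 = a := by
    intro a
    rw [← ENNReal.rpow_natCast, ← ENNReal.rpow_mul]; norm_num
  have hI' : I = I ^ (1 / 2 : ℝ) * I ^ (1 / 2 : ℝ) := by rw [← sq, hsq]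
  have fin : I ^ (1 / 2 : ℝ) ≤ C * s * D ^ (1 / 2 : ℝ) := by
    by_cases h0 : I ^ (1 / 2 : ℝ) = 0
    · rw [h0]; exact zero_le
    rw [← ENNReal.mul_le_mul_iff_right h0 hI2]
    calc _ = I := hI'.symm
      _ ≤ _ := fat
      _ = _ := by ring
  calc I = (I ^ (1 / 2 : ℝ)) ^ 2 := (hsq I).symm
    _ ≤ (C * s * D ^ (1 / 2 : ℝ)) ^ 2 := by gcongr
    _ = C ^ 2 * s ^ 2 * (D ^ (1 / 2 : ℝ)) ^ 2 := by ring
    _ = _ := by rw [hsq]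
end fk2

section
variable {n : ℕ} {d C₀ : ℝ} {Γ : Set (Euc n)}

lemma infDist_lip (Γ : Set (Euc n)) (x y : Euc n) : |infDist x Γ - infDist y Γ| ≤ ‖x - y‖ := by
  have := (lipschitz_infDist_pt Γ).dist_le_mul x y
  rw [Real.dist_eq, dist_eq_norm] at this
  simpa using this

lemma clamp_lip (a b : ℝ) : |max 0 (min a 1) - max 0 (min b 1)| ≤ |a - b| := by
  have h1 := abs_max_sub_max_le_abs (min a 1) (min b 1) 0
  rw [max_comm 0, max_comm 0]
  refine h1.trans ?_
  have := abs_min_sub_min_le_max a 1 b 1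
  simpa using this

/-- generic smooth Lipschitz cutoff, obtained by mollifying a clamped Lipschitz function. -/
lemma exists_lip_cutoff (g : Euc n → ℝ) {L ε : ℝ} (hL : 0 < L) (hε : 0 < ε)
    (hg : ∀ x y, |g x - g y| ≤ L * ‖x - y‖) :
    ∃ ψ : Euc n → ℝ, ContDiff ℝ (⊤ : ℕ∞) ψ ∧ (∀ x, ψ x ∈ Icc (0 : ℝ) 1) ∧ (∀ x, ‖gradient ψ x‖ ≤ L) ∧
      (∀ x, g x ≤ -ε → ψ x = 0) ∧ (∀ x, 1 + ε ≤ g x → ψ x = 1) := by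
  set c : Euc n → ℝ := fun x => max 0 (min (g x) 1) with hc
  have hcl : ∀ x y, |c x - c y| ≤ L * ‖x - y‖ := fun x y => (clamp_lip _ _).trans (hg x y)
  have hcc : Continuous c := by
    have : LipschitzWith (Real.toNNReal L) c := LipschitzWith.of_dist_le_mul fun x y => by
      rw [Real.dist_eq, dist_eq_norm, Real.coe_toNNReal _ hL.le]; exact hcl x y
    exact this.continuous
  have hI : ∀ y, c y ∈ Icc (0 : ℝ) 1 := fun y => ⟨le_max_left _ _, max_le zero_le_one (min_le_right _ _)⟩
  obtain ⟨j, hj⟩ := (eps_tendsto.eventually_lt_const (show 0 < ε / L by positivity)).exists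
  have hjL : L * eps j < ε := by rw [lt_div_iff₀ hL] at hj; linarith
  refine ⟨moll j c, moll_contDiff j hcc.locallyIntegrable, moll_mem_Icc j hcc.locallyIntegrable hI,
    moll_lip j hcc hL.le hcl, fun x hx => moll_zero_of fun y hy => ?_, fun x hx => moll_const_of fun y hy => ?_⟩
  all_goals
    rw [mem_ball, dist_eq_norm] at hy
    have h1 := hg y x
    have h2 : L * ‖y - x‖ ≤ L * eps j := by gcongr
    rw [abs_le] at h1
  · exact max_eq_left ((min_le_left _ _).trans (by linarith))
  · rw [hc]; simp only; rw [min_eq_right (by linarith)]; simp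

lemma grad_zero_of_eventually {ψ : Euc n → ℝ} {x : Euc n} {c : ℝ} (h : ∀ᶠ y in 𝓝 x, ψ y = c) : gradient ψ x = 0 := by
  have : ψ =ᶠ[𝓝 x] fun _ => c := h
  rw [gradient, this.fderiv_eq]; simp

lemma exists_psi (Γ : Set (Euc n)) {τ : ℝ} (hτ : 0 < τ) :
    ∃ ψ : Euc n → ℝ, ContDiff ℝ (⊤ : ℕ∞) ψ ∧ (∀ x, ψ x ∈ Icc (0 : ℝ) 1) ∧ (∀ x, ‖gradient ψ x‖ ≤ τ⁻¹) ∧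
      (∀ x, infDist x Γ ≤ τ → ψ x = 0) ∧ (∀ x, 4 * τ ≤ infDist x Γ → ψ x = 1) ∧
      (∀ x, infDist x Γ < τ → gradient ψ x = 0) ∧ (∀ x, 4 * τ < infDist x Γ → gradient ψ x = 0) := by
  obtain ⟨ψ, h1, h2, h3, h4, h5⟩ := exists_lip_cutoff (fun x => τ⁻¹ * (infDist x Γ - 2 * τ)) (inv_pos.2 hτ) one_pos
    (fun x y => by
      rw [← mul_sub, abs_mul, abs_of_pos (inv_pos.2 hτ)]
      gcongr
      have := infDist_lip Γ x y
      rwa [sub_sub_sub_cancel_right])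
  have c0 : ∀ x, infDist x Γ ≤ τ → ψ x = 0 := fun x hx => h4 x (by
    rw [inv_mul_le_iff₀ hτ]; linarith)
  have c1 : ∀ x, 4 * τ ≤ infDist x Γ → ψ x = 1 := fun x hx => h5 x (by
    rw [le_inv_mul_iff₀ hτ]; linarith)
  refine ⟨ψ, h1, h2, h3, c0, c1, fun x hx => grad_zero_of_eventually (c := 0) ?_,
    fun x hx => grad_zero_of_eventually (c := 1) ?_⟩
  · filter_upwards [(continuous_infDist_pt Γ).continuousAt.eventually_lt_const hx] with y hy using c0 y hy.le
  · filter_upwards [(continuous_infDist_pt Γ).continuousAt.eventually_const_lt hx] with y hy using c1 y hy.le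

lemma tsupport_psi {ψ : Euc n → ℝ} {τ : ℝ} (hτ : 0 < τ) (h : ∀ x, infDist x Γ ≤ τ → ψ x = 0) : tsupport ψ ⊆ Γᶜ := by
  have : tsupport ψ ⊆ {x | τ ≤ infDist x Γ} := by
    apply closure_minimal _ (isClosed_le continuous_const (continuous_infDist_pt Γ))
    intro x hx
    by_contra hc
    simp only [mem_ofPred_eq, not_le] at hc
    exact hx (h x hc.le)
  intro x hx hxΓ
  have := this hx
  simp only [mem_ofPred_eq, infDist_zero_of_mem hxΓ] at this
  linarith

lemma WG.remove_bdd (hne : Γ.Nonempty) (hcl : IsClosed Γ)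
    (hA : AhlforsRegular n d C₀ Γ) (hC₀ : 1 ≤ C₀) (hdn : d < (n : ℝ) - 1)
    {f : Euc n → ℝ} {F : Euc n → Euc n} (h : WG Γᶜ f F) {N : ℝ} (hN : 0 ≤ N) (hfN : ∀ᵐ x, |f x| ≤ N) : WG univ f F := by
  refine ⟨h.hf, h.hF, fun ψ hψ hψc _ => ?_⟩
  have hτ : ∀ j, 0 < eps j := eps_pos
  choose ζ ζ1 ζ2 ζ3 ζ4 ζ5 ζ6 ζ7 using fun j => exists_psi Γ (hτ j)
  obtain ⟨M, hM0, hM⟩ := cs_bdd hψ.continuous hψc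
  obtain ⟨M', hM0', hM'⟩ := cs_bdd (cont_grad hψ) (cs_grad hψc)
  have hζb : ∀ j x, ‖ζ j x‖ ≤ 1 := fun j x => by
    rw [Real.norm_eq_abs, abs_of_nonneg (ζ2 j x).1]; exact (ζ2 j x).2
  have i1 := int_smul_bdd (G := ℝ) h.hf (cont_grad hψ).aestronglyMeasurable M' hM'
  have i2 := int_bdd_smul h.hF hψ.continuous.aestronglyMeasurable M hM
  have hζlim : ∀ᵐ x, Tendsto (fun j => ζ j x) atTop (𝓝 1) := by
    filter_upwards [ae_notMem hne hcl hA hC₀ hdn] with x hx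
    apply tendsto_const_nhds.congr'
    have hp := infDist_pos' hne hcl hx
    filter_upwards [eps_tendsto.eventually_lt_const (show 0 < infDist x Γ / 4 by positivity)] with j hj
    exact (ζ5 j x (by linarith)).symm
  have L : ∀ g : Euc n → Euc n, Integrable g → Tendsto (fun j => ∫ x, ζ j x • g x) atTop (𝓝 (∫ x, g x)) := by
    intro g hg
    apply tendsto_integral_of_dominated_convergence (fun x => ‖g x‖)
      (fun j => (ζ1 j).continuous.aestronglyMeasurable.smul hg.1) hg.norm
    · intro j; filter_upwards with x
      simp only [Pi.smul_apply']
      rw [norm_smul]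
      calc _ ≤ 1 * ‖g x‖ := by gcongr; exact hζb j x
        _ = _ := one_mul _
    · filter_upwards [hζlim] with x hx
      simpa using hx.smul_const (g x)
  have E : Tendsto (fun j => ∫ x, f x • (ψ x • gradient (ζ j) x)) atTop (𝓝 0) := by
    obtain ⟨x0, hx0⟩ := hne
    obtain ⟨R, hR0, hR⟩ : ∃ R > 0, tsupport ψ ⊆ ball x0 R := by
      obtain ⟨R, hR⟩ := hψc.isBounded.subset_ball x0
      exact ⟨max R 1, by positivity, hR.trans (ball_subset_ball (le_max_left _ _))⟩
    obtain ⟨C, hC, hv⟩ := nbhd_volume ⟨x0, hx0⟩ hcl hA hC₀ hx0 hR0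
    rw [tendsto_zero_iff_norm_tendsto_zero]
    have key : ∀ᶠ j in atTop, ‖∫ x, f x • (ψ x • gradient (ζ j) x)‖ ≤ N * M * C.toReal * 5 ^ ((n : ℝ) - d) * (eps j) ^ ((n : ℝ) - d - 1) := by
      filter_upwards [eps_tendsto.eventually_lt_const (show 0 < R / 5 by positivity)] with j hj
      set S := {z | infDist z Γ < 5 * eps j} ∩ ball x0 R with hS
      have hSm : MeasurableSet S := ((isOpen_lt (continuous_infDist_pt Γ) continuous_const).inter isOpen_ball).measurableSet
      have hvj := hv (5 * eps j) (by linarith [hτ j]) (by linarith)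
      have hSt : volume S ≠ ⊤ := ne_top_of_le_ne_top (by finiteness) hvj
      have hb : ∀ᵐ x, ‖f x • (ψ x • gradient (ζ j) x)‖ ≤ S.indicator (fun _ => N * (M * (eps j)⁻¹)) x := by
        filter_upwards [hfN] with x hx
        by_cases hxS : x ∈ S
        · rw [indicator_of_mem hxS, norm_smul, norm_smul, Real.norm_eq_abs]
          gcongr
          · exact hM x
          · exact ζ3 j x
        · rw [indicator_of_notMem hxS]
          by_cases hb : x ∈ ball x0 R
          · have : ¬ infDist x Γ < 5 * eps j := fun h => hxS ⟨h, hb⟩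
            rw [ζ7 j x (by linarith [hτ j])]; simp
          · rw [image_eq_zero_of_notMem_tsupport (fun h => hb (hR h))]; simp
      have hint : Integrable (S.indicator (fun _ : Euc n => N * (M * (eps j)⁻¹))) :=
        (integrable_indicator_iff hSm).2 (integrableOn_const hSt)
      refine (norm_integral_le_of_norm_le hint hb).trans ?_
      rw [integral_indicator_const _ hSm, smul_eq_mul, measureReal_def]
      have : (volume S).toReal ≤ C.toReal * (5 * eps j) ^ ((n : ℝ) - d) := by
        have := ENNReal.toReal_mono (by finiteness) hvj
        rwa [ENNReal.toReal_mul, ENNReal.toReal_ofReal (Real.rpow_nonneg (by linarith [hτ j]) _)] at this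
      calc _ ≤ (C.toReal * (5 * eps j) ^ ((n : ℝ) - d)) * (N * (M * (eps j)⁻¹)) := by
            gcongr; exact mul_nonneg hN (mul_nonneg hM0 (inv_pos.2 (hτ j)).le)
        _ = _ := by
            rw [Real.mul_rpow (by norm_num) (hτ j).le, Real.rpow_sub_one (hτ j).ne']
            field_simp
    have lim : Tendsto (fun j => N * M * C.toReal * 5 ^ ((n : ℝ) - d) * (eps j) ^ ((n : ℝ) - d - 1)) atTop (𝓝 0) := by
      have := eps_tendsto.rpow_const (p := (n : ℝ) - d - 1) (Or.inr (by linarith))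
      rw [Real.zero_rpow (by linarith)] at this
      simpa using this.const_mul (N * M * C.toReal * 5 ^ ((n : ℝ) - d))
    exact squeeze_zero' (Eventually.of_forall fun _ => norm_nonneg _) key lim
  have eq : ∀ j, (∫ x, ζ j x • (f x • gradient ψ x)) + ∫ x, f x • (ψ x • gradient (ζ j) x) = -∫ x, ζ j x • (ψ x • F x) := by
    intro j
    have hcs : HasCompactSupport (fun x => ζ j x * ψ x) := hψc.mul_left
    have := h.ibp (fun x => ζ j x * ψ x) ((ζ1 j).mul hψ) hcs
      ((tsupport_mul_subset_left).trans (tsupport_psi (hτ j) (ζ4 j)))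
    have j1 : Integrable (fun x => ζ j x • (f x • gradient ψ x)) := int_bdd_smul i1 (ζ1 j).continuous.aestronglyMeasurable 1 (hζb j)
    have j2 : Integrable (fun x => f x • (ψ x • gradient (ζ j) x)) := by
      apply int_smul_bdd (G := ℝ) h.hf ((hψ.continuous.smul (cont_grad (ζ1 j))).aestronglyMeasurable) (M * (eps j)⁻¹)
      intro x; simp only [Pi.smul_apply']; rw [norm_smul]; gcongr
      · exact hM x
      · exact ζ3 j x
    rw [← integral_add j1 j2]
    rw [show (fun x => ζ j x • (f x • gradient ψ x) + f x • (ψ x • gradient (ζ j) x)) = fun x => f x • gradient (fun x => ζ j x * ψ x) x from ?_, this]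
    · simp only [mul_smul]
    · ext1 x
      rw [grad_mul (cd_diff (ζ1 j) x) (cd_diff hψ x), smul_add, smul_comm]
  have l1 := (L _ i1).add E
  have l2 := (L _ i2).neg
  rw [add_zero] at l1
  simp_rw [eq] at l1
  exact tendsto_nhds_unique l1 l2

lemma WG.remove (hne : Γ.Nonempty) (hcl : IsClosed Γ)
    (hA : AhlforsRegular n d C₀ Γ) (hC₀ : 1 ≤ C₀) (hdn : d < (n : ℝ) - 1)
    {f : Euc n → ℝ} {F : Euc n → Euc n} (h : WG Γᶜ f F) (hf0 : ∀ᵐ x, 0 ≤ f x) : WG univ f F := by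
  refine ⟨h.hf, h.hF, fun ψ hψ hψc _ => ?_⟩
  have hp := fun N : ℕ => h.pos_local hcl.isOpen_compl (Nat.cast_nonneg N)
  have hN : ∀ N : ℕ, WG univ (fun x => f x - max (f x - N) 0) (fun x => F x - tg N f F x) := by
    intro N
    refine WG.remove_bdd hne hcl hA hC₀ hdn (N := N) ⟨h.hf.sub (hp N).hf, h.hF.sub (hp N).hF, ?_⟩ (Nat.cast_nonneg N) ?_
    · intro ψ hψ hψc hs
      obtain ⟨M, hM0, hM⟩ := cs_bdd hψ.continuous hψc
      obtain ⟨M', hM0', hM'⟩ := cs_bdd (cont_grad hψ) (cs_grad hψc)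
      simp only [sub_smul, smul_sub]
      rw [integral_sub (int_smul_bdd (G := ℝ) h.hf (cont_grad hψ).aestronglyMeasurable M' hM')
        (int_smul_bdd (G := ℝ) (hp N).hf (cont_grad hψ).aestronglyMeasurable M' hM'),
        integral_sub (int_bdd_smul h.hF hψ.continuous.aestronglyMeasurable M hM)
        (int_bdd_smul (hp N).hF hψ.continuous.aestronglyMeasurable M hM), h.ibp ψ hψ hψc hs, (hp N).ibp ψ hψ hψc hs]
      abel
    · filter_upwards [hf0] with x hx
      rw [abs_le]
      have : (0 : ℝ) ≤ N := Nat.cast_nonneg N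
      rcases le_total (f x - N) 0 with h | h
      · rw [max_eq_right h]; constructor <;> linarith
      · rw [max_eq_left h]; constructor <;> linarith
  obtain ⟨M, hM0, hM⟩ := cs_bdd hψ.continuous hψc
  obtain ⟨M', hM0', hM'⟩ := cs_bdd (cont_grad hψ) (cs_grad hψc)
  have i1 := int_smul_bdd (G := ℝ) h.hf (cont_grad hψ).aestronglyMeasurable M' hM'
  have i2 := int_bdd_smul h.hF hψ.continuous.aestronglyMeasurable M hM
  have ev : ∀ x, ∀ᶠ N : ℕ in atTop, f x ≤ N := fun x => tendsto_natCast_atTop_atTop.eventually_ge_atTop (f x)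
  have l1 : Tendsto (fun N : ℕ => ∫ x, (f x - max (f x - N) 0) • gradient ψ x) atTop (𝓝 (∫ x, f x • gradient ψ x)) := by
    apply tendsto_integral_of_dominated_convergence (fun x => ‖f x • gradient ψ x‖)
      (fun N => (hN N).hf.1.smul (cont_grad hψ).aestronglyMeasurable) i1.norm
    · intro N; filter_upwards [hf0] with x hx
      simp only [Pi.smul_apply']
      rw [norm_smul, norm_smul]
      gcongr
      rw [Real.norm_eq_abs, Real.norm_eq_abs, abs_le, abs_of_nonneg hx]
      have : (0 : ℝ) ≤ N := Nat.cast_nonneg N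
      rcases le_total (f x - N) 0 with h | h
      · rw [max_eq_right h]; constructor <;> linarith
      · rw [max_eq_left h]; constructor <;> linarith
    · filter_upwards with x
      apply tendsto_const_nhds.congr'
      filter_upwards [ev x] with N hx
      simp only [Pi.smul_apply']
      rw [max_eq_right (by linarith), sub_zero]
  have l2 : Tendsto (fun N : ℕ => ∫ x, ψ x • (F x - tg N f F x)) atTop (𝓝 (∫ x, ψ x • F x)) := by
    apply tendsto_integral_of_dominated_convergence (fun x => ‖ψ x • F x‖)
      (fun N => hψ.continuous.aestronglyMeasurable.smul (hN N).hF.1) i2.norm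
    · intro N; filter_upwards with x
      simp only [Pi.smul_apply']
      rw [norm_smul, norm_smul]
      gcongr
      unfold tg
      split_ifs <;> simp
    · filter_upwards with x
      apply tendsto_const_nhds.congr'
      filter_upwards [ev x] with N hx
      simp only [Pi.smul_apply']
      rw [tg, if_neg (not_lt.2 hx)]; simp
  have : ∀ N : ℕ, ∫ x, (f x - max (f x - N) 0) • gradient ψ x = -∫ x, ψ x • (F x - tg N f F x) :=
    fun N => (hN N).ibp ψ hψ hψc (subset_univ _)
  simp_rw [this] at l1
  exact tendsto_nhds_unique l1 l2.neg
end

section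
variable {n : ℕ} {d C₀ : ℝ} {Γ : Set (Euc n)}

lemma ker_A1 (n : ℕ) (hn : 2 ≤ n) : ∃ C : ℝ≥0∞, C ≠ ⊤ ∧ ∀ (j : ℕ) (x : Euc n), x ≠ 0 →
    mollE j (kerE ((n : ℝ) - 1)) x ≤ C * kerE ((n : ℝ) - 1) x := by
  obtain ⟨C, hC, hb⟩ := ker_ball n hn
  have hn1 : (0 : ℝ) ≤ (n : ℝ) - 1 := by
    have : (2 : ℝ) ≤ n := by exact_mod_cast hn
    linarith
  set V := volume.real (closedBall (0 : Euc n) 1) with hV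
  have hV0 : 0 < V := by
    rw [hV, measureReal_def]; exact ENNReal.toReal_pos (measure_closedBall_pos _ _ one_pos).ne' measure_closedBall_lt_top.ne
  refine ⟨ENNReal.ofReal (2 ^ ((n : ℝ) - 1)) + ENNReal.ofReal (2 ^ n / V) * C * 3 * ENNReal.ofReal (2 ^ ((n : ℝ) - 1)), by finiteness, ?_⟩
  intro j x hx
  have hx0 : 0 < ‖x‖ := norm_pos_iff.2 hx
  have he := eps_pos j
  set ε := eps j with hε
  rw [add_mul]
  rcases le_total (2 * ε) ‖x‖ with h | h
  · refine le_trans ?_ le_self_add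
    calc mollE j (kerE ((n : ℝ) - 1)) x
        ≤ ∫⁻ y, ENNReal.ofReal (rho n j y) * (ENNReal.ofReal (2 ^ ((n : ℝ) - 1)) * kerE ((n : ℝ) - 1) x) := by
          apply lintegral_mono
          intro y
          simp only
          by_cases hy : ε ≤ ‖y‖
          · rw [rho_zero j hy]; simp
          push Not at hy
          apply mul_le_mul_right
          rw [kerE, kerE, ← ENNReal.ofReal_mul (by positivity)]
          apply ENNReal.ofReal_le_ofReal
          have h1 : ‖x‖ / 2 ≤ ‖x - y‖ := by
            have := norm_sub_norm_le x y
            linarith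
          calc ‖x - y‖ ^ (-((n : ℝ) - 1)) ≤ (‖x‖ / 2) ^ (-((n : ℝ) - 1)) :=
                Real.rpow_le_rpow_of_nonpos (by positivity) h1 (by linarith)
            _ = _ := by
                rw [div_eq_mul_inv, Real.mul_rpow hx0.le (by norm_num), Real.inv_rpow (by norm_num), ← Real.rpow_neg (by norm_num), neg_neg, mul_comm]
      _ = _ := by
          rw [lintegral_mul_const _ ((rho_meas j).ennreal_ofReal), rho_lint, one_mul]
  · refine le_trans ?_ le_add_self
    have hvol : volume.real (closedBall (0 : Euc n) ε) = ε ^ n * V := by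
      rw [measureReal_def, Measure.addHaar_closedBall' volume _ he.le, finrank_euc, ENNReal.toReal_mul,
        ENNReal.toReal_ofReal (by positivity)]; rfl
    calc mollE j (kerE ((n : ℝ) - 1)) x
        = ∫⁻ y, ENNReal.ofReal (rho n j (x - y)) * kerE ((n : ℝ) - 1) y := mollE_eq _ _ _
      _ ≤ ∫⁻ y, (ball (0 : Euc n) (3 * ε)).indicator (fun y => ENNReal.ofReal (2 ^ n / (ε ^ n * V)) * kerE ((n : ℝ) - 1) y) y := by
          apply lintegral_mono
          intro y
          simp only
          by_cases hy : y ∈ ball (0 : Euc n) (3 * ε)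
          · rw [indicator_of_mem hy]
            apply mul_le_mul_left
            apply ENNReal.ofReal_le_ofReal
            rw [← hvol]; exact rho_le j _
          · rw [indicator_of_notMem hy, rho_zero j]; simp
            rw [mem_ball_zero_iff] at hy
            have := norm_sub_norm_le y x
            rw [norm_sub_rev] at this
            push Not at hy
            linarith
      _ = ENNReal.ofReal (2 ^ n / (ε ^ n * V)) * ∫⁻ y in ball (0 : Euc n) (3 * ε), kerE ((n : ℝ) - 1) y := by
          rw [lintegral_indicator measurableSet_ball, lintegral_const_mul _ (measurable_kerE _)]
      _ ≤ ENNReal.ofReal (2 ^ n / (ε ^ n * V)) * (C * ENNReal.ofReal (3 * ε)) := by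
          apply mul_le_mul_right; exact hb _ (by positivity)
      _ = ENNReal.ofReal (2 ^ n / V) * C * 3 * ENNReal.ofReal (ε ^ (-((n : ℝ) - 1))) := by
          have : ENNReal.ofReal (2 ^ n / (ε ^ n * V)) * ENNReal.ofReal (3 * ε) =
              ENNReal.ofReal (2 ^ n / V) * 3 * ENNReal.ofReal (ε ^ (-((n : ℝ) - 1))) := by
            rw [show (3 : ℝ≥0∞) = ENNReal.ofReal 3 by norm_num, ← ENNReal.ofReal_mul (by positivity), ← ENNReal.ofReal_mul (by positivity),
              ← ENNReal.ofReal_mul (by positivity)]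
            congr 1
            rw [neg_sub, Real.rpow_sub he, Real.rpow_one, Real.rpow_natCast]
            field_simp
          calc _ = (ENNReal.ofReal (2 ^ n / (ε ^ n * V)) * ENNReal.ofReal (3 * ε)) * C := by ring
            _ = _ := by rw [this]; ring
      _ ≤ _ := by
          rw [mul_assoc (_ * C * 3)]
          apply mul_le_mul_right
          rw [kerE, ← ENNReal.ofReal_mul (by positivity)]
          apply ENNReal.ofReal_le_ofReal
          calc ε ^ (-((n : ℝ) - 1)) ≤ (‖x‖ / 2) ^ (-((n : ℝ) - 1)) :=
                Real.rpow_le_rpow_of_nonpos (by positivity) (by linarith) (by linarith)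
            _ = _ := by
                rw [div_eq_mul_inv, Real.mul_rpow hx0.le (by norm_num), Real.inv_rpow (by norm_num), ← Real.rpow_neg (by norm_num), neg_neg, mul_comm]

lemma hardy_limit (n : ℕ) (hn : 2 ≤ n) : ∃ C : ℝ≥0∞, C ≠ ⊤ ∧ ∀ (f : Euc n → ℝ) (F : Euc n → Euc n), WG univ f F →
    ∀ y, Tendsto (fun j => moll j f y) atTop (𝓝 0) →
    ∫⁻ x, ‖f x‖ₑ ^ 2 * kerE ((n : ℝ) + 1) (x - y) ≤ C * ∫⁻ x, ‖F x‖ₑ ^ 2 * kerE ((n : ℝ) - 1) (x - y) := by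
  obtain ⟨C, hC, hA1⟩ := ker_A1 n hn
  have : Nontrivial (Euc n) := by
    apply Module.nontrivial_of_finrank_pos (R := ℝ); rw [finrank_euc]; omega
  refine ⟨4 * C, by finiteness, fun f F hw y hy => ?_⟩
  have hli := hw.hf.locallyIntegrable
  have km : ∀ s, Measurable fun x : Euc n => kerE s (x - y) := fun s => (measurable_kerE s).comp (measurable_id.sub_const y)
  have step : ∀ j, ∫⁻ x, ‖moll j f x - moll j f y‖ₑ ^ 2 * kerE ((n : ℝ) + 1) (x - y) ≤
      4 * C * ∫⁻ x, ‖F x‖ₑ ^ 2 * kerE ((n : ℝ) - 1) (x - y) := by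
    intro j
    refine (hardy_y hn (moll_contDiff j hli) y).trans ?_
    rw [mul_assoc]
    apply mul_le_mul_right
    have hF2 : AEMeasurable (fun x => ‖F x‖ₑ ^ 2) volume := hw.hF.1.enorm.pow_const 2
    calc ∫⁻ x, ‖gradient (moll j f) x‖ₑ ^ 2 * kerE ((n : ℝ) - 1) (x - y)
        ≤ ∫⁻ x, kerE ((n : ℝ) - 1) (x - y) * mollE j (fun z => ‖F z‖ₑ ^ 2) x := by
          apply lintegral_mono
          intro x
          simp only
          rw [hw.moll_gradient, mul_comm]
          apply mul_le_mul_right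
          exact moll_enorm_sq_le j hw.hF.1 x
      _ = ∫⁻ x, mollE j (fun x => kerE ((n : ℝ) - 1) (x - y)) x * ‖F x‖ₑ ^ 2 :=
          lintegral_mollE_mul j hF2 (km _).aemeasurable
      _ ≤ ∫⁻ x, C * (‖F x‖ₑ ^ 2 * kerE ((n : ℝ) - 1) (x - y)) := by
          apply lintegral_mono_ae
          filter_upwards [Measure.ae_ne volume y] with x hx
          have e : mollE j (fun x => kerE ((n : ℝ) - 1) (x - y)) x = mollE j (kerE ((n : ℝ) - 1)) (x - y) := by
            unfold mollE; congr 1; ext w; rw [sub_right_comm]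
          rw [e]
          calc _ ≤ (C * kerE ((n : ℝ) - 1) (x - y)) * ‖F x‖ₑ ^ 2 := by
                apply mul_le_mul_left; exact hA1 j _ (sub_ne_zero.2 hx)
            _ = _ := by ring
      _ = _ := lintegral_const_mul' _ _ hC
  have lim : ∀ᵐ x, Tendsto (fun j => ‖moll j f x - moll j f y‖ₑ ^ 2 * kerE ((n : ℝ) + 1) (x - y)) atTop
      (𝓝 (‖f x‖ₑ ^ 2 * kerE ((n : ℝ) + 1) (x - y))) := by
    filter_upwards [moll_ae hli] with x hx
    have h1 : Tendsto (fun j => moll j f x - moll j f y) atTop (𝓝 (f x)) := by simpa using hx.sub hy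
    apply ENNReal.Tendsto.mul_const
    · exact ((ENNReal.continuous_pow 2).tendsto _).comp h1.enorm
    · right; exact ENNReal.ofReal_ne_top
  calc _ = ∫⁻ x, liminf (fun j => ‖moll j f x - moll j f y‖ₑ ^ 2 * kerE ((n : ℝ) + 1) (x - y)) atTop := by
        apply lintegral_congr_ae
        filter_upwards [lim] with x hx using hx.liminf_eq.symm
    _ ≤ liminf (fun j => ∫⁻ x, ‖moll j f x - moll j f y‖ₑ ^ 2 * kerE ((n : ℝ) + 1) (x - y)) atTop :=
        lintegral_liminf_le fun j => (((moll_contDiff j hli).continuous.measurable.sub_const _).enorm.pow_const 2).mul (km _)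
    _ ≤ liminf (fun _ : ℕ => 4 * C * ∫⁻ x, ‖F x‖ₑ ^ 2 * kerE ((n : ℝ) - 1) (x - y)) atTop :=
        liminf_le_liminf (Eventually.of_forall step)
    _ = _ := by simp

lemma hardy_trace (hn : 2 ≤ n) (hne : Γ.Nonempty) (hcl : IsClosed Γ)
    (hA : AhlforsRegular n d C₀ Γ) (hC₀ : 1 ≤ C₀) (hd : 0 < d) (hdn : d < (n : ℝ) - 1)
    {f : Euc n → ℝ} {F : Euc n → Euc n} (hw : WG univ f F) (hF : ∫⁻ x, ‖F x‖ₑ ^ 2 ∂(measW n d Γ) ≠ ⊤)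
    (ht : ∀ᵐ y ∂((μH[d] : Measure (Euc n)).restrict Γ), Tendsto (fun j => moll j f y) atTop (𝓝 0)) :
    ∫⁻ x, ‖f x‖ₑ ^ 2 * dE d Γ ((n : ℝ) + 1) x ≠ ⊤ := by
  obtain ⟨C, hC, hh⟩ := hardy_limit n hn
  have h1 := kint_lower hne hcl hA hC₀ hdn (s := (n : ℝ) + 1) (by positivity) (hw.hf.1.enorm.pow_const 2)
  have h2 := kint_upper hne hcl hA hC₀ hd hdn hdn (hw.hF.1.enorm.pow_const 2)
  have h3 : ∫⁻ y in Γ, (∫⁻ x, ‖f x‖ₑ ^ 2 * kerE ((n : ℝ) + 1) (x - y)) ∂μH[d] ≤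
      C * ∫⁻ y in Γ, (∫⁻ x, ‖F x‖ₑ ^ 2 * kerE ((n : ℝ) - 1) (x - y)) ∂μH[d] := by
    rw [← lintegral_const_mul' _ _ hC]
    apply lintegral_mono_ae
    filter_upwards [ht] with y hy
    exact hh f F hw y hy
  rw [lint_m] at hF
  have h4 := h1.trans (h3.trans (mul_le_mul_right h2 C))
  have h5 : ENNReal.ofReal (C₀⁻¹ * 2 ^ (-((n : ℝ) + 1))) ≠ 0 := by
    have : 0 < C₀ := by linarith
    rw [ne_eq, ENNReal.ofReal_eq_zero, not_le]; positivity
  intro htop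
  rw [htop, ENNReal.mul_top h5, top_le_iff] at h4
  exact ENNReal.mul_ne_top hC (ENNReal.mul_ne_top ENNReal.ofReal_ne_top hF) h4

lemma moll_trace {u f : Euc n → ℝ} {y : Euc n} {ρ : ℝ} (hρ : 0 < ρ) (hu : IntegrableOn u (ball y ρ))
    (hfu : ∀ᵐ z ∂(volume.restrict (ball y ρ)), 0 ≤ f z ∧ f z ≤ u z) (hT : HasTraceAt u y 0) :
    Tendsto (fun j => moll j f y) atTop (𝓝 0) := by
  have ht : Tendsto (fun j => 2 ^ n * ⨍ z in ball y (eps j), u z) atTop (𝓝 0) := by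
    have := (hT.comp (tendsto_nhdsWithin_iff.2 ⟨eps_tendsto, Eventually.of_forall fun j => eps_pos j⟩)).const_mul (2 ^ n : ℝ)
    rwa [mul_zero] at this
  have key : ∀ᶠ j in atTop, 0 ≤ moll j f y ∧ moll j f y ≤ 2 ^ n * ⨍ z in ball y (eps j), u z := by
    filter_upwards [eps_tendsto.eventually_lt_const hρ] with j hj
    have hsub : ball y (eps j) ⊆ ball y ρ := ball_subset_ball hj.le
    have e : moll j f y = ∫ z in ball y (eps j), rho n j (y - z) • f z := by
      rw [moll_smul_int, setIntegral_eq_integral_of_forall_compl_eq_zero]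
      intro z hz
      rw [mem_ball, dist_comm, dist_eq_norm, not_lt] at hz
      rw [rho_zero j hz, zero_smul]
    have hae := ae_mono (Measure.restrict_mono hsub le_rfl) hfu
    constructor
    · rw [e]
      apply integral_nonneg_of_ae
      filter_upwards [hae] with z hz
      exact mul_nonneg (rho_nonneg j _) hz.1
    · rw [e, setAverage_eq, smul_eq_mul, ← integral_const_mul, ← integral_const_mul]
      apply integral_mono_of_nonneg
      · filter_upwards [hae] with z hz
        exact mul_nonneg (rho_nonneg j _) hz.1
      · exact ((hu.mono_set hsub).const_mul _).const_mul _
      · filter_upwards [hae] with z hz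
        have hv : volume.real (closedBall (0 : Euc n) (eps j)) = volume.real (ball y (eps j)) := by
          rw [measureReal_def, measureReal_def, Measure.addHaar_closedBall _ _ (eps_pos j).le, Measure.addHaar_ball_of_pos _ _ (eps_pos j)]
        have := rho_le j (y - z)
        rw [hv] at this
        calc _ ≤ (2 ^ n / volume.real (ball y (eps j))) * u z := by
              rw [smul_eq_mul]
              exact mul_le_mul this hz.2 hz.1 (by positivity)
          _ = _ := by rw [div_eq_mul_inv, mul_assoc]
  exact squeeze_zero' (key.mono fun _ h => h.1) (key.mono fun _ h => h.2) ht
end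

section
variable {n : ℕ} {d C₀ : ℝ} {Γ : Set (Euc n)}

lemma dE_lower {x : Euc n} (hx : x ∈ Γ) {R s : ℝ} (hs : d ≤ s) (hne : Γ.Nonempty) (hcl : IsClosed Γ)
    {y : Euc n} (hy : y ∈ ball x R) (hyΓ : y ∉ Γ) : ENNReal.ofReal (R ^ (d - s)) ≤ dE d Γ s y := by
  apply ENNReal.ofReal_le_ofReal
  apply Real.rpow_le_rpow_of_nonpos (infDist_pos' hne hcl hyΓ) _ (by linarith)
  exact (infDist_le_dist_of_mem hx).trans (mem_ball.1 hy).le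

lemma lint_le_dE (hne : Γ.Nonempty) (hcl : IsClosed Γ)
    (hA : AhlforsRegular n d C₀ Γ) (hC₀ : 1 ≤ C₀) (hdn : d < (n : ℝ) - 1)
    {x : Euc n} (hx : x ∈ Γ) {R s : ℝ} (hR : 0 < R) (hs : d ≤ s) {g : Euc n → ℝ≥0∞} (hg : ∀ y ∉ ball x R, g y = 0) :
    ∫⁻ y, g y ≤ ENNReal.ofReal (R ^ (s - d)) * ∫⁻ y, g y * dE d Γ s y := by
  rw [← lintegral_const_mul' _ _ ENNReal.ofReal_ne_top]
  apply lintegral_mono_ae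
  filter_upwards [ae_notMem hne hcl hA hC₀ hdn] with y hy
  by_cases hb : y ∈ ball x R
  · calc g y = (ENNReal.ofReal (R ^ (s - d)) * ENNReal.ofReal (R ^ (d - s))) * g y := by
          rw [← ENNReal.ofReal_mul (by positivity), ← Real.rpow_add hR]; simp
      _ ≤ (ENNReal.ofReal (R ^ (s - d)) * dE d Γ s y) * g y := by
          apply mul_le_mul_left; apply mul_le_mul_right; exact dE_lower hx hs hne hcl hb hy
      _ = _ := by ring
  · rw [hg y hb]; simp

/-- cleaned-up data -/
structure Data (n : ℕ) (d : ℝ) (Γ : Set (Euc n)) (A : Euc n → Euc n →L[ℝ] Euc n) (x : Euc n) (r : ℝ)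
    (u f : Euc n → ℝ) (F : Euc n → Euc n) : Prop where
  wg : WG univ f F
  nonneg : ∀ᵐ y, 0 ≤ f y
  eq : ∀ y ∈ ball x (7 * r / 4), f y = u y
  f0 : ∀ y ∉ ball x (2 * r), f y = 0
  Fm : ∫⁻ y, ‖F y‖ₑ ^ 2 ∂(measW n d Γ) ≠ ⊤
  F2 : ∫⁻ y, ‖F y‖ₑ ^ 2 ≠ ⊤
  fH : ∫⁻ y, ‖f y‖ₑ ^ 2 * dE d Γ ((n : ℝ) + 1) y ≠ ⊤
  f2 : ∫⁻ y, ‖f y‖ₑ ^ 2 ≠ ⊤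
  sub : SubsolOn Γ A F (ball x (7 * r / 4) \ Γ)

lemma bad_v {U : Set (Euc n)} (hU : IsOpen U) {u : Euc n → ℝ} {v : Euc n → Euc n} (hu : LocallyIntegrableOn u U)
    (hg : IsDistribGradOn u v U) (hv : ¬ LocallyIntegrableOn v U)
    {φ : Euc n → ℝ} (h1 : ContDiff ℝ (⊤ : ℕ∞) φ) (h2 : HasCompactSupport φ) (h3 : tsupport φ ⊆ U) :
    ∫ y in U, u y • gradient φ y = 0 := by
  unfold LocallyIntegrableOn at hv
  push Not at hv
  obtain ⟨z, hz, hvz⟩ := hv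
  obtain ⟨s, hs, hsU⟩ := nhds_basis_closedBall.mem_iff.1 (hU.mem_nhds hz)
  obtain ⟨χ, c1, c2, c3, c4, c5⟩ := exists_cutoff (isCompact_closedBall z s) hU hsU
  have nχ : ¬ IntegrableOn (fun y => χ y • v y) U := by
    intro h
    apply hvz
    refine ⟨closedBall z s, mem_nhdsWithin_of_mem_nhds (closedBall_mem_nhds z hs), ?_⟩
    refine ((h.mono_set hsU).congr_fun ?_ measurableSet_closedBall)
    intro y hy; simp [c4 y hy]
  have eχ : ∫ y in U, u y • gradient χ y = 0 := by
    rw [hg χ c1 c2 c3, integral_undef nχ, neg_zero]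
  by_cases hφ : IntegrableOn (fun y => φ y • v y) U
  · have hsum : ∫ y in U, u y • gradient (fun y => φ y + χ y) y = 0 := by
      rw [hg _ (h1.add c1) (h2.add c2) ((tsupport_add φ χ).trans (union_subset h3 c3)), integral_undef, neg_zero]
      intro h
      apply nχ
      have := h.sub hφ
      refine this.congr (Eventually.of_forall fun y => ?_)
      simp [add_smul]
    have hi : ∀ ψ : Euc n → ℝ, ContDiff ℝ (⊤ : ℕ∞) ψ → HasCompactSupport ψ → tsupport ψ ⊆ U →
        IntegrableOn (fun y => u y • gradient ψ y) U := by
      intro ψ p1 p2 p3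
      obtain ⟨M, hM0, hM⟩ := cs_bdd (cont_grad p1) (cs_grad p2)
      have hK := hu.integrableOn_compact_subset p3 p2
      have : Integrable (fun y => (tsupport ψ).indicator u y • gradient ψ y) :=
        int_smul_bdd (G := ℝ) ((integrable_indicator_iff (isClosed_tsupport ψ).measurableSet).2 hK) (cont_grad p1).aestronglyMeasurable M hM
      refine (this.congr (Eventually.of_forall fun y => ?_)).integrableOn
      simp only
      by_cases hy : y ∈ tsupport ψ
      · rw [indicator_of_mem hy]
      · rw [image_eq_zero_of_notMem_tsupport (fun h => hy (supp_grad_sub ψ h))]; simp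
    have e : ∀ y, u y • gradient (fun y => φ y + χ y) y = u y • gradient φ y + u y • gradient χ y := by
      intro y
      rw [← smul_add]; congr 1
      unfold gradient
      rw [fderiv_fun_add (cd_diff h1 y) (cd_diff c1 y)]; simp
    simp_rw [e] at hsum
    rw [integral_add (hi φ h1 h2 h3) (hi χ c1 c2 c3), eχ, add_zero] at hsum
    exact hsum
  · rw [hg φ h1 h2 h3, integral_undef hφ, neg_zero]

lemma exists_data (hn : 2 ≤ n) (hd : 0 < d) (hdn : d < (n : ℝ) - 1) (hC₀ : 1 ≤ C₀) (hne : Γ.Nonempty) (hcl : IsClosed Γ)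
    (hA : AhlforsRegular n d C₀ Γ) (A : Euc n → Euc n →L[ℝ] Euc n) {x : Euc n} (hx : x ∈ Γ) {r : ℝ} (hr : 0 < r)
    {u : Euc n → ℝ} {v : Euc n → Euc n} (hW : MemWrOn n d Γ (ball x (2 * r)) u)
    (hg : IsDistribGradOn u v (ball x (2 * r) \ Γ))
    (h0 : ∀ᵐ y ∂(volume.restrict (ball x (2 * r) \ Γ)), 0 ≤ u y) (hs : SubsolOn Γ A v (ball x (2 * r) \ Γ))
    (ht : ∀ᵐ z ∂((μH[d] : Measure (Euc n)).restrict (Γ ∩ ball x (2 * r))), HasTraceAt u z 0) :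
    ∃ f F, Data n d Γ A x r u f F := by
  have hΓ := ae_notMem hne hcl hA hC₀ hdn
  have hres : (volume : Measure (Euc n)).restrict Γᶜ = volume := Measure.restrict_eq_self_of_ae_mem hΓ
  let η : ContDiffBump x := ⟨7 * r / 4, 15 * r / 8, by positivity, by linarith⟩
  let χ : ContDiffBump x := ⟨15 * r / 8, 31 * r / 16, by positivity, by linarith⟩
  have ηs : tsupport η ⊆ ball x (2 * r) := by
    rw [η.tsupport_eq]; exact closedBall_subset_ball (by simp only [η]; linarith)
  have χs : tsupport χ ⊆ ball x (2 * r) := by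
    rw [χ.tsupport_eq]; exact closedBall_subset_ball (by simp only [χ]; linarith)
  obtain ⟨F₀, hF₀⟩ := hW.2 η η.contDiff η.hasCompactSupport ηs
  set f : Euc n → ℝ := fun y => η y * u y with hf
  set F : Euc n → Euc n := fun y => χ y • F₀ y with hF
  have hu0 : ∀ᵐ y, y ∈ ball x (2 * r) → 0 ≤ u y := by
    rw [ae_restrict_iff' (measurableSet_ball.diff hcl.measurableSet)] at h0
    filter_upwards [h0, hΓ] with y h1 h2 h3 using h1 ⟨h3, h2⟩
  have f00 : ∀ y ∉ ball x (15 * r / 8), f y = 0 := by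
    intro y hy
    have : y ∉ Function.support η := by rw [η.support_eq]; exact hy
    rw [Function.notMem_support] at this
    simp only [hf, this, zero_mul]
  have f0 : ∀ y ∉ ball x (2 * r), f y = 0 := fun y hy => f00 y fun h => hy (ball_subset_ball (by linarith) h)
  have χ0 : ∀ y ∉ ball x (2 * r), χ y = 0 := fun y hy => image_eq_zero_of_notMem_tsupport fun h => hy (χs h)
  have F0 : ∀ y ∉ ball x (2 * r), F y = 0 := fun y hy => by simp [hF, χ0 y hy]
  have F₀m : AEStronglyMeasurable F₀ volume := by
    have := hF₀.gradLocInt.aestronglyMeasurable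
    rwa [hres] at this
  have Fmeas : AEStronglyMeasurable F volume := χ.continuous.aestronglyMeasurable.smul F₀m
  have fi : Integrable f := by
    have h1 := hW.1.integrableOn_compact_subset (closedBall_subset_ball (show 15 * r / 8 < 2 * r by linarith)) (isCompact_closedBall x _)
    have h2 := (integrable_indicator_iff measurableSet_closedBall).2 h1
    have h3 := int_bdd_smul h2 η.continuous.aestronglyMeasurable 1 (fun y => by
      rw [Real.norm_eq_abs, abs_of_nonneg η.nonneg]; exact η.le_one)
    refine h3.congr (Eventually.of_forall fun y => ?_)
    simp only [smul_eq_mul]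
    by_cases hy : y ∈ closedBall x (15 * r / 8)
    · rw [indicator_of_mem hy]
    · rw [indicator_of_notMem hy, f00 y fun h => hy (ball_subset_closedBall h), mul_zero]
  have Fm : ∫⁻ y, ‖F y‖ₑ ^ 2 ∂(measW n d Γ) ≠ ⊤ := by
    have h1 : ∫⁻ y, ‖F y‖ₑ ^ 2 ∂(measW n d Γ) ≤ ∫⁻ y in Γᶜ, ENNReal.ofReal (‖F₀ y‖ ^ 2) ∂(measW n d Γ) := by
      have : (measW n d Γ).restrict Γᶜ = measW n d Γ := Measure.restrict_eq_self_of_ae_mem (m_ac.ae_le hΓ)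
      rw [this]
      apply lintegral_mono
      intro y
      simp only [hF]
      rw [ENNReal.ofReal_pow (norm_nonneg _), ofReal_norm, enorm_smul]
      gcongr
      calc _ ≤ 1 * ‖F₀ y‖ₑ := by
            gcongr
            rw [Real.enorm_of_nonneg χ.nonneg, ← ENNReal.ofReal_one]
            exact ENNReal.ofReal_le_ofReal χ.le_one
        _ = _ := one_mul _
    exact ne_top_of_le_ne_top hF₀.l2.ne h1
  have F2 : ∫⁻ y, ‖F y‖ₑ ^ 2 ≠ ⊤ := by
    refine ne_top_of_le_ne_top ?_ (lint_le_dE hne hcl hA hC₀ hdn hx (R := 2 * r) (by positivity) hdn.le (fun y hy => by rw [F0 y hy]; simp))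
    rw [← lint_m]
    exact ENNReal.mul_ne_top ENNReal.ofReal_ne_top Fm
  have Fi : Integrable F := by
    refine ⟨Fmeas, ?_⟩
    have h1 : ∫⁻ y, ‖F y‖ₑ ≤ ∫⁻ y, ((ball x (2 * r)).indicator (fun _ => 1) y + ‖F y‖ₑ ^ 2) := by
      apply lintegral_mono
      intro y
      simp only
      by_cases hy : y ∈ ball x (2 * r)
      · rw [indicator_of_mem hy]
        rcases le_total ‖F y‖ₑ 1 with h | h
        · exact h.trans le_self_add
        · refine le_trans ?_ le_add_self
          rw [sq]; exact le_mul_of_one_le_left' h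
      · rw [F0 y hy]; simp
    rw [lintegral_add_left (measurable_const.indicator measurableSet_ball), lintegral_indicator measurableSet_ball] at h1
    refine lt_of_le_of_lt h1 ?_
    simp only [lintegral_const, one_mul, Measure.restrict_apply_univ]
    exact ENNReal.add_lt_top.2 ⟨measure_ball_lt_top, lt_top_iff_ne_top.2 F2⟩
  have wgΓ : WG Γᶜ f F := by
    refine ⟨fi, Fi, fun ψ p1 p2 p3 => ?_⟩
    have := hF₀.isGrad (fun y => χ y * ψ y) (χ.contDiff.mul p1) (p2.mul_left) ((tsupport_mul_subset_right).trans p3)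
    rw [hres] at this
    rw [show (fun y => f y • gradient ψ y) = fun y => (η y * u y) • gradient (fun y => χ y * ψ y) y from ?_, this]
    · congr 1; congr 1; ext1 y; rw [hF, mul_comm, mul_smul]
    · ext1 y
      by_cases hy : y ∈ ball x (15 * r / 8)
      · have : (fun y => χ y * ψ y) =ᶠ[𝓝 y] ψ := by
          filter_upwards [isOpen_ball.mem_nhds hy] with z hz
          rw [χ.one_of_mem_closedBall (ball_subset_closedBall hz), one_mul]
        rw [gradient, gradient, this.fderiv_eq]
      · have := f00 y hy
        simp only [hf] at this
        simp only [hf, this, zero_smul]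
  have nonneg : ∀ᵐ y, 0 ≤ f y := by
    filter_upwards [hu0] with y hy
    by_cases hb : y ∈ ball x (2 * r)
    · exact mul_nonneg η.nonneg (hy hb)
    · rw [f0 y hb]
  have wg : WG univ f F := wgΓ.remove hne hcl hA hC₀ hdn nonneg
  have feq : ∀ y ∈ ball x (7 * r / 4), f y = u y := fun y hy => by
    simp only [hf]; rw [η.one_of_mem_closedBall (ball_subset_closedBall hy), one_mul]
  have tr : ∀ᵐ y ∂((μH[d] : Measure (Euc n)).restrict Γ), Tendsto (fun j => moll j f y) atTop (𝓝 0) := by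
    rw [ae_restrict_iff' hcl.measurableSet]
    rw [ae_restrict_iff' (hcl.measurableSet.inter measurableSet_ball)] at ht
    filter_upwards [ht] with y hy hyΓ
    by_cases hb : y ∈ ball x (2 * r)
    · have hρ : 0 < (2 * r - dist y x) / 2 := by have := mem_ball.1 hb; linarith
      have hsub : closedBall y ((2 * r - dist y x) / 2) ⊆ ball x (2 * r) := by
        intro z hz
        rw [mem_closedBall] at hz; rw [mem_ball]
        have := dist_triangle z y x
        have := mem_ball.1 hb; linarith
      refine moll_trace hρ ((hW.1.integrableOn_compact_subset hsub (isCompact_closedBall _ _)).mono_set ball_subset_closedBall) ?_ (hy ⟨hyΓ, hb⟩)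
      rw [ae_restrict_iff' measurableSet_ball]
      filter_upwards [hu0] with z hz hzb
      have h1 := hz (hsub (ball_subset_closedBall hzb))
      exact ⟨mul_nonneg η.nonneg h1, mul_le_of_le_one_left h1 η.le_one⟩
    · apply tendsto_const_nhds.congr'
      filter_upwards [eps_tendsto.eventually_lt_const (show 0 < r / 8 by positivity)] with j hj
      symm
      apply moll_zero_of
      intro z hz
      apply f00
      intro hz2
      apply hb
      rw [mem_ball] at *
      have := dist_triangle y z x
      rw [dist_comm y z] at this
      linarith
  have fH := hardy_trace hn hne hcl hA hC₀ hd hdn wg Fm tr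
  have f2 : ∫⁻ y, ‖f y‖ₑ ^ 2 ≠ ⊤ :=
    ne_top_of_le_ne_top (ENNReal.mul_ne_top ENNReal.ofReal_ne_top fH)
      (lint_le_dE hne hcl hA hC₀ hdn hx (R := 2 * r) (s := (n : ℝ) + 1) (by positivity) (by linarith) (fun y hy => by rw [f0 y hy]; simp))
  refine ⟨f, F, wg, nonneg, feq, f0, Fm, F2, fH, f2, ?_⟩
  set U := ball x (2 * r) \ Γ with hU
  set U' := ball x (7 * r / 4) \ Γ with hU'
  have oU : IsOpen U := isOpen_ball.sdiff hcl
  have oU' : IsOpen U' := isOpen_ball.sdiff hcl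
  have hUU : U' ⊆ U := sdiff_subset_sdiff_left (ball_subset_ball (by linarith))
  have huU : LocallyIntegrableOn u U := hW.1.mono_set sdiff_subset
  have eqI : ∀ φ : Euc n → ℝ, ContDiff ℝ (⊤ : ℕ∞) φ → HasCompactSupport φ → tsupport φ ⊆ U' →
      ∫ y in U, u y • gradient φ y = -∫ y, φ y • F y := by
    intro φ p1 p2 p3
    rw [← wg.ibp φ p1 p2 (subset_univ _), setIntegral_eq_integral_of_forall_compl_eq_zero]
    · congr 1; ext1 y
      by_cases hy : y ∈ tsupport φ
      · rw [feq y (p3 hy).1]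
      · rw [image_eq_zero_of_notMem_tsupport (fun h => hy (supp_grad_sub φ h))]; simp
    · intro y hy
      rw [image_eq_zero_of_notMem_tsupport (fun h => hy (hUU (p3 (supp_grad_sub φ h))))]; simp
  by_cases hv : LocallyIntegrableOn v U
  · have hvF : ∀ᵐ y, y ∈ U' → v y - F y = 0 := by
      apply oU'.ae_eq_zero_of_integral_contDiff_smul_eq_zero
      · exact (hv.mono_set hUU).sub (wg.hF.locallyIntegrable.locallyIntegrableOn _)
      · intro φ p1 p2 p3
        have e1 := eqI φ p1 p2 p3
        rw [hg φ p1 p2 (p3.trans hUU), neg_inj, setIntegral_eq_integral_of_forall_compl_eq_zero] at e1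
        · obtain ⟨M, hM0, hM⟩ := cs_bdd p1.continuous p2
          simp_rw [smul_sub]
          rw [integral_sub, e1, sub_self]
          · have hK := hv.integrableOn_compact_subset (p3.trans hUU) p2
            have := int_bdd_smul ((integrable_indicator_iff (isClosed_tsupport φ).measurableSet).2 hK) p1.continuous.aestronglyMeasurable M hM
            refine this.congr (Eventually.of_forall fun y => ?_)
            simp only
            by_cases hy : y ∈ tsupport φ
            · rw [indicator_of_mem hy]
            · rw [image_eq_zero_of_notMem_tsupport hy]; simp
          · exact int_bdd_smul wg.hF p1.continuous.aestronglyMeasurable M hM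
        · intro y hy
          rw [image_eq_zero_of_notMem_tsupport (fun h => hy (hUU (p3 h)))]; simp
    intro φ p1 p2 p3 p4
    have := hs φ p1 p2 (p3.trans hUU) p4
    rw [hres] at this ⊢
    rw [show ∫ y, ∑ i, A y (F y) i * gradient φ y i = ∫ y, ∑ i, A y (v y) i * gradient φ y i from ?_]
    · exact this
    apply integral_congr_ae
    filter_upwards [hvF] with y hy
    by_cases h : y ∈ tsupport φ
    · rw [sub_eq_zero.1 (hy (p3 h))]
    · rw [image_eq_zero_of_notMem_tsupport (fun h' => h (supp_grad_sub φ h'))]; simp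
  · have hF0 : ∀ᵐ y, y ∈ U' → F y = 0 := by
      apply oU'.ae_eq_zero_of_integral_contDiff_smul_eq_zero
      · exact wg.hF.locallyIntegrable.locallyIntegrableOn _
      · intro φ p1 p2 p3
        have e1 := eqI φ p1 p2 p3
        rw [bad_v oU huU hg hv p1 p2 (p3.trans hUU)] at e1
        exact neg_eq_zero.1 e1.symm
    intro φ p1 p2 p3 p4
    rw [hres]
    apply le_of_eq
    apply integral_eq_zero_of_ae
    filter_upwards [hF0] with y hy
    by_cases h : y ∈ tsupport φ
    · rw [hy (p3 h)]; simp
    · rw [image_eq_zero_of_notMem_tsupport (fun h' => h (supp_grad_sub φ h'))]; simp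
end

section
variable {n : ℕ} {d C₀ C₁ : ℝ} {Γ : Set (Euc n)} {A : Euc n → Euc n →L[ℝ] Euc n}

lemma sum_inner_euc (a b : Euc n) : ∑ i, a i * b i = inner ℝ a b := by
  rw [PiLp.inner_apply]; simp [mul_comm]

lemma Q_enorm (hC₁ : 1 ≤ C₁) (hE : EllipticOn n d Γ A C₁) {x : Euc n} (hx : x ∉ Γ) (ξ ζ : Euc n) :
    ‖∑ i, A x ξ i * ζ i‖ₑ ≤ ENNReal.ofReal C₁ * (‖ξ‖ₑ * ‖ζ‖ₑ * dE d Γ ((n : ℝ) - 1) x) := by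
  have := (hE x hx).1 ξ ζ
  rw [← ofReal_norm, Real.norm_eq_abs, ← weight_dE, ← ofReal_norm, ← ofReal_norm, ← ENNReal.ofReal_mul (norm_nonneg _),
    ← ENNReal.ofReal_mul (by positivity), ← ENNReal.ofReal_mul (by linarith)]
  apply ENNReal.ofReal_le_ofReal
  linarith

lemma Q_lint (hne : Γ.Nonempty) (hcl : IsClosed Γ) (hA : AhlforsRegular n d C₀ Γ) (hC₀ : 1 ≤ C₀) (hdn : d < (n : ℝ) - 1)
    (hC₁ : 1 ≤ C₁) (hE : EllipticOn n d Γ A C₁) {F Z : Euc n → Euc n}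
    (hF : AEStronglyMeasurable F volume) (hZ : AEStronglyMeasurable Z volume) :
    ∫⁻ x, ‖∑ i, A x (F x) i * Z x i‖ₑ ≤ ENNReal.ofReal C₁ *
      ((∫⁻ x, ‖F x‖ₑ ^ 2 ∂(measW n d Γ)) * ∫⁻ x, ‖Z x‖ₑ ^ 2 ∂(measW n d Γ)) ^ (1 / 2 : ℝ) := by
  rw [lint_m, lint_m]
  refine le_trans ?_ (mul_le_mul_right (cs_w (dE_meas _).aemeasurable hF.enorm hZ.enorm) _)
  rw [← lintegral_const_mul' _ _ ENNReal.ofReal_ne_top]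
  apply lintegral_mono_ae
  filter_upwards [ae_notMem hne hcl hA hC₀ hdn] with x hx
  exact Q_enorm hC₁ hE hx _ _

lemma Q_meas (hAm : AEStronglyMeasurable A volume) {F Z : Euc n → Euc n}
    (hF : AEStronglyMeasurable F volume) (hZ : AEStronglyMeasurable Z volume) :
    AEStronglyMeasurable (fun x => ∑ i, A x (F x) i * Z x i) volume := by
  simp_rw [sum_inner_euc]
  exact ((ContinuousLinearMap.id ℝ (Euc n →L[ℝ] Euc n)).aestronglyMeasurable_comp₂ hAm hF).inner hZ

/-- testing with a compactly supported Sobolev function -/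
lemma test_sobolev (hne : Γ.Nonempty) (hcl : IsClosed Γ) (hA : AhlforsRegular n d C₀ Γ) (hC₀ : 1 ≤ C₀) (hdn : d < (n : ℝ) - 1)
    (hC₁ : 1 ≤ C₁) (hAm : AEStronglyMeasurable A volume) (hE : EllipticOn n d Γ A C₁)
    {F : Euc n → Euc n} {V : Set (Euc n)} (hV : IsOpen V) (hVΓ : V ⊆ Γᶜ) (hsub : SubsolOn Γ A F V)
    (hF : AEStronglyMeasurable F volume) (hFm : ∫⁻ y, ‖F y‖ₑ ^ 2 ∂(measW n d Γ) ≠ ⊤)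
    {Φ : Euc n → ℝ} {P : Euc n → Euc n} (hw : WG univ Φ P) {K : Set (Euc n)} (hK : IsCompact K) (hKV : K ⊆ V)
    (h0 : ∀ x ∉ K, Φ x = 0) (h0' : ∀ x ∉ K, P x = 0) (hpos : ∀ x, 0 ≤ Φ x) (hP2 : ∫⁻ x, ‖P x‖ₑ ^ 2 ≠ ⊤) :
    Integrable (fun x => ∑ i, A x (F x) i * P x i) ∧ ∫ x, ∑ i, A x (F x) i * P x i ≤ 0 := by
  have hres : (volume : Measure (Euc n)).restrict Γᶜ = volume :=
    Measure.restrict_eq_self_of_ae_mem (ae_notMem hne hcl hA hC₀ hdn)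
  have hLi := hw.hF.locallyIntegrable
  have hli := hw.hf.locallyIntegrable
  obtain ⟨M, hM, hMb⟩ := dE_bdd (d := d) hne hcl hK (hKV.trans hVΓ) ((n : ℝ) - 1)
  have hPm : ∫⁻ x, ‖P x‖ₑ ^ 2 ∂(measW n d Γ) ≠ ⊤ := ne_top_of_le_ne_top (ENNReal.mul_ne_top hM hP2)
    (lint_le_of_supp hMb hM (fun x hx => by rw [h0' x hx]; simp))
  have cM := fun j => (moll_contDiff j hLi).continuous.aestronglyMeasurable (μ := volume)
  have iP : Integrable (fun x => ∑ i, A x (F x) i * P x i) := by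
    refine ⟨Q_meas hAm hF hw.hF.1, ?_⟩
    refine lt_of_le_of_lt (Q_lint hne hcl hA hC₀ hdn hC₁ hE hF hw.hF.1) (lt_top_iff_ne_top.2 ?_)
    exact ENNReal.mul_ne_top ENNReal.ofReal_ne_top (ENNReal.rpow_ne_top_of_nonneg (by norm_num) (ENNReal.mul_ne_top hFm hPm))
  refine ⟨iP, ?_⟩
  have t := moll_L2m (d := d) hne hcl hK (hKV.trans hVΓ) h0' hLi hP2
  have t2 : Tendsto (fun j => ∫⁻ x, ‖∑ i, A x (F x) i * moll j P x i - ∑ i, A x (F x) i * P x i‖ₑ) atTop (𝓝 0) := by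
    have lim : Tendsto (fun j => ENNReal.ofReal C₁ * ((∫⁻ x, ‖F x‖ₑ ^ 2 ∂(measW n d Γ)) *
        ∫⁻ x, ‖moll j P x - P x‖ₑ ^ 2 ∂(measW n d Γ)) ^ (1 / 2 : ℝ)) atTop (𝓝 0) := by
      have h1 := (ENNReal.Tendsto.const_mul t (Or.inr hFm)).ennrpow_const (1 / 2 : ℝ)
      have h2 := ENNReal.Tendsto.const_mul h1 (Or.inr (ENNReal.ofReal_ne_top (r := C₁)))
      rwa [mul_zero, ENNReal.zero_rpow_of_pos (by norm_num), mul_zero] at h2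
    refine tendsto_of_tendsto_of_tendsto_of_le_of_le tendsto_const_nhds lim (fun _ => zero_le) fun j => ?_
    refine le_trans (le_of_eq ?_) (Q_lint hne hcl hA hC₀ hdn hC₁ hE hF ((cM j).sub hw.hF.1))
    congr 1; ext1 x; congr 1
    rw [← Finset.sum_sub_distrib]
    apply Finset.sum_congr rfl
    intro i _
    simp only [Pi.sub_apply, PiLp.sub_apply]; ring
  have ij : ∀ᶠ j in atTop, Integrable (fun x => ∑ i, A x (F x) i * moll j P x i) := by
    have hev : ∀ᶠ j in atTop, ∫⁻ x, ‖∑ i, A x (F x) i * moll j P x i - ∑ i, A x (F x) i * P x i‖ₑ < 1 :=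
      t2.eventually_lt_const zero_lt_one
    filter_upwards [hev] with j hj
    have : Integrable (fun x => ∑ i, A x (F x) i * moll j P x i - ∑ i, A x (F x) i * P x i) :=
      ⟨(Q_meas hAm hF (cM j)).sub (Q_meas hAm hF hw.hF.1), hj.trans ENNReal.one_lt_top⟩
    refine (this.add iP).congr (Eventually.of_forall fun x => ?_)
    simp
  have conv := tendsto_integral_of_L1 _ iP.1 ij t2
  obtain ⟨η, hη, hηV⟩ := hK.exists_cthickening_subset_open hV hKV
  apply le_of_tendsto conv
  filter_upwards [eps_tendsto.eventually_lt_const hη] with j hj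
  have hs : tsupport (moll j Φ) ⊆ cthickening η K := by
    apply closure_minimal _ isClosed_cthickening
    intro x hx
    by_contra hc
    exact hx (moll_supp h0 hj.le x hc)
  have := hsub (moll j Φ) (moll_contDiff j hli) (hK.cthickening.of_isClosed_subset (isClosed_tsupport _) hs) (hs.trans hηV)
    (fun x => integral_nonneg fun y => mul_nonneg (rho_nonneg j y) (hpos _))
  rw [hres] at this
  simp_rw [hw.moll_gradient] at this
  exact this

lemma cacc_pt {C₁ w θ g : ℝ} (hC₁ : 1 ≤ C₁) (hw : 0 ≤ w) {G T : ℝ} {a b : ℝ}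
    (ha : C₁⁻¹ * w * G ^ 2 ≤ a) (hb : |b| ≤ C₁ * w * G * T) :
    w * (θ ^ 2 * G ^ 2) ≤ 2 * C₁ * (θ ^ 2 * a + 2 * θ * g * b) + 4 * C₁ ^ 4 * (w * (g ^ 2 * T ^ 2)) := by
  have h0 : 0 < C₁ := by linarith
  have h1 : w * G ^ 2 ≤ C₁ * a := by
    have := mul_le_mul_of_nonneg_left ha h0.le
    rw [← mul_assoc, ← mul_assoc, mul_inv_cancel₀ h0.ne', one_mul] at this
    exact this
  have h2 : |θ * g * b| ≤ |θ| * |g| * (C₁ * w * G * T) := by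
    rw [abs_mul, abs_mul]; gcongr
  have h3 : 4 * C₁ * (|θ| * |g| * (C₁ * w * G * T)) ≤ w * (θ ^ 2 * G ^ 2) + 4 * C₁ ^ 4 * (w * (g ^ 2 * T ^ 2)) := by
    have e : w * (θ ^ 2 * G ^ 2) + 4 * C₁ ^ 4 * (w * (g ^ 2 * T ^ 2)) - 4 * C₁ * (|θ| * |g| * (C₁ * w * G * T)) =
        w * (|θ| * G - 2 * C₁ ^ 2 * |g| * T) ^ 2 := by
      have e1 := sq_abs θ
      have e2 := sq_abs g
      rw [← e1, ← e2]; ring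
    have : 0 ≤ w * (|θ| * G - 2 * C₁ ^ 2 * |g| * T) ^ 2 := by positivity
    linarith
  have h4 : θ ^ 2 * (w * G ^ 2) ≤ θ ^ 2 * (C₁ * a) := by gcongr
  have h5 := neg_abs_le (θ * g * b)
  nlinarith

lemma lint_of_int {a b : Euc n → ℝ} {c : ℝ} (ha : Integrable a) (hb : Integrable b) (ha0 : ∀ x, 0 ≤ a x) (hb0 : ∀ x, 0 ≤ b x)
    (hc : 0 ≤ c) (h : ∫ x, a x ≤ c * ∫ x, b x) : ∫⁻ x, ‖a x‖ₑ ≤ ENNReal.ofReal c * ∫⁻ x, ‖b x‖ₑ := by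
  have e : ∀ {a : Euc n → ℝ}, Integrable a → (∀ x, 0 ≤ a x) → ∫⁻ x, ‖a x‖ₑ = ENNReal.ofReal (∫ x, a x) := by
    intro a ha h0
    rw [ofReal_integral_eq_lintegral_ofReal ha (Eventually.of_forall h0)]
    congr 1; ext1 x; exact Real.enorm_of_nonneg (h0 x)
  rw [e ha ha0, e hb hb0, ← ENNReal.ofReal_mul hc]
  exact ENNReal.ofReal_le_ofReal h

end

section
variable {n : ℕ} {d C₀ C₁ : ℝ} {Γ : Set (Euc n)} {A : Euc n → Euc n →L[ℝ] Euc n}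

lemma weightW_meas : Measurable (weightW n d Γ) :=
  (continuous_infDist_pt Γ).measurable.pow_const _

lemma wsq_lint (Z : Euc n → Euc n) :
    ∫⁻ y, ‖weightW n d Γ y * ‖Z y‖ ^ 2‖ₑ = ∫⁻ y, ‖Z y‖ₑ ^ 2 ∂(measW n d Γ) := by
  rw [lint_m]
  congr 1; ext1 y
  rw [← weight_dE, enorm_mul, Real.enorm_of_nonneg (weightW_nonneg _), enorm_pow, enorm_norm, mul_comm]

lemma wsq_int {Z : Euc n → Euc n} (hZ : AEStronglyMeasurable Z volume)
    (hf : ∫⁻ y, ‖Z y‖ₑ ^ 2 ∂(measW n d Γ) ≠ ⊤) : Integrable (fun y => weightW n d Γ y * ‖Z y‖ ^ 2) := by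
  refine ⟨weightW_meas.aestronglyMeasurable.mul (hZ.norm.pow 2), ?_⟩
  rw [HasFiniteIntegral, wsq_lint]
  exact lt_top_iff_ne_top.2 hf

lemma enorm_add_sq_le' (a b : Euc n) : ‖a + b‖ₑ ^ 2 ≤ 2 * ‖a‖ₑ ^ 2 + 2 * ‖b‖ₑ ^ 2 := by
  have := enorm_sub_sq_le a (-b)
  rwa [sub_neg_eq_add, enorm_neg] at this

lemma lint_add_sq {μ : Measure (Euc n)} {a b : Euc n → Euc n} (ha : AEStronglyMeasurable a μ) :
    ∫⁻ x, ‖a x + b x‖ₑ ^ 2 ∂μ ≤ 2 * (∫⁻ x, ‖a x‖ₑ ^ 2 ∂μ) + 2 * ∫⁻ x, ‖b x‖ₑ ^ 2 ∂μ := by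
  refine (lintegral_mono fun x => enorm_add_sq_le' _ _).trans (le_of_eq ?_)
  rw [lintegral_add_left' ((ha.enorm.pow_const 2).const_mul _), lintegral_const_mul' _ _ (by simp),
    lintegral_const_mul' _ _ (by simp)]

lemma smul_L2 {a : Euc n → ℝ} {Z : Euc n → Euc n} {C : ℝ} (hC : ∀ x, ‖a x‖ ≤ C) {μ : Measure (Euc n)}
    (hZ : ∫⁻ x, ‖Z x‖ₑ ^ 2 ∂μ ≠ ⊤) : ∫⁻ x, ‖a x • Z x‖ₑ ^ 2 ∂μ ≠ ⊤ := by
  refine ne_top_of_le_ne_top (b := ENNReal.ofReal C ^ 2 * ∫⁻ x, ‖Z x‖ₑ ^ 2 ∂μ)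
    (ENNReal.mul_ne_top (by simp) hZ) ?_
  rw [← lintegral_const_mul' _ _ (by simp)]
  refine lintegral_mono fun x => ?_
  rw [enorm_smul, mul_pow]
  gcongr
  rw [← ofReal_norm]
  exact ENNReal.ofReal_le_ofReal (hC x)

lemma smul_L2' {a : Euc n → ℝ} {Z : Euc n → Euc n} {C : ℝ} (hC : ∀ x, ‖Z x‖ ≤ C) {μ : Measure (Euc n)}
    (ha : ∫⁻ x, ‖a x‖ₑ ^ 2 ∂μ ≠ ⊤) : ∫⁻ x, ‖a x • Z x‖ₑ ^ 2 ∂μ ≠ ⊤ := by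
  refine ne_top_of_le_ne_top (b := ENNReal.ofReal C ^ 2 * ∫⁻ x, ‖a x‖ₑ ^ 2 ∂μ)
    (ENNReal.mul_ne_top (by simp) ha) ?_
  rw [← lintegral_const_mul' _ _ (by simp)]
  refine lintegral_mono fun x => ?_
  rw [enorm_smul, mul_pow, mul_comm]
  gcongr
  rw [← ofReal_norm]
  exact ENNReal.ofReal_le_ofReal (hC x)

lemma smul_L2_real {a g : Euc n → ℝ} {C : ℝ} (hC : ∀ x, ‖a x‖ ≤ C) {μ : Measure (Euc n)}
    (hg : ∫⁻ x, ‖g x‖ₑ ^ 2 ∂μ ≠ ⊤) : ∫⁻ x, ‖a x * g x‖ₑ ^ 2 ∂μ ≠ ⊤ := by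
  refine ne_top_of_le_ne_top (b := ENNReal.ofReal C ^ 2 * ∫⁻ x, ‖g x‖ₑ ^ 2 ∂μ)
    (ENNReal.mul_ne_top (by simp) hg) ?_
  rw [← lintegral_const_mul' _ _ (by simp)]
  refine lintegral_mono fun x => ?_
  rw [enorm_mul, mul_pow]
  gcongr
  rw [← ofReal_norm]
  exact ENNReal.ofReal_le_ofReal (hC x)

lemma gk_le (k : ℝ) (hk : 0 ≤ k) (t : ℝ) : ‖max (t - k) 0‖ₑ ≤ ‖t‖ₑ := by
  rw [← ofReal_norm, ← ofReal_norm]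
  apply ENNReal.ofReal_le_ofReal
  rw [Real.norm_of_nonneg (le_max_right _ _), Real.norm_eq_abs]
  exact max_le (by linarith [le_abs_self t]) (abs_nonneg _)

lemma cacc_fk (n : ℕ) (hn : 2 ≤ n) (d C₀ C₁ : ℝ) (hC₀ : 1 ≤ C₀) (hC₁ : 1 ≤ C₁) (hd : 0 < d) (hdn : d < (n : ℝ) - 1) :
    ∃ C : ℝ≥0∞, C ≠ ⊤ ∧ ∀ Γ : Set (Euc n), Γ.Nonempty → IsClosed Γ → AhlforsRegular n d C₀ Γ →
      ∀ A : Euc n → Euc n →L[ℝ] Euc n, AEStronglyMeasurable A volume → EllipticOn n d Γ A C₁ →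
      ∀ x r u f F, Data n d Γ A x r u f F → ∀ k : ℝ, 0 ≤ k → ∀ θ : Euc n → ℝ, ContDiff ℝ (⊤ : ℕ∞) θ →
      HasCompactSupport θ → tsupport θ ⊆ ball x (7 * r / 4) \ Γ →
      ∫⁻ y, ‖θ y * max (f y - k) 0‖ₑ ^ 2 ∂(measW n d Γ) ≤ C * (volume ({y | k < f y} ∩ tsupport θ) ^ (1 / (n : ℝ))) ^ 2 *
        ∫⁻ y, ‖max (f y - k) 0 • gradient θ y‖ₑ ^ 2 ∂(measW n d Γ) := by
  obtain ⟨C, hC, hfk⟩ := fk n hn d C₀ hC₀ hd hdn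
  refine ⟨C * (2 * ENNReal.ofReal (4 * C₁ ^ 4) + 2), ENNReal.mul_ne_top hC (by finiteness), ?_⟩
  intro Γ hne hcl hA A hAm hE x r u f F D k hk θ hθ hc hs
  have hsΓ : tsupport θ ⊆ Γᶜ := hs.trans fun y hy => hy.2
  obtain ⟨M, hM, hMb⟩ := dE_bdd (d := d) hne hcl hc hsΓ ((n : ℝ) - 1)
  obtain ⟨c1, _, hc1⟩ := cs_bdd hθ.continuous hc
  obtain ⟨c2, _, hc2⟩ := cs_bdd (cont_grad hθ) (cs_grad hc)
  have hg := D.wg.pos hk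
  set g : Euc n → ℝ := fun y => max (f y - k) 0 with hgdef
  set G := tg k f F with hGdef
  have z1 : ∀ y ∉ tsupport θ, θ y = 0 := fun y hy => image_eq_zero_of_notMem_tsupport hy
  have z2 : ∀ y ∉ tsupport θ, gradient θ y = 0 := fun y hy =>
    image_eq_zero_of_notMem_tsupport fun h => hy (supp_grad_sub θ h)
  have g2 : ∫⁻ y, ‖g y‖ₑ ^ 2 ≠ ⊤ := ne_top_of_le_ne_top D.f2 (lintegral_mono fun y => by
    gcongr; exact gk_le k hk _)
  have G2 : ∫⁻ y, ‖G y‖ₑ ^ 2 ≠ ⊤ := ne_top_of_le_ne_top D.F2 (lintegral_mono fun y => by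
    simp only; gcongr; exact enorm_le_iff_norm_le.2 (tg_norm_le _ _ _ _))
  have gm := hg.hf.1
  have Gm := hg.hF.1
  have m1 : AEStronglyMeasurable (fun y => θ y • G y) volume := hθ.continuous.aestronglyMeasurable.smul Gm
  have m2 : AEStronglyMeasurable (fun y => g y • gradient θ y) volume := gm.smul (cont_grad hθ).aestronglyMeasurable
  have a1 : ∫⁻ y, ‖θ y • G y‖ₑ ^ 2 ≠ ⊤ := smul_L2 hc1 G2
  have a2 : ∫⁻ y, ‖g y • gradient θ y‖ₑ ^ 2 ≠ ⊤ := smul_L2' hc2 g2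
  have b1 : ∫⁻ y, ‖θ y • G y‖ₑ ^ 2 ∂(measW n d Γ) ≠ ⊤ := ne_top_of_le_ne_top (ENNReal.mul_ne_top hM a1)
    (lint_le_of_supp hMb hM (fun y hy => by rw [z1 y hy]; simp))
  have b2 : ∫⁻ y, ‖g y • gradient θ y‖ₑ ^ 2 ∂(measW n d Γ) ≠ ⊤ := ne_top_of_le_ne_top (ENNReal.mul_ne_top hM a2)
    (lint_le_of_supp hMb hM (fun y hy => by rw [z2 y hy]; simp))
  have cc : ∫⁻ y, ‖θ y • G y‖ₑ ^ 2 ∂(measW n d Γ) ≤ ENNReal.ofReal (4 * C₁ ^ 4) *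
      ∫⁻ y, ‖g y • gradient θ y‖ₑ ^ 2 ∂(measW n d Γ) := by
    have hχ : ContDiff ℝ (⊤ : ℕ∞) (fun y => θ y * θ y) := hθ.mul hθ
    have hχc : HasCompactSupport (fun y => θ y * θ y) := hc.mul_right
    have hw := hg.mul hχ hχc (subset_univ _)
    have eP : ∀ y, (θ y * θ y) • G y + g y • gradient (fun y => θ y * θ y) y =
        θ y • (θ y • G y + (2 : ℝ) • (g y • gradient θ y)) := by
      intro y
      rw [grad_mul (cd_diff hθ y) (cd_diff hθ y)]
      module
    have hP2 : ∫⁻ y, ‖(θ y * θ y) • G y + g y • gradient (fun y => θ y * θ y) y‖ₑ ^ 2 ≠ ⊤ := by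
      simp_rw [eP]
      refine smul_L2 hc1 (ne_top_of_le_ne_top ?_ (lint_add_sq m1))
      have := smul_L2 (a := fun _ => (2 : ℝ)) (C := 2) (by simp) a2
      finiteness
    obtain ⟨i1, i2⟩ := test_sobolev hne hcl hA hC₀ hdn hC₁ hAm hE (isOpen_ball.sdiff hcl) (fun y hy => hy.2) D.sub
      D.wg.hF.1 D.Fm hw hc hs (fun y hy => by rw [z1 y hy]; simp) (fun y hy => by rw [eP, z1 y hy]; simp)
      (fun y => mul_nonneg (mul_self_nonneg _) (le_max_right _ _)) hP2
    have I1 := wsq_int m1 b1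
    have I2 := wsq_int m2 b2
    have key := lint_of_int (c := 4 * C₁ ^ 4) I1 I2 (fun y => mul_nonneg (weightW_nonneg _) (sq_nonneg _))
      (fun y => mul_nonneg (weightW_nonneg _) (sq_nonneg _)) (by positivity) ?_
    · rwa [wsq_lint, wsq_lint] at key
    · have : ∫ y, weightW n d Γ y * ‖θ y • G y‖ ^ 2 ≤ ∫ y, (2 * C₁ * (∑ i, A y (F y) i *
          ((θ y * θ y) • G y + g y • gradient (fun y => θ y * θ y) y) i) +
          4 * C₁ ^ 4 * (weightW n d Γ y * ‖g y • gradient θ y‖ ^ 2)) := by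
        refine integral_mono_ae I1 ((i1.const_mul _).add (I2.const_mul _)) ?_
        filter_upwards [ae_notMem hne hcl hA hC₀ hdn] with y hy
        have e := cacc_pt (θ := θ y) (g := g y) hC₁ (weightW_nonneg (n := n) (d := d) (Γ := Γ) y)
          ((hE y hy).2 (G y)) ((hE y hy).1 (G y) (gradient θ y))
        have e2 : ∑ i, A y (F y) i * ((θ y * θ y) • G y + g y • gradient (fun y => θ y * θ y) y) i =
            θ y ^ 2 * ∑ i, A y (G y) i * G y i + 2 * θ y * g y * ∑ i, A y (G y) i * gradient θ y i := by
          rw [eP]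
          by_cases hf : k < f y
          · have : G y = F y := by simp [hGdef, tg, hf]
            rw [this, Finset.mul_sum, Finset.mul_sum, ← Finset.sum_add_distrib]
            apply Finset.sum_congr rfl
            intro i _
            simp only [PiLp.add_apply, PiLp.smul_apply, smul_eq_mul]; ring
          · have e1 : G y = 0 := by simp [hGdef, tg, hf]
            have e2 : g y = 0 := by simp only [hgdef]; exact max_eq_right (by linarith)
            simp [e1, e2]
        rw [e2]
        simp only [norm_smul, mul_pow, Real.norm_eq_abs, sq_abs]
        exact e
      rw [integral_add (i1.const_mul _) (I2.const_mul _), integral_const_mul, integral_const_mul] at this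
      have : 2 * C₁ * ∫ y, (∑ i, A y (F y) i *
          ((θ y * θ y) • G y + g y • gradient (fun y => θ y * θ y) y) i) ≤ 0 :=
        mul_nonpos_of_nonneg_of_nonpos (by linarith) i2
      linarith
  have hh := hg.mul hθ hc (subset_univ _)
  have hvol : volume ({y | k < f y} ∩ tsupport θ) ≠ ⊤ :=
    ne_top_of_le_ne_top hc.measure_ne_top (measure_mono inter_subset_right)
  have key := hfk Γ hne hcl hA _ _ hh (tsupport θ) hc hsΓ (fun y hy => by rw [z1 y hy]; simp)
    (fun y hy => by rw [z1 y hy, z2 y hy]; simp) (smul_L2_real hc1 g2)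
    (ne_top_of_le_ne_top (by finiteness) (lint_add_sq m1)) (toMeasurable volume ({y | k < f y} ∩ tsupport θ))
    (measurableSet_toMeasurable _ _) (by rwa [measure_toMeasurable]) (Eventually.of_forall fun y hy => by
      by_contra h
      apply hy (subset_toMeasurable _ _ ⟨?_, ?_⟩)
      · by_contra h2
        apply h
        rw [show g y = 0 from max_eq_right (by linarith [not_lt.1 (show ¬ k < f y from h2)]), mul_zero]
      · by_contra h2
        apply h
        rw [z1 y h2, zero_mul])
  rw [measure_toMeasurable] at key
  refine key.trans ?_
  have fin : ∫⁻ y, ‖θ y • G y + g y • gradient θ y‖ₑ ^ 2 ∂(measW n d Γ) ≤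
      (2 * ENNReal.ofReal (4 * C₁ ^ 4) + 2) * ∫⁻ y, ‖g y • gradient θ y‖ₑ ^ 2 ∂(measW n d Γ) := by
    refine (lint_add_sq (m1.mono_ac m_ac)).trans ?_
    rw [add_mul, mul_assoc]
    gcongr
  refine (mul_le_mul_right fin _).trans (le_of_eq ?_)
  ring

end

section
variable {n : ℕ} {d C₀ C₁ : ℝ} {Γ : Set (Euc n)} {A : Euc n → Euc n →L[ℝ] Euc n}

lemma Data.f2m (hne : Γ.Nonempty) (hcl : IsClosed Γ) (hA : AhlforsRegular n d C₀ Γ) (hC₀ : 1 ≤ C₀)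
    (hdn : d < (n : ℝ) - 1) {x : Euc n} {r : ℝ} {u f : Euc n → ℝ} {F : Euc n → Euc n} (hx : x ∈ Γ) (hr : 0 < r)
    (D : Data n d Γ A x r u f F) : ∫⁻ y, ‖f y‖ₑ ^ 2 ∂(measW n d Γ) ≠ ⊤ := by
  rw [lint_m]
  refine ne_top_of_le_ne_top ?_ (lint_le_dE hne hcl hA hC₀ hdn hx (R := 2 * r) (s := d + 2) (by linarith) (by linarith)
    (fun y hy => by rw [D.f0 y hy]; simp))
  refine ENNReal.mul_ne_top ENNReal.ofReal_ne_top ?_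
  convert D.fH using 1
  congr 1; ext1 y
  rw [mul_assoc]
  congr 1
  unfold dE
  rw [← ENNReal.ofReal_mul (by positivity [infDist_nonneg (x := y) (s := Γ)])]
  congr 1
  rcases eq_or_lt_of_le (infDist_nonneg (x := y) (s := Γ)) with h | h
  · rw [← h, Real.zero_rpow (by linarith), Real.zero_rpow (by linarith), zero_mul, Real.zero_rpow (by linarith)]
  · rw [← Real.rpow_add h]; congr 1; ring

lemma ann_cutoff (x : Euc n) {s t : ℝ} (hst : s < t) : ∃ η : Euc n → ℝ, ContDiff ℝ (⊤ : ℕ∞) η ∧ (∀ y, η y ∈ Icc (0 : ℝ) 1) ∧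
    (∀ y, ‖gradient η y‖ ≤ 4 / (t - s)) ∧ tsupport η ⊆ ball x t ∧ (∀ y ∈ ball x s, η y = 1) := by
  have h0 : 0 < t - s := sub_pos.2 hst
  have hL : 0 < 4 / (t - s) := by positivity
  obtain ⟨η, h1, h2, h3, h4, h5⟩ := exists_lip_cutoff (fun y => 4 / (t - s) * (s + 3 * (t - s) / 8 - ‖y - x‖)) hL
    (half_pos one_pos) (fun a b => by
      rw [← mul_sub, abs_mul, abs_of_pos hL]
      gcongr
      have := abs_norm_sub_norm_le (b - x) (a - x)
      rw [show s + 3 * (t - s) / 8 - ‖a - x‖ - (s + 3 * (t - s) / 8 - ‖b - x‖) = ‖b - x‖ - ‖a - x‖ by ring]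
      refine this.trans (le_of_eq ?_)
      rw [sub_sub_sub_cancel_right, norm_sub_rev])
  refine ⟨η, h1, h2, h3, ?_, ?_⟩
  · refine (closure_minimal (t := closedBall x ((s + t) / 2)) ?_ isClosed_closedBall).trans (closedBall_subset_ball (by linarith))
    intro y hy
    by_contra hc
    apply hy (h4 y ?_)
    rw [mem_closedBall, dist_eq_norm, not_le] at hc
    rw [div_mul_eq_mul_div, div_le_iff₀ h0]
    linarith
  · intro y hy
    rw [mem_ball, dist_eq_norm] at hy
    apply h5
    rw [div_mul_eq_mul_div, le_div_iff₀ h0]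
    linarith

lemma cacc_ball (n : ℕ) (hn : 2 ≤ n) (d C₀ C₁ : ℝ) (hC₀ : 1 ≤ C₀) (hC₁ : 1 ≤ C₁) (hd : 0 < d) (hdn : d < (n : ℝ) - 1) :
    ∃ C : ℝ≥0∞, C ≠ ⊤ ∧ ∀ Γ : Set (Euc n), Γ.Nonempty → IsClosed Γ → AhlforsRegular n d C₀ Γ →
      ∀ A : Euc n → Euc n →L[ℝ] Euc n, AEStronglyMeasurable A volume → EllipticOn n d Γ A C₁ →
      ∀ x ∈ Γ, ∀ r : ℝ, 0 < r → ∀ u f F, Data n d Γ A x r u f F → ∀ k : ℝ, 0 ≤ k → ∀ s t : ℝ, s < t → t ≤ 7 * r / 4 →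
      ∫⁻ y in ball x s, ‖max (f y - k) 0‖ₑ ^ 2 ∂(measW n d Γ) ≤
        C * (volume ({y | k < f y} ∩ ball x t) ^ (1 / (n : ℝ))) ^ 2 *
        (ENNReal.ofReal (4 / (t - s)) ^ 2 * ∫⁻ y in ball x t, ‖max (f y - k) 0‖ₑ ^ 2 ∂(measW n d Γ)) := by
  obtain ⟨C, hC, hfk⟩ := cacc_fk n hn d C₀ C₁ hC₀ hC₁ hd hdn
  refine ⟨C * 2, ENNReal.mul_ne_top hC (by simp), ?_⟩
  intro Γ hne hcl hA A hAm hE x hx r hr u f F D k hk s t hst ht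
  obtain ⟨η, h1, h2, h3, h4, h5⟩ := ann_cutoff x hst
  have hc : HasCompactSupport η := (isCompact_closedBall x t).of_isClosed_subset (isClosed_tsupport _)
    (h4.trans ball_subset_closedBall)
  choose ψ p1 p2 p3 p4 p5 p6 p7 using fun j => exists_psi Γ (eps_pos j)
  set V := volume ({y | k < f y} ∩ ball x t)
  have hV : V ≠ ⊤ := ne_top_of_le_ne_top measure_ball_lt_top.ne (measure_mono inter_subset_right)
  have fm : AEStronglyMeasurable f (measW n d Γ) := D.wg.hf.1.mono_ac m_ac
  have gm : AEStronglyMeasurable (fun y => max (f y - k) 0) (measW n d Γ) := (D.wg.pos hk).hf.1.mono_ac m_ac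
  have hae := ae_notMem hne hcl hA hC₀ hdn
  have haem : ∀ᵐ y ∂(measW n d Γ), y ∉ Γ := m_ac.ae_le hae
  have f2m := D.f2m hne hcl hA hC₀ hdn hx hr
  have ev : ∀ y ∉ Γ, ∀ᶠ j in atTop, 4 * eps j < infDist y Γ := by
    intro y hy
    have : Tendsto (fun j => 4 * eps j) atTop (𝓝 0) := by simpa using eps_tendsto.const_mul 4
    exact this.eventually_lt_const (infDist_pos' hne hcl hy)
  -- error term
  set R : ℕ → ℝ≥0∞ := fun j => ∫⁻ y, {y | infDist y Γ ≤ 4 * eps j}.indicator (fun y => ‖f y‖ₑ ^ 2 * dE d Γ ((n : ℝ) + 1) y) y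
  have hR : Tendsto R atTop (𝓝 0) := by
    have := tendsto_lintegral_of_dominated_convergence' (μ := volume)
      (F := fun j y => {y | infDist y Γ ≤ 4 * eps j}.indicator (fun y => ‖f y‖ₑ ^ 2 * dE d Γ ((n : ℝ) + 1) y) y) (f := fun _ => 0)
      (fun y => ‖f y‖ₑ ^ 2 * dE d Γ ((n : ℝ) + 1) y)
      (fun j => ((D.wg.hf.1.enorm.pow_const 2).mul (dE_meas _).aemeasurable).indicator
        (isClosed_le (continuous_infDist_pt Γ) continuous_const).measurableSet)
      (fun j => Eventually.of_forall fun y => indicator_le_self _ _ _) D.fH (by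
        filter_upwards [hae] with y hy
        apply tendsto_const_nhds.congr'
        filter_upwards [ev y hy] with j hj
        rw [indicator_of_notMem]
        exact not_le.2 hj)
    simpa using this
  have lhs : Tendsto (fun j => ∫⁻ y in ball x s, ‖ψ j y * max (f y - k) 0‖ₑ ^ 2 ∂(measW n d Γ)) atTop
      (𝓝 (∫⁻ y in ball x s, ‖max (f y - k) 0‖ₑ ^ 2 ∂(measW n d Γ))) := by
    apply tendsto_lintegral_of_dominated_convergence' (fun y => ‖f y‖ₑ ^ 2)
    · intro j
      exact (((p1 j).continuous.aestronglyMeasurable.mul gm).enorm.pow_const 2).restrict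
    · intro j
      refine Eventually.of_forall fun y => ?_
      simp only
      rw [enorm_mul]
      gcongr
      calc ‖ψ j y‖ₑ * ‖max (f y - k) 0‖ₑ ≤ 1 * ‖f y‖ₑ := by
            gcongr
            · rw [Real.enorm_of_nonneg (p2 j y).1]; exact ENNReal.ofReal_le_one.2 (p2 j y).2
            · exact gk_le k hk _
        _ = _ := one_mul _
    · exact ne_top_of_le_ne_top f2m (setLIntegral_le_lintegral _ _)
    · filter_upwards [ae_restrict_of_ae haem] with y hy
      apply tendsto_const_nhds.congr'
      filter_upwards [ev y hy] with j hj
      rw [p5 j y hj.le, one_mul]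
  set Y := ∫⁻ y in ball x t, ‖max (f y - k) 0‖ₑ ^ 2 ∂(measW n d Γ) with hY
  have rhs : Tendsto (fun j => C * (V ^ (1 / (n : ℝ))) ^ 2 * (2 * (16 * R j) + 2 * (ENNReal.ofReal (4 / (t - s)) ^ 2 * Y))) atTop
      (𝓝 (C * (V ^ (1 / (n : ℝ))) ^ 2 * (2 * (16 * 0) + 2 * (ENNReal.ofReal (4 / (t - s)) ^ 2 * Y)))) := by
    apply ENNReal.Tendsto.const_mul _ (Or.inr _)
    · exact (ENNReal.Tendsto.const_mul (ENNReal.Tendsto.const_mul hR (Or.inr (by simp))) (Or.inr (by simp))).add tendsto_const_nhds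
    · exact ENNReal.mul_ne_top hC (ENNReal.pow_ne_top (ENNReal.rpow_ne_top_of_nonneg (by positivity) hV))
  refine (le_of_tendsto_of_tendsto' lhs rhs fun j => ?_).trans (le_of_eq (by ring))
  have hθs : tsupport (fun y => η y * ψ j y) ⊆ ball x t \ Γ := fun y hy =>
    ⟨h4 (tsupport_mul_subset_left hy), tsupport_psi (eps_pos j) (p4 j) (tsupport_mul_subset_right hy)⟩
  have key := hfk Γ hne hcl hA A hAm hE x r u f F D k hk (fun y => η y * ψ j y) (h1.mul (p1 j)) hc.mul_right
    (hθs.trans (sdiff_subset_sdiff_left (ball_subset_ball ht)))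
  refine le_trans ?_ (key.trans ?_)
  · rw [← lintegral_indicator measurableSet_ball]
    refine lintegral_mono fun y => ?_
    by_cases hy : y ∈ ball x s
    · rw [indicator_of_mem hy, h5 y hy, one_mul]
    · rw [indicator_of_notMem hy]; exact zero_le
  · gcongr
    · exact measure_mono (inter_subset_inter_right _ (hθs.trans sdiff_subset))
    have e : ∀ y, max (f y - k) 0 • gradient (fun y => η y * ψ j y) y =
        max (f y - k) 0 • η y • gradient (ψ j) y + max (f y - k) 0 • ψ j y • gradient η y := by
      intro y
      rw [grad_mul (cd_diff h1 y) (cd_diff (p1 j) y), smul_add]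
    simp_rw [e]
    refine (lint_add_sq (a := fun y => max (f y - k) 0 • η y • gradient (ψ j) y) (gm.smul (h1.continuous.smul (cont_grad (p1 j))).aestronglyMeasurable)).trans ?_
    gcongr
    · rw [lint_m, ← lintegral_const_mul' _ _ (by simp)]
      apply lintegral_mono_ae
      filter_upwards [hae] with y hy
      have hp := infDist_pos' hne hcl hy
      by_cases hd : infDist y Γ ≤ 4 * eps j
      · rw [indicator_of_mem (by exact hd)]
        have q1 : ‖max (f y - k) 0 • η y • gradient (ψ j) y‖ₑ ≤ ‖f y‖ₑ * ENNReal.ofReal (eps j)⁻¹ := by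
          rw [enorm_smul]
          gcongr
          · exact gk_le k hk _
          · rw [← ofReal_norm]
            apply ENNReal.ofReal_le_ofReal
            rw [norm_smul, Real.norm_of_nonneg (h2 y).1]
            exact (mul_le_of_le_one_left (norm_nonneg _) (h2 y).2).trans (p3 j y)
        have q2 : ENNReal.ofReal (eps j)⁻¹ ^ 2 * dE d Γ ((n : ℝ) - 1) y ≤ 16 * dE d Γ ((n : ℝ) + 1) y := by
          unfold dE
          rw [← ENNReal.ofReal_pow (inv_pos.2 (eps_pos j)).le, ← ENNReal.ofReal_mul (by positivity),
            show (16 : ℝ≥0∞) = ENNReal.ofReal 16 by simp, ← ENNReal.ofReal_mul (by norm_num)]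
          apply ENNReal.ofReal_le_ofReal
          rw [show d - ((n : ℝ) - 1) = (d - ((n : ℝ) + 1)) + (2 : ℕ) by push_cast; ring, Real.rpow_add hp, Real.rpow_natCast]
          have : (eps j)⁻¹ ^ 2 * infDist y Γ ^ 2 ≤ 16 := by
            rw [← mul_pow, show (16 : ℝ) = 4 ^ 2 by norm_num]
            have := inv_pos.2 (eps_pos j)
            gcongr
            rw [inv_mul_le_iff₀ (eps_pos j)]; linarith
          calc _ = ((eps j)⁻¹ ^ 2 * infDist y Γ ^ 2) * infDist y Γ ^ (d - ((n : ℝ) + 1)) := by ring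
            _ ≤ _ := by gcongr
        calc _ ≤ (‖f y‖ₑ * ENNReal.ofReal (eps j)⁻¹) ^ 2 * dE d Γ ((n : ℝ) - 1) y := by gcongr
          _ = ‖f y‖ₑ ^ 2 * (ENNReal.ofReal (eps j)⁻¹ ^ 2 * dE d Γ ((n : ℝ) - 1) y) := by ring
          _ ≤ ‖f y‖ₑ ^ 2 * (16 * dE d Γ ((n : ℝ) + 1) y) := by gcongr
          _ = _ := by ring
      · rw [p7 j y (not_le.1 hd)]; simp
    · rw [hY, ← lintegral_const_mul' _ _ (by finiteness), ← lintegral_indicator measurableSet_ball]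
      refine lintegral_mono fun y => ?_
      by_cases hy : y ∈ ball x t
      · rw [indicator_of_mem hy, enorm_smul, mul_pow, mul_comm]
        gcongr
        rw [← ofReal_norm]
        apply ENNReal.ofReal_le_ofReal
        rw [norm_smul, Real.norm_of_nonneg (p2 j y).1]
        exact (mul_le_of_le_one_left (norm_nonneg _) (p2 j y).2).trans (h3 y)
      · rw [image_eq_zero_of_notMem_tsupport fun h => hy (h4 (supp_grad_sub η h))]
        simp

end

section
variable {n : ℕ} {d C₀ C₁ : ℝ} {Γ : Set (Euc n)} {A : Euc n → Euc n →L[ℝ] Euc n}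

/-- energy of the truncation -/
def YY (n : ℕ) (d : ℝ) (Γ : Set (Euc n)) (f : Euc n → ℝ) (x : Euc n) (k s : ℝ) : ℝ≥0∞ :=
  ∫⁻ y in ball x s, ‖max (f y - k) 0‖ₑ ^ 2 ∂(measW n d Γ)

lemma YY_mono {f : Euc n → ℝ} {x : Euc n} {h k s t : ℝ} (hhk : h ≤ k) (hst : s ≤ t) :
    YY n d Γ f x k s ≤ YY n d Γ f x h t := by
  unfold YY
  refine (lintegral_mono_set (ball_subset_ball hst)).trans (lintegral_mono fun y => ?_)
  simp only
  gcongr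
  rw [Real.enorm_of_nonneg (le_max_right _ _), Real.enorm_of_nonneg (le_max_right _ _)]
  exact ENNReal.ofReal_le_ofReal (max_le_max (by linarith) le_rfl)

lemma lvl_vol (hne : Γ.Nonempty) (hcl : IsClosed Γ) (hA : AhlforsRegular n d C₀ Γ) (hC₀ : 1 ≤ C₀)
    (hdn : d < (n : ℝ) - 1) {x : Euc n} {r : ℝ} {f : Euc n → ℝ} (hx : x ∈ Γ) (hr : 0 < r)
    (hf : AEStronglyMeasurable f volume) {h k t : ℝ} (hhk : h < k) (ht : t ≤ 2 * r) :
    volume ({y | k < f y} ∩ ball x t) ≤ ENNReal.ofReal ((2 * r) ^ ((n : ℝ) - 1 - d) * ((k - h)⁻¹) ^ 2) * YY n d Γ f x h t := by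
  have hp : 0 < k - h := sub_pos.2 hhk
  have e1 := mul_meas_ge_le_lintegral₀ (μ := volume.restrict (ball x t)) (f := fun y => ‖max (f y - h) 0‖ₑ ^ 2)
    ((((hf.sub aestronglyMeasurable_const).sup aestronglyMeasurable_const).enorm.pow_const 2).restrict)
    (ENNReal.ofReal (k - h) ^ 2)
  rw [Measure.restrict_apply' measurableSet_ball] at e1
  have e2 : volume ({y | k < f y} ∩ ball x t) ≤ volume ({y | ENNReal.ofReal (k - h) ^ 2 ≤ ‖max (f y - h) 0‖ₑ ^ 2} ∩ ball x t) := by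
    apply measure_mono
    rintro y ⟨hy, hb⟩
    refine ⟨?_, hb⟩
    have hy' : k < f y := hy
    show ENNReal.ofReal (k - h) ^ 2 ≤ ‖max (f y - h) 0‖ₑ ^ 2
    gcongr
    rw [Real.enorm_of_nonneg (le_max_right _ _)]
    exact ENNReal.ofReal_le_ofReal ((by linarith : k - h ≤ f y - h).trans (le_max_left _ _))
  have e3 : ∫⁻ y in ball x t, ‖max (f y - h) 0‖ₑ ^ 2 ≤ ENNReal.ofReal ((2 * r) ^ ((n : ℝ) - 1 - d)) * YY n d Γ f x h t := by
    unfold YY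
    rw [← lintegral_indicator measurableSet_ball, ← lintegral_indicator measurableSet_ball, lint_m]
    exact lint_le_dE hne hcl hA hC₀ hdn hx (by linarith) hdn.le
      (fun y hy => indicator_of_notMem (fun h => hy (ball_subset_ball ht h)) _)
  have e4 : ENNReal.ofReal (((k - h)⁻¹) ^ 2) * ENNReal.ofReal (k - h) ^ 2 = 1 := by
    rw [← ENNReal.ofReal_pow hp.le, ← ENNReal.ofReal_mul (by positivity), ← mul_pow, inv_mul_cancel₀ hp.ne']; simp
  calc _ ≤ _ := e2
    _ = ENNReal.ofReal (((k - h)⁻¹) ^ 2) * (ENNReal.ofReal (k - h) ^ 2 * _) := by rw [← mul_assoc, e4, one_mul]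
    _ ≤ ENNReal.ofReal (((k - h)⁻¹) ^ 2) * (ENNReal.ofReal ((2 * r) ^ ((n : ℝ) - 1 - d)) * YY n d Γ f x h t) := by
      exact mul_le_mul_right (e1.trans e3) _
    _ = _ := by rw [ENNReal.ofReal_mul (by positivity)]; ring

lemma Data.YY_fin (hne : Γ.Nonempty) (hcl : IsClosed Γ) (hA : AhlforsRegular n d C₀ Γ) (hC₀ : 1 ≤ C₀)
    (hdn : d < (n : ℝ) - 1) {x : Euc n} {r : ℝ} {u f : Euc n → ℝ} {F : Euc n → Euc n} (hx : x ∈ Γ) (hr : 0 < r)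
    (D : Data n d Γ A x r u f F) {k s : ℝ} (hk : 0 ≤ k) : YY n d Γ f x k s ≠ ⊤ := by
  refine ne_top_of_le_ne_top (D.f2m hne hcl hA hC₀ hdn hx hr) ((setLIntegral_le_lintegral _ _).trans (lintegral_mono fun y => ?_))
  simp only
  gcongr
  exact gk_le k hk _

lemma dg_step (n : ℕ) (hn : 2 ≤ n) (d C₀ C₁ : ℝ) (hC₀ : 1 ≤ C₀) (hC₁ : 1 ≤ C₁) (hd : 0 < d) (hdn : d < (n : ℝ) - 1) :
    ∃ c : ℝ, 0 < c ∧ ∀ Γ : Set (Euc n), Γ.Nonempty → IsClosed Γ → AhlforsRegular n d C₀ Γ →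
      ∀ A : Euc n → Euc n →L[ℝ] Euc n, AEStronglyMeasurable A volume → EllipticOn n d Γ A C₁ →
      ∀ x ∈ Γ, ∀ r : ℝ, 0 < r → ∀ u f F, Data n d Γ A x r u f F → ∀ h k : ℝ, 0 ≤ h → h < k → ∀ s t : ℝ, s < t → t ≤ 7 * r / 4 →
      (YY n d Γ f x k s).toReal ≤ c * ((t - s)⁻¹) ^ 2 *
        ((2 * r) ^ ((n : ℝ) - 1 - d) * ((k - h)⁻¹) ^ 2 * (YY n d Γ f x h t).toReal) ^ (2 / (n : ℝ)) *
        (YY n d Γ f x h t).toReal := by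
  obtain ⟨C, hC, hfk⟩ := cacc_ball n hn d C₀ C₁ hC₀ hC₁ hd hdn
  refine ⟨C.toReal * 16 + 1, by positivity, ?_⟩
  intro Γ hne hcl hA A hAm hE x hx r hr u f F D h k hh hhk s t hst ht
  have key := hfk Γ hne hcl hA A hAm hE x hx r hr u f F D k (hh.trans hhk.le) s t hst ht
  have fin := D.YY_fin hne hcl hA hC₀ hdn hx hr (s := t) hh
  have hts : 0 < t - s := sub_pos.2 hst
  set y := (YY n d Γ f x h t).toReal with hy
  have hY : YY n d Γ f x h t = ENNReal.ofReal y := (ENNReal.ofReal_toReal fin).symm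
  have hy0 : 0 ≤ y := ENNReal.toReal_nonneg
  have hv := lvl_vol hne hcl hA hC₀ hdn hx hr D.wg.hf.1 hhk (by linarith : t ≤ 2 * r)
  rw [hY, ← ENNReal.ofReal_mul (by positivity)] at hv
  set E := (2 * r) ^ ((n : ℝ) - 1 - d) * ((k - h)⁻¹) ^ 2 * y with hEd
  have hE0 : 0 ≤ E := by positivity
  have e1 : YY n d Γ f x k s ≤ ENNReal.ofReal (C.toReal * (E ^ (1 / (n : ℝ))) ^ 2 * ((4 / (t - s)) ^ 2 * y)) := by
    rw [ENNReal.ofReal_mul (by positivity), ENNReal.ofReal_mul (by positivity), ENNReal.ofReal_mul (by positivity),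
      ENNReal.ofReal_toReal hC, ← hY, ENNReal.ofReal_pow (by positivity), ENNReal.ofReal_pow (by positivity),
      ← ENNReal.ofReal_rpow_of_nonneg hE0 (by positivity)]
    refine key.trans ?_
    gcongr
    exact YY_mono hhk.le le_rfl
  have e2 := ENNReal.toReal_le_of_le_ofReal (by positivity) e1
  refine e2.trans ?_
  have e3 : (E ^ (1 / (n : ℝ))) ^ 2 = E ^ (2 / (n : ℝ)) := by
    rw [← Real.rpow_natCast, ← Real.rpow_mul hE0]; congr 1; push_cast; ring
  rw [e3]
  calc _ = (C.toReal * 16) * (((t - s)⁻¹) ^ 2 * E ^ (2 / (n : ℝ)) * y) := by rw [div_eq_mul_inv]; ring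
    _ ≤ (C.toReal * 16 + 1) * (((t - s)⁻¹) ^ 2 * E ^ (2 / (n : ℝ)) * y) := by gcongr; linarith
    _ = _ := by ring

lemma dg_iter {y : ℕ → ℝ} {K α : ℝ} (hα : 0 < α) (hK : 0 ≤ K) (hy : ∀ i, 0 ≤ y i)
    (step : ∀ i, y (i + 1) ≤ K * ((4 : ℝ) ^ (1 + α)) ^ (i + 1) * (y i) ^ α * y i)
    (h0 : K * (4 : ℝ) ^ (1 + α) * (y 0) ^ α ≤ (4 : ℝ) ^ (-(1 + α) / α)) : Tendsto y atTop (𝓝 0) := by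
  set l : ℝ := (4 : ℝ) ^ (-(1 + α) / α) with hl
  set B : ℝ := (4 : ℝ) ^ (1 + α) with hB
  have hl0 : 0 < l := by positivity
  have hl1 : l < 1 := Real.rpow_lt_one_of_one_lt_of_neg (by norm_num) (div_neg_of_neg_of_pos (by linarith) hα)
  have hlB : B * l ^ α = 1 := by
    rw [hl, hB, ← Real.rpow_mul (by norm_num), ← Real.rpow_add (by norm_num), div_mul_cancel₀ _ hα.ne', add_neg_cancel, Real.rpow_zero]
  have hB0 : 0 < B := by positivity
  have main : ∀ i, y i ≤ l ^ i * y 0 := by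
    intro i
    induction i with
    | zero => simp
    | succ i ih =>
      have h1 : (y i) ^ α ≤ (l ^ α) ^ i * (y 0) ^ α := by
        refine (Real.rpow_le_rpow (hy i) ih hα.le).trans (le_of_eq ?_)
        rw [Real.mul_rpow (by positivity) (hy 0), ← Real.rpow_natCast, ← Real.rpow_natCast, ← Real.rpow_mul hl0.le,
          ← Real.rpow_mul hl0.le, mul_comm α]
      have hy0 := hy 0
      have hyi := hy i
      calc y (i + 1) ≤ _ := step i
        _ ≤ K * B ^ (i + 1) * ((l ^ α) ^ i * (y 0) ^ α) * (l ^ i * y 0) := by gcongr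
        _ = (K * B * (y 0) ^ α) * (B * l ^ α) ^ i * (l ^ i * y 0) := by rw [mul_pow]; ring
        _ ≤ l * (l ^ i * y 0) := by rw [hlB, one_pow, mul_one]; gcongr
        _ = _ := by ring
  refine tendsto_of_tendsto_of_tendsto_of_le_of_le tendsto_const_nhds ?_ hy main
  simpa using (tendsto_pow_atTop_nhds_zero_of_lt_one hl0.le hl1).mul_const (y 0)

lemma dg_sup (n : ℕ) (hn : 2 ≤ n) (d C₀ C₁ : ℝ) (hC₀ : 1 ≤ C₀) (hC₁ : 1 ≤ C₁) (hd : 0 < d) (hdn : d < (n : ℝ) - 1) :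
    ∃ c : ℝ, 0 < c ∧ ∀ Γ : Set (Euc n), Γ.Nonempty → IsClosed Γ → AhlforsRegular n d C₀ Γ →
      ∀ A : Euc n → Euc n →L[ℝ] Euc n, AEStronglyMeasurable A volume → EllipticOn n d Γ A C₁ →
      ∀ x ∈ Γ, ∀ r : ℝ, 0 < r → ∀ u f F, Data n d Γ A x r u f F → ∀ s t : ℝ, s < t → t ≤ 7 * r / 4 → ∀ M : ℝ, 0 < M →
      c * r ^ ((n : ℝ) - 1 - d) * (YY n d Γ f x 0 t).toReal ≤ M ^ 2 * (t - s) ^ n → ∀ᵐ y, y ∈ ball x s → f y ≤ M := by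
  obtain ⟨c, hc, hst⟩ := dg_step n hn d C₀ C₁ hC₀ hC₁ hd hdn
  have hn0 : (0 : ℝ) < n := by positivity
  set α : ℝ := 2 / (n : ℝ) with hαd
  have hα : 0 < α := by positivity
  set B : ℝ := (4 : ℝ) ^ (1 + α) with hB
  set l : ℝ := (4 : ℝ) ^ (-(1 + α) / α) with hl
  have hl0 : 0 < l := by positivity
  have hB0 : 0 < B := by positivity
  set Q : ℝ := (c * B / l) ^ ((n : ℝ) / 2) with hQ
  have hQ0 : 0 < Q := by positivity
  refine ⟨Q * 2 ^ ((n : ℝ) - 1 - d), by positivity, ?_⟩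
  intro Γ hne hcl hA A hAm hE x hx r hr u f F D s t hts ht M hM hle
  have hp : 0 < t - s := sub_pos.2 hts
  set K : ℕ → ℝ := fun i => M * (1 - (1 / 2) ^ i) with hKd
  set S : ℕ → ℝ := fun i => s + (t - s) * (1 / 2) ^ i with hSd
  set y : ℕ → ℝ := fun i => (YY n d Γ f x (K i) (S i)).toReal with hyd
  have hK0 : ∀ i, 0 ≤ K i := fun i => mul_nonneg hM.le (sub_nonneg.2 (pow_le_one₀ (by norm_num) (by norm_num)))
  set E := (2 * r) ^ ((n : ℝ) - 1 - d) with hEd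
  have hE0 : 0 < E := by positivity
  have hy : ∀ i, 0 ≤ y i := fun i => ENNReal.toReal_nonneg
  have step : ∀ i, y (i + 1) ≤ (c * ((t - s)⁻¹) ^ 2 * (E * (M⁻¹) ^ 2) ^ α) * B ^ (i + 1) * (y i) ^ α * y i := by
    intro i
    have hk : K (i + 1) - K i = M * (1 / 2) ^ (i + 1) := by simp only [hKd]; rw [pow_succ]; ring
    have hs : S i - S (i + 1) = (t - s) * (1 / 2) ^ (i + 1) := by simp only [hSd]; rw [pow_succ]; ring
    have := hst Γ hne hcl hA A hAm hE x hx r hr u f F D (K i) (K (i + 1)) (hK0 i) (by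
      rw [← sub_pos, hk]; positivity) (S (i + 1)) (S i) (by rw [← sub_pos, hs]; positivity) (by
      refine le_trans ?_ ht
      have : (t - s) * (1 / 2) ^ i ≤ (t - s) * 1 := by
        gcongr; exact pow_le_one₀ (by norm_num) (by norm_num)
      simp only [hSd]; linarith)
    rw [hk, hs] at this
    refine this.trans (le_of_eq ?_)
    have e4 : (((1 : ℝ) / 2) ^ (i + 1))⁻¹ ^ 2 = 4 ^ (i + 1) := by
      rw [← inv_pow, ← pow_mul, mul_comm, pow_mul]; norm_num
    have e5 : B ^ (i + 1) = 4 ^ (i + 1) * ((4 : ℝ) ^ (i + 1)) ^ α := by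
      rw [hB, Real.rpow_add (by norm_num), Real.rpow_one, mul_pow]
      congr 1
      rw [← Real.rpow_natCast, ← Real.rpow_natCast, ← Real.rpow_mul (by norm_num), ← Real.rpow_mul (by norm_num), mul_comm α]
    rw [mul_inv, mul_inv, mul_pow, mul_pow, e4, e5,
      show E * (M⁻¹ ^ 2 * 4 ^ (i + 1)) * y i = (E * M⁻¹ ^ 2) * (4 ^ (i + 1) * y i) by ring,
      Real.mul_rpow (by positivity) (mul_nonneg (by positivity) (hy i)), Real.mul_rpow (by positivity) (hy i)]
    ring
  have hy0e : y 0 = (YY n d Γ f x 0 t).toReal := by simp [hyd, hKd, hSd]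
  have h0 : (c * ((t - s)⁻¹) ^ 2 * (E * (M⁻¹) ^ 2) ^ α) * B * (y 0) ^ α ≤ l := by
    have a1 : E * M⁻¹ ^ 2 * y 0 ≤ (t - s) ^ n / Q := by
      rw [le_div_iff₀ hQ0, hy0e]
      have : E = 2 ^ ((n : ℝ) - 1 - d) * r ^ ((n : ℝ) - 1 - d) := by rw [hEd, Real.mul_rpow (by norm_num) hr.le]
      rw [this]
      have := mul_le_mul_of_nonneg_left hle (sq_nonneg M⁻¹)
      rw [← mul_assoc _ (M ^ 2), ← mul_pow, inv_mul_cancel₀ hM.ne', one_pow, one_mul] at this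
      refine le_trans (le_of_eq ?_) this
      ring
    have a2 : (E * M⁻¹ ^ 2 * y 0) ^ α ≤ (t - s) ^ 2 / (c * B / l) := by
      refine (Real.rpow_le_rpow (mul_nonneg (by positivity) (hy 0)) a1 hα.le).trans (le_of_eq ?_)
      rw [Real.div_rpow (by positivity) hQ0.le, hQ, ← Real.rpow_mul (by positivity), ← Real.rpow_natCast, ← Real.rpow_mul hp.le]
      rw [show (n : ℝ) / 2 * α = 1 by rw [hαd]; field_simp, show (n : ℝ) * α = (2 : ℕ) by rw [hαd]; push_cast; field_simp,
        Real.rpow_one, Real.rpow_natCast]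
    rw [Real.mul_rpow (by positivity) (hy 0)] at a2
    calc _ = c * B * ((t - s)⁻¹) ^ 2 * ((E * (M⁻¹) ^ 2) ^ α * (y 0) ^ α) := by ring
      _ ≤ c * B * ((t - s)⁻¹) ^ 2 * ((t - s) ^ 2 / (c * B / l)) := by gcongr
      _ = l := by field_simp
  have lim := dg_iter hα (by positivity) hy step h0
  have hz : YY n d Γ f x M s = 0 := by
    have fin := D.YY_fin hne hcl hA hC₀ hdn hx hr (s := s) hM.le
    refine ((ENNReal.toReal_eq_zero_iff _).1 ?_).resolve_right fin
    refine le_antisymm (ge_of_tendsto' lim fun i => ?_) ENNReal.toReal_nonneg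
    apply ENNReal.toReal_mono (D.YY_fin hne hcl hA hC₀ hdn hx hr (hK0 i))
    apply YY_mono
    · have : 0 ≤ M * (1 / 2) ^ i := by positivity
      simp only [hKd]; linarith
    · have : 0 ≤ (t - s) * (1 / 2) ^ i := by positivity
      simp only [hSd]; linarith
  unfold YY at hz
  rw [lint_m_set _ measurableSet_ball, ← lintegral_indicator measurableSet_ball, lintegral_eq_zero_iff'] at hz
  · filter_upwards [hz, ae_notMem hne hcl hA hC₀ hdn] with z hz hzΓ hzs
    rw [indicator_of_mem hzs, Pi.zero_apply, mul_eq_zero] at hz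
    rcases hz with hz | hz
    · have : max (f z - M) 0 = 0 := by simpa using hz
      linarith [le_max_left (f z - M) 0]
    · exfalso
      rw [dE, ENNReal.ofReal_eq_zero] at hz
      exact absurd hz (not_le.2 (Real.rpow_pos_of_pos (infDist_pos' hne hcl hzΓ) _))
  · exact (((D.wg.pos hM.le).hf.1.enorm.pow_const 2).mul (dE_meas _).aemeasurable).indicator measurableSet_ball

end

section
variable {n : ℕ} {d C₀ C₁ : ℝ} {Γ : Set (Euc n)} {A : Euc n → Euc n →L[ℝ] Euc n}

lemma YY_le_J {x : Euc n} {r : ℝ} {u f : Euc n → ℝ} {F : Euc n → Euc n} (D : Data n d Γ A x r u f F)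
    {p : ℝ} (hp : 0 < p) (hp2 : p ≤ 2) {t S : ℝ} (ht : t ≤ 7 * r / 4) (hS : 0 < S) (hb : ∀ᵐ y, y ∈ ball x t → f y ≤ S) :
    YY n d Γ f x 0 t ≤ ENNReal.ofReal (S ^ (2 - p)) *
      ∫⁻ y in ball x (7 * r / 4), ENNReal.ofReal (f y ^ p) ∂(measW n d Γ) := by
  refine le_trans ?_ (mul_le_mul_right (lintegral_mono_set (ball_subset_ball ht)) _)
  rw [← lintegral_const_mul' _ _ ENNReal.ofReal_ne_top, YY]
  apply lintegral_mono_ae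
  refine (ae_restrict_iff' measurableSet_ball).2 ?_
  filter_upwards [m_ac.ae_le hb, m_ac.ae_le D.nonneg] with y h1 h2 hy
  rw [sub_zero, max_eq_left h2, Real.enorm_of_nonneg h2, ← ENNReal.ofReal_pow h2, ← ENNReal.ofReal_mul (by positivity)]
  apply ENNReal.ofReal_le_ofReal
  rcases eq_or_lt_of_le h2 with h | h
  · rw [← h, Real.zero_rpow hp.ne']; simp
  · have e : f y ^ 2 = f y ^ (2 - p) * f y ^ p := by
      rw [← Real.rpow_add h, ← Real.rpow_natCast]; congr 1; push_cast; ring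
    rw [e]
    gcongr
    exact h1 hy

lemma fin_small (n : ℕ) (hn : 2 ≤ n) (d C₀ C₁ : ℝ) (hC₀ : 1 ≤ C₀) (hC₁ : 1 ≤ C₁) (hd : 0 < d) (hdn : d < (n : ℝ) - 1)
    (p : ℝ) (hp : 0 < p) (hp2 : p ≤ 2) :
    ∃ c : ℝ, 0 < c ∧ ∀ Γ : Set (Euc n), Γ.Nonempty → IsClosed Γ → AhlforsRegular n d C₀ Γ →
      ∀ A : Euc n → Euc n →L[ℝ] Euc n, AEStronglyMeasurable A volume → EllipticOn n d Γ A C₁ →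
      ∀ x ∈ Γ, ∀ r : ℝ, 0 < r → ∀ u f F, Data n d Γ A x r u f F → ∀ Λ : ℝ, 0 < Λ →
      ∫⁻ y in ball x (7 * r / 4), ENNReal.ofReal (f y ^ p) ∂(measW n d Γ) ≤ ENNReal.ofReal (Λ ^ p * r ^ (d + 1)) →
      ∀ᵐ y, y ∈ ball x r → f y ≤ c * Λ := by
  obtain ⟨c, hc, hdg⟩ := dg_sup n hn d C₀ C₁ hC₀ hC₁ hd hdn
  set a : ℝ := (n : ℝ) / p with ha
  set D0 : ℝ := Real.sqrt c * 2 ^ a with hD0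
  have hD : 0 < D0 := by positivity
  set q : ℝ := 1 - p / 2 with hq
  set Ns : ℝ := D0 ^ (2 / p) with hNs
  have hNs0 : 0 < Ns := by positivity
  have hap : a * p = n := by rw [ha]; field_simp
  have hn0 : (0 : ℝ) < n := by positivity
  have ha0 : 0 < a := by positivity
  refine ⟨2 * Ns * (3 / 4 : ℝ) ^ (-a), by positivity, ?_⟩
  intro Γ hne hcl hA A hAm hE x hx r hr u f F D Λ hΛ hJ
  have er : r ^ ((n : ℝ) - 1 - d) * r ^ (d + 1) = r ^ n := by
    rw [← Real.rpow_add hr, ← Real.rpow_natCast]; congr 1; ring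
  let Q : ℝ → Prop := fun N => ∀ s, r ≤ s → s < 7 * r / 4 → ∀ᵐ y, y ∈ ball x s →
    f y ≤ N * Λ * ((7 * r / 4 - s) / r) ^ (-a)
  have init : ∃ N, 0 < N ∧ Q N := by
    set y := (YY n d Γ f x 0 (7 * r / 4)).toReal with hy
    have hy0 : 0 ≤ y := ENNReal.toReal_nonneg
    set X := c * r ^ ((n : ℝ) - 1 - d) * y / (Λ ^ 2 * r ^ n) with hX
    have hX0 : 0 ≤ X := by positivity
    refine ⟨1 + X, by positivity, ?_⟩
    intro s hs hsT
    have hp1 : 0 < 7 * r / 4 - s := by linarith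
    set σ := (7 * r / 4 - s) / r with hσ
    have hσ0 : 0 < σ := by positivity
    have hσ1 : σ ≤ 1 := by rw [hσ, div_le_one hr]; linarith
    apply hdg Γ hne hcl hA A hAm hE x hx r hr u f F D s (7 * r / 4) hsT le_rfl _ (by positivity)
    have e1 : 7 * r / 4 - s = r * σ := by rw [hσ]; field_simp
    have e2 : c * r ^ ((n : ℝ) - 1 - d) * y = X * (Λ ^ 2 * r ^ n) := by rw [hX]; field_simp
    have e3 : 1 ≤ (σ ^ (-a)) ^ 2 * σ ^ n := by
      rw [← Real.rpow_natCast, ← Real.rpow_natCast, ← Real.rpow_mul hσ0.le, ← Real.rpow_add hσ0]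
      apply Real.one_le_rpow_of_pos_of_le_one_of_nonpos hσ0 hσ1
      push_cast
      rw [← hap]; nlinarith
    rw [← hy, e2, e1]
    calc X * (Λ ^ 2 * r ^ n) = X * (Λ ^ 2 * r ^ n) * 1 := by ring
      _ ≤ (1 + X) ^ 2 * (Λ ^ 2 * r ^ n) * ((σ ^ (-a)) ^ 2 * σ ^ n) := by gcongr; nlinarith
      _ = _ := by ring
  have step : ∀ N, 0 < N → Q N → Q (D0 * N ^ q) := by
    intro N hN hQ s hs hsT
    have hp1 : 0 < 7 * r / 4 - s := by linarith
    set σ := (7 * r / 4 - s) / r with hσ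
    have hσ0 : 0 < σ := by positivity
    set t := (s + 7 * r / 4) / 2 with ht
    have hQt := hQ t (by linarith) (by linarith)
    have e0 : (7 * r / 4 - t) / r = σ / 2 := by rw [ht, hσ]; field_simp; ring
    rw [e0] at hQt
    have e1 : t - s = r * (σ / 2) := by rw [ht, hσ]; field_simp; ring
    set e := σ / 2 with he
    have he0 : 0 < e := by positivity
    apply hdg Γ hne hcl hA A hAm hE x hx r hr u f F D s t (by linarith) (by linarith) _ (by positivity)
    have h1 := (YY_le_J D hp hp2 (by linarith : t ≤ 7 * r / 4) (by positivity) hQt).trans (mul_le_mul_right hJ _)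
    rw [← ENNReal.ofReal_mul (by positivity)] at h1
    have h2 := ENNReal.toReal_le_of_le_ofReal (by positivity) h1
    have e2 : D0 * N ^ q * Λ * σ ^ (-a) = Real.sqrt c * N ^ q * Λ * e ^ (-a) := by
      rw [he, Real.div_rpow hσ0.le (by norm_num), Real.rpow_neg (by norm_num : (0 : ℝ) ≤ 2), hD0, div_inv_eq_mul]; ring
    have e3 : (N * Λ * e ^ (-a)) ^ (2 - p) = (N ^ q) ^ 2 * Λ ^ (2 - p) * ((e ^ (-a)) ^ 2 * e ^ n) := by
      rw [Real.mul_rpow (by positivity) (by positivity), Real.mul_rpow hN.le hΛ.le]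
      congr 1
      · congr 1
        rw [← Real.rpow_natCast, ← Real.rpow_mul hN.le]; congr 1; rw [hq]; push_cast; ring
      · rw [← Real.rpow_natCast, ← Real.rpow_natCast, ← Real.rpow_mul he0.le, ← Real.rpow_mul he0.le, ← Real.rpow_add he0]
        congr 1; push_cast; rw [← hap]; ring
    have e4 : Λ ^ (2 - p) * Λ ^ p = Λ ^ 2 := by
      rw [← Real.rpow_add hΛ, ← Real.rpow_natCast]; congr 1; push_cast; ring
    rw [e1, e2]
    calc _ ≤ c * r ^ ((n : ℝ) - 1 - d) * ((N * Λ * e ^ (-a)) ^ (2 - p) * (Λ ^ p * r ^ (d + 1))) := by gcongr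
      _ = c * (r ^ ((n : ℝ) - 1 - d) * r ^ (d + 1)) * (N ^ q) ^ 2 * (Λ ^ (2 - p) * Λ ^ p) * ((e ^ (-a)) ^ 2 * e ^ n) := by
        rw [e3]; ring
      _ = Real.sqrt c ^ 2 * r ^ n * (N ^ q) ^ 2 * Λ ^ 2 * ((e ^ (-a)) ^ 2 * e ^ n) := by rw [er, e4, Real.sq_sqrt hc.le]
      _ = _ := by ring
  obtain ⟨N, hN, hQN⟩ := init
  have iter : ∀ i : ℕ, Q (Ns * (N / Ns) ^ (q ^ i)) := by
    intro i
    induction i with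
    | zero =>
      rw [pow_zero, Real.rpow_one, mul_div_cancel₀ _ hNs0.ne']; exact hQN
    | succ i ih =>
      have := step _ (by positivity) ih
      rw [Real.mul_rpow hNs0.le (by positivity), ← Real.rpow_mul (x := N / Ns) (by positivity), ← pow_succ, ← mul_assoc] at this
      have e : D0 * Ns ^ q = Ns := by
        rw [hNs, ← Real.rpow_mul hD.le]
        nth_rewrite 1 [← Real.rpow_one D0]
        rw [← Real.rpow_add hD]
        congr 1; rw [hq]; field_simp; ring
      rwa [e] at this
  have lim : Tendsto (fun i : ℕ => (N / Ns) ^ (q ^ i)) atTop (𝓝 1) := by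
    have h1 : Tendsto (fun i : ℕ => q ^ i) atTop (𝓝 0) :=
      tendsto_pow_atTop_nhds_zero_of_lt_one (by rw [hq]; linarith) (by rw [hq]; linarith)
    have := (tendsto_const_nhds (x := N / Ns)).rpow h1 (Or.inl (by positivity))
    rwa [Real.rpow_zero] at this
  obtain ⟨i, hi⟩ := (lim.eventually_lt_const (by norm_num : (1 : ℝ) < 2)).exists
  filter_upwards [iter i r le_rfl (by linarith)] with y hy hyb
  refine (hy hyb).trans ?_
  have e : (7 * r / 4 - r) / r = 3 / 4 := by field_simp; ring
  rw [e]
  calc _ ≤ Ns * 2 * Λ * (3 / 4 : ℝ) ^ (-a) := by gcongr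
    _ = _ := by ring

lemma fin_large (n : ℕ) (hn : 2 ≤ n) (d C₀ C₁ : ℝ) (hC₀ : 1 ≤ C₀) (hC₁ : 1 ≤ C₁) (hd : 0 < d) (hdn : d < (n : ℝ) - 1)
    (p : ℝ) (hp2 : 2 ≤ p) :
    ∃ c : ℝ, 0 < c ∧ ∀ Γ : Set (Euc n), Γ.Nonempty → IsClosed Γ → AhlforsRegular n d C₀ Γ →
      ∀ A : Euc n → Euc n →L[ℝ] Euc n, AEStronglyMeasurable A volume → EllipticOn n d Γ A C₁ →
      ∀ x ∈ Γ, ∀ r : ℝ, 0 < r → ∀ u f F, Data n d Γ A x r u f F → ∀ Λ : ℝ, 0 < Λ →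
      ∫⁻ y in ball x (7 * r / 4), ENNReal.ofReal (f y ^ p) ∂(measW n d Γ) ≤ ENNReal.ofReal (Λ ^ p * r ^ (d + 1)) →
      ∀ᵐ y, y ∈ ball x r → f y ≤ c * Λ := by
  obtain ⟨c, hc, hs⟩ := fin_small n hn d C₀ C₁ hC₀ hC₁ hd hdn 2 (by norm_num) le_rfl
  obtain ⟨Cm, hCm, hm⟩ := meas_ball_upper n hn d C₀ hC₀ hdn
  set b : ℝ := 1 / 2 - 1 / p with hb
  have hp : 0 < p := by linarith
  have hb0 : 0 ≤ b := by
    rw [hb, sub_nonneg]; exact one_div_le_one_div_of_le (by norm_num) hp2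
  refine ⟨c * Cm ^ b, by positivity, ?_⟩
  intro Γ hne hcl hA A hAm hE x hx r hr u f F D Λ hΛ hJ
  rw [mul_assoc]
  apply hs Γ hne hcl hA A hAm hE x hx r hr u f F D _ (by positivity)
  have key := eLpNorm'_le_eLpNorm'_mul_rpow_measure_univ (μ := (measW n d Γ).restrict (ball x (7 * r / 4))) (f := f)
    (by norm_num : (0 : ℝ) < 2) hp2 (D.wg.hf.1.mono_ac m_ac).restrict
  have ee : ∀ q : ℝ, ∫⁻ y in ball x (7 * r / 4), ‖f y‖ₑ ^ q ∂(measW n d Γ) =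
      ∫⁻ y in ball x (7 * r / 4), ENNReal.ofReal (f y ^ q) ∂(measW n d Γ) ∨ q ≤ 0 := by
    intro q
    by_cases hq : q ≤ 0
    · exact Or.inr hq
    left
    apply lintegral_congr_ae
    filter_upwards [ae_restrict_of_ae (m_ac.ae_le D.nonneg)] with y hy
    rw [Real.enorm_of_nonneg hy, ENNReal.ofReal_rpow_of_nonneg hy (not_le.1 hq).le]
  rw [eLpNorm', eLpNorm', (ee p).resolve_right (by linarith), (ee 2).resolve_right (by norm_num),
    Measure.restrict_apply_univ, ← hb] at key
  have hm' : measW n d Γ (ball x (7 * r / 4)) ≤ ENNReal.ofReal (Cm * r ^ (d + 1)) :=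
    (measure_mono (ball_subset_ball (by linarith))).trans (hm Γ hne hcl hA x hx r hr)
  have k2 := key.trans (mul_le_mul' (ENNReal.rpow_le_rpow hJ (by positivity)) (ENNReal.rpow_le_rpow hm' hb0))
  rw [ENNReal.ofReal_rpow_of_nonneg (by positivity) (by positivity), ENNReal.ofReal_rpow_of_nonneg (by positivity) hb0,
    ← ENNReal.ofReal_mul (by positivity), one_div, ENNReal.rpow_inv_le_iff (by norm_num),
    ENNReal.ofReal_rpow_of_nonneg (by positivity) (by norm_num)] at k2
  refine k2.trans (le_of_eq ?_)
  congr 1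
  rw [Real.mul_rpow (x := Λ ^ p) (by positivity) (by positivity), Real.mul_rpow (x := Cm) (by positivity) (by positivity),
    ← Real.rpow_mul hΛ.le, mul_one_div_cancel hp.ne', Real.rpow_one, ← Real.rpow_mul hr.le, ← Real.rpow_mul hr.le]
  have e : r ^ ((d + 1) * p⁻¹) * r ^ ((d + 1) * b) = r ^ ((d + 1) * (1 / 2)) := by
    rw [← Real.rpow_add hr]; congr 1; rw [hb]; ring
  have e2 : (r ^ ((d + 1) * (1 / 2))) ^ (2 : ℝ) = r ^ (d + 1) := by
    rw [← Real.rpow_mul hr.le]; congr 1; ring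
  rw [one_div, show Λ * r ^ ((d + 1) * p⁻¹) * (Cm ^ b * r ^ ((d + 1) * b)) =
    Cm ^ b * Λ * (r ^ ((d + 1) * p⁻¹) * r ^ ((d + 1) * b)) by ring, e, Real.mul_rpow (by positivity) (by positivity), e2]

end

/-- the Moser estimate at the boundary, for any exponent `p > 0`. -/
theorem statement14 (n : ℕ) (hn : 2 ≤ n) (d : ℝ) (hd0 : 0 < d) (hdn : d < (n : ℝ) - 1)
    (C₀ C₁ : ℝ) (hC₀ : 1 ≤ C₀) (hC₁ : 1 ≤ C₁) (p : ℝ) (hp : 0 < p) :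
    ∃ C : ℝ, 0 < C ∧
      ∀ Γ : Set (Euc n), Γ.Nonempty → IsClosed Γ → AhlforsRegular n d C₀ Γ →
      ∀ A : Euc n → Euc n →L[ℝ] Euc n, AEStronglyMeasurable A volume →
        EllipticOn n d Γ A C₁ →
      ∀ x ∈ Γ, ∀ r : ℝ, 0 < r →
      ∀ u : Euc n → ℝ, ∀ v : Euc n → Euc n,
        MemWrOn n d Γ (ball x (2 * r)) u →
        IsDistribGradOn u v (ball x (2 * r) \ Γ) →
        (∀ᵐ y ∂(volume.restrict (ball x (2 * r) \ Γ)), 0 ≤ u y) →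
        SubsolOn Γ A v (ball x (2 * r) \ Γ) →
        (∀ᵐ z ∂(μH[d].restrict (Γ ∩ ball x (2 * r))), HasTraceAt u z 0) →
        ∀ᵐ y ∂(volume.restrict (ball x r \ Γ)),
          ENNReal.ofReal (u y) ≤ ENNReal.ofReal C *
            ((∫⁻ z in ball x (2 * r), ENNReal.ofReal (u z ^ p) ∂(measW n d Γ))
              / measW n d Γ (ball x (2 * r))) ^ (1 / p) := by
  obtain ⟨c, hc, hfin⟩ : ∃ c : ℝ, 0 < c ∧ ∀ Γ : Set (Euc n), Γ.Nonempty → IsClosed Γ → AhlforsRegular n d C₀ Γ →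
      ∀ A : Euc n → Euc n →L[ℝ] Euc n, AEStronglyMeasurable A volume → EllipticOn n d Γ A C₁ →
      ∀ x ∈ Γ, ∀ r : ℝ, 0 < r → ∀ u f F, Data n d Γ A x r u f F → ∀ Λ : ℝ, 0 < Λ →
      ∫⁻ y in ball x (7 * r / 4), ENNReal.ofReal (f y ^ p) ∂(measW n d Γ) ≤ ENNReal.ofReal (Λ ^ p * r ^ (d + 1)) →
      ∀ᵐ y, y ∈ ball x r → f y ≤ c * Λ := by
    rcases le_total p 2 with h | h
    · exact fin_small n hn d C₀ C₁ hC₀ hC₁ hd0 hdn p hp h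
    · exact fin_large n hn d C₀ C₁ hC₀ hC₁ hd0 hdn p h
  obtain ⟨Cm, hCm, hm⟩ := meas_ball_upper n hn d C₀ hC₀ hdn
  refine ⟨c * Cm ^ (1 / p), by positivity, ?_⟩
  intro Γ hne hcl hA A hAm hE x hx r hr u v hW hg h0 hs ht
  obtain ⟨f, F, D⟩ := exists_data hn hd0 hdn hC₀ hne hcl hA A hx hr hW hg h0 hs ht
  have hm2 := hm Γ hne hcl hA x hx r hr
  set μ2 := measW n d Γ (ball x (2 * r)) with hμ2
  set I := ∫⁻ z in ball x (2 * r), ENNReal.ofReal (u z ^ p) ∂(measW n d Γ) with hI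
  have hμt : μ2 ≠ ⊤ := ne_top_of_le_ne_top ENNReal.ofReal_ne_top hm2
  by_cases hIt : I = ⊤
  · refine Eventually.of_forall fun y => ?_
    rw [hIt, ENNReal.top_div_of_ne_top hμt, ENNReal.top_rpow_of_pos (by positivity), ENNReal.mul_top]
    · exact le_top
    · exact (ENNReal.ofReal_pos.2 (by positivity)).ne'
  have hJ : ∫⁻ y in ball x (7 * r / 4), ENNReal.ofReal (f y ^ p) ∂(measW n d Γ) ≤ I := by
    rw [setLIntegral_congr_fun measurableSet_ball (g := fun y => ENNReal.ofReal (u y ^ p)) (fun y hy => by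
      simp only [D.eq y hy])]
    exact lintegral_mono_set (ball_subset_ball (by linarith))
  set i := I.toReal with hi
  have hi0 : 0 ≤ i := ENNReal.toReal_nonneg
  have hrd : 0 < r ^ (d + 1) := by positivity
  set L : ℝ := (i / r ^ (d + 1)) ^ (1 / p) with hL
  have hL0 : 0 ≤ L := by positivity
  have hall : ∀ j : ℕ, ∀ᵐ y, y ∈ ball x r → f y ≤ c * (L + eps j) := by
    intro j
    have hj := eps_pos j
    apply hfin Γ hne hcl hA A hAm hE x hx r hr u f F D _ (by positivity)
    refine hJ.trans ?_
    rw [← ENNReal.ofReal_toReal hIt]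
    apply ENNReal.ofReal_le_ofReal
    have : L ^ p ≤ (L + eps j) ^ p := by gcongr; linarith
    rw [hL, ← Real.rpow_mul (by positivity), one_div_mul_cancel hp.ne', Real.rpow_one, ← hL] at this
    rwa [div_le_iff₀ hrd] at this
  rw [ae_restrict_iff' (measurableSet_ball.diff hcl.measurableSet)]
  filter_upwards [ae_all_iff.2 hall] with y hy hyb
  have hle : f y ≤ c * L := by
    have : Tendsto (fun j => c * (L + eps j)) atTop (𝓝 (c * (L + 0))) := (eps_tendsto.const_add L).const_mul c
    rw [add_zero] at this
    exact ge_of_tendsto' this fun j => hy j hyb.1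
  rw [D.eq y (ball_subset_ball (by linarith) hyb.1)] at hle
  refine (ENNReal.ofReal_le_ofReal hle).trans ?_
  rw [ENNReal.ofReal_mul hc.le, ENNReal.ofReal_mul hc.le, mul_assoc]
  gcongr
  rw [hL, ← ENNReal.ofReal_rpow_of_nonneg (by positivity) (by positivity),
    ← ENNReal.ofReal_rpow_of_nonneg hCm.le (by positivity), ← ENNReal.mul_rpow_of_nonneg _ _ (by positivity)]
  gcongr
  rw [div_eq_mul_inv, ENNReal.ofReal_mul hi0, hi, ENNReal.ofReal_toReal hIt, div_eq_mul_inv, mul_left_comm]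
  gcongr
  rw [← div_eq_mul_inv, ENNReal.le_div_iff_mul_le (Or.inr (ENNReal.ofReal_pos.2 hCm).ne') (Or.inl hμt)]
  calc _ ≤ ENNReal.ofReal (r ^ (d + 1))⁻¹ * ENNReal.ofReal (Cm * r ^ (d + 1)) := by gcongr
    _ = ENNReal.ofReal Cm := by
      rw [← ENNReal.ofReal_mul (by positivity)]; congr 1; field_simp
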